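/- Let X ⊆ ℂ^n be a complex algebraic curve. Then X is Lipschitz normally embedded if and only if there exist m ∈ ℕ, a complex algebraic curve Y ⊆ ℂ^m which is Lipschitz normally embedded, and a blow-spherical homeomorphism from X to Y. -/

import Mathlib

open Filter Set Topology

noncomputable section

section TopDefs

variable {α β : Type*} [TopologicalSpace α] [TopologicalSpace β]

/-- `h` restricts to a homeomorphism from `X` onto `Y` (for the subspace topologies). -/
def IsHomeoOn (h : α → β) (X : Set α) (Y : Set β) : Prop :=
  Set.BijOn h X Y ∧ ContinuousOn h X ∧
    ∃ g : β → α, (∀ x ∈ X, g (h x) = x) ∧ (∀ y ∈ Y, h (g y) = y) ∧ ContinuousOn g Y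

/-- `A` is a topological manifold of dimension `d` (charts onto open subsets of `ℝ^d`). -/
def IsTopManifoldOfDim (A : Set α) (d : ℕ) : Prop :=
  ∀ a ∈ A, ∃ W : Set α, IsOpen W ∧ a ∈ W ∧
    ∃ (U : Set (EuclideanSpace ℝ (Fin d))) (f : α → EuclideanSpace ℝ (Fin d)),
      IsOpen U ∧ IsHomeoOn f (A ∩ W) U

/-- The model half-space in `ℝ^d`. -/
def halfSpace (d : ℕ) : Set (EuclideanSpace ℝ (Fin d)) :=
  {u | ∀ hd : 0 < d, 0 ≤ u ⟨0, hd⟩}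

/-- `A` is a topological manifold with boundary of dimension `d`
(charts onto relatively open subsets of the half-space of `ℝ^d`). -/
def IsTopManifoldWithBoundaryOfDim (A : Set α) (d : ℕ) : Prop :=
  ∀ a ∈ A, ∃ W : Set α, IsOpen W ∧ a ∈ W ∧
    ∃ (V : Set (EuclideanSpace ℝ (Fin d))) (f : α → EuclideanSpace ℝ (Fin d)),
      IsOpen V ∧ IsHomeoOn f (A ∩ W) (V ∩ halfSpace d)

end TopDefs

section BlowSpherical

variable {E F : Type*} [NormedAddCommGroup E] [NormedSpace ℝ E]
  [NormedAddCommGroup F] [NormedSpace ℝ F]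

/-- The inverse of the spherical blow-up at `p`, `x ↦ ((x-p)/‖x-p‖, ‖x-p‖)`. -/
def blowupInv (p x : E) : E × ℝ := (‖x - p‖⁻¹ • (x - p), ‖x - p‖)

/-- The inverse of the spherical blow-up at infinity, `x ↦ (x/‖x‖, 1/‖x‖)`. -/
def blowupInvInf (x : E) : E × ℝ := (‖x‖⁻¹ • x, ‖x‖⁻¹)

/-- The strict transform of `X` under the spherical blow-up at `p`. -/
def strictTransform (X : Set E) (p : E) : Set (E × ℝ) := closure (blowupInv p '' (X \ {p}))

/-- The strict transform of `X` under the spherical blow-up at infinity. -/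
def strictTransformInf (X : Set E) : Set (E × ℝ) := closure (blowupInvInf '' (X \ {0}))

/-- The strict transform at `p ∈ E ∪ {∞}`, where `none` stands for `∞`. -/
def strictTransformO (X : Set E) : Option E → Set (E × ℝ)
  | some p => strictTransform X p
  | none => strictTransformInf X

/-- The boundary of a strict transform: the points with second coordinate `0`. -/
def transformBoundary (T : Set (E × ℝ)) : Set (E × ℝ) := {z ∈ T | z.2 = 0}

/-- The filter of neighbourhoods of infinity within `X`. -/
def atInftyOn (X : Set E) : Filter E :=
  Filter.comap (fun x : E => ‖x‖) Filter.atTop ⊓ Filter.principal X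

/-- `q = lim_{x → p} h(x)` where `p ∈ E ∪ {∞}`, `q ∈ F ∪ {∞}` (`none` stands for `∞`). -/
def BSLimit (h : E → F) (X : Set E) : Option E → Option F → Prop
  | some p, some q => Filter.Tendsto h (nhdsWithin p X) (nhds q)
  | some p, none => Filter.Tendsto (fun x => ‖h x‖) (nhdsWithin p X) Filter.atTop
  | none, some q => Filter.Tendsto h (atInftyOn X) (nhds q)
  | none, none => Filter.Tendsto (fun x => ‖h x‖) (atInftyOn X) Filter.atTop

/-- The inverse of the spherical blow-up at `p ∈ E ∪ {∞}`. -/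
def blowupInvO : Option E → E → E × ℝ
  | some p, x => blowupInv p x
  | none, x => blowupInvInf x

/-- `x` is the center of the spherical blow-up at `p ∈ E ∪ {∞}` (at infinity, the center is `0`). -/
def IsCenter : Option E → E → Prop
  | some p, x => x = p
  | none, x => x = 0

/-- `h` is a blow-spherical homeomorphism from `X` onto `Y` at `p ∈ E ∪ {∞}` (with
`q = lim_{x → p} h(x) ∈ F ∪ {∞}`): `h` is a homeomorphism from `X` onto `Y` and the induced map
between the strict transforms extends to a homeomorphism `Φ` of the strict transforms. -/
def IsBSHomeoAtO (h : E → F) (X : Set E) (Y : Set F) (po : Option E) (qo : Option F) : Prop :=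
  IsHomeoOn h X Y ∧ BSLimit h X po qo ∧
    ∃ Φ : E × ℝ → F × ℝ,
      IsHomeoOn Φ (strictTransformO X po) (strictTransformO Y qo) ∧
      ∀ x ∈ X, ¬ IsCenter po x → ¬ IsCenter qo (h x) →
        Φ (blowupInvO po x) = blowupInvO qo (h x)

/-- `h` is a (global) blow-spherical homeomorphism from `X` onto `Y`: it is a blow-spherical
homeomorphism at every `p ∈ closure X ∪ {∞}`. -/
def IsBSHomeo (h : E → F) (X : Set E) (Y : Set F) : Prop :=
  IsHomeoOn h X Y ∧
    (∀ p ∈ closure X, ∃ qo : Option F, IsBSHomeoAtO h X Y (some p) qo) ∧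
    (∃ qo : Option F, IsBSHomeoAtO h X Y none qo)

/-- `X` and `Y` are blow-spherical homeomorphic at infinity: outside suitable compact sets there
is a homeomorphism which is blow-spherical at `∞`. -/
def BSHomeoAtInfinity (X : Set E) (Y : Set F) : Prop :=
  ∃ (K : Set E) (K' : Set F), IsCompact K ∧ IsCompact K' ∧
    ∃ h : E → F, IsBSHomeoAtO h (X \ K) (Y \ K') none none

/-- The tangent cone of `X` at `p`. -/
def tangConeAt (X : Set E) (p : E) : Set E :=
  {v | ∃ (x : ℕ → E) (t : ℕ → ℝ), (∀ i, x i ∈ X) ∧ (∀ i, 0 < t i) ∧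
    Filter.Tendsto x Filter.atTop (nhds p) ∧
    Filter.Tendsto (fun i => (t i)⁻¹ • (x i - p)) Filter.atTop (nhds v)}

/-- The tangent cone of `X` at infinity. -/
def tangConeInf (X : Set E) : Set E :=
  {v | ∃ (x : ℕ → E) (t : ℕ → ℝ), (∀ i, x i ∈ X) ∧ (∀ i, 0 < t i) ∧
    Filter.Tendsto (fun i => ‖x i‖) Filter.atTop Filter.atTop ∧
    Filter.Tendsto (fun i => (t i)⁻¹ • x i) Filter.atTop (nhds v)}

/-- The tangent cone of `X` at `p ∈ E ∪ {∞}`. -/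
def tangConeO (X : Set E) : Option E → Set E
  | some p => tangConeAt X p
  | none => tangConeInf X

/-- `Cone_∞(A) = {t • a : a ∈ A, t ≥ 1}`. -/
def coneInfSet (A : Set E) : Set E := {y | ∃ a ∈ A, ∃ t : ℝ, 1 ≤ t ∧ y = t • a}

/-- The inner distance on `X`: the infimum of lengths of paths in `X` joining `x` to `y`. -/
def innerDist (X : Set E) (x y : E) : ENNReal :=
  ⨅ (γ : ℝ → E) (_ : ContinuousOn γ (Set.Icc 0 1)) (_ : Set.MapsTo γ (Set.Icc 0 1) X)
    (_ : γ 0 = x) (_ : γ 1 = y), eVariationOn γ (Set.Icc 0 1)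

/-- `X` is Lipschitz normally embedded. -/
def IsLNE (X : Set E) : Prop :=
  ∃ c : ℝ, 1 ≤ c ∧ ∀ x ∈ X, ∀ y ∈ X, innerDist X x y ≤ ENNReal.ofReal (c * ‖x - y‖)

/-- `X` is Lipschitz normally embedded at the point `p`. -/
def IsLNEAt (X : Set E) (p : E) : Prop := ∃ U : Set E, IsOpen U ∧ p ∈ U ∧ IsLNE (X ∩ U)

/-- `X` is Lipschitz normally embedded at infinity. -/
def IsLNEAtInf (X : Set E) : Prop := ∃ K : Set E, IsCompact K ∧ IsLNE (X \ K)

/-- `X` and `Y` are outer lipeomorphic. -/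
def OuterLipeo (X : Set E) (Y : Set F) : Prop :=
  ∃ (h : E → F) (lam : ℝ), 1 ≤ lam ∧ Set.BijOn h X Y ∧
    ∀ x ∈ X, ∀ x' ∈ X, lam⁻¹ * ‖x - x'‖ ≤ ‖h x - h x'‖ ∧ ‖h x - h x'‖ ≤ lam * ‖x - x'‖

/-- `X` and `Y` are outer lipeomorphic at infinity. -/
def OuterLipeoAtInf (X : Set E) (Y : Set F) : Prop :=
  ∃ (K : Set E) (K' : Set F), IsCompact K ∧ IsCompact K' ∧ OuterLipeo (X \ K) (Y \ K')

/-- The ends of `C` relative to `R`: the connected components of `C \ {‖x‖ ≤ R}`. -/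
def endsRel (C : Set E) (R : ℝ) : Set (Set E) :=
  {A | ∃ x ∈ C \ Metric.closedBall 0 R, A = connectedComponentIn (C \ Metric.closedBall 0 R) x}

/-- `X` contains a homeomorphic copy of a nonempty open subset of `ℝ^d`. -/
def HasDimGE (X : Set E) (d : ℕ) : Prop :=
  ∃ (U : Set (EuclideanSpace ℝ (Fin d))) (f : EuclideanSpace ℝ (Fin d) → E),
    IsOpen U ∧ U.Nonempty ∧ f '' U ⊆ X ∧ IsHomeoOn f U (f '' U)

/-- `X` has (topological) dimension `d`. -/
def HasDim (X : Set E) (d : ℕ) : Prop := HasDimGE X d ∧ ¬ HasDimGE X (d + 1)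

/-- `x` is a simple point of the boundary of the strict transform `T`, relative to dimension `d`:
near `x`, the connected components of `T` minus the boundary are `d`-dimensional topological
manifolds, and together with the boundary they are topological manifolds with boundary. -/
def IsSimplePointOf (T : Set (E × ℝ)) (d : ℕ) (x : E × ℝ) : Prop :=
  x ∈ transformBoundary T ∧
    ∃ W : Set (E × ℝ), IsOpen W ∧ x ∈ W ∧
      ∀ y ∈ (T ∩ W) \ transformBoundary T,
        IsTopManifoldOfDim (connectedComponentIn ((T ∩ W) \ transformBoundary T) y) d ∧
        IsTopManifoldWithBoundaryOfDim
          (connectedComponentIn ((T ∩ W) \ transformBoundary T) y ∪ (transformBoundary T ∩ W)) d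

/-- `x` is a simple point of the boundary of the strict transform `T` of the set `X`. -/
def IsSimplePoint (X : Set E) (T : Set (E × ℝ)) (x : E × ℝ) : Prop :=
  ∃ d : ℕ, HasDim X d ∧ IsSimplePointOf T d x

/-- The relative multiplicity: for every sufficiently small open neighbourhood `W` of `x`,
the number of connected components of `(T \ ∂T) ∩ W` whose closure contains `x` equals `k`. -/
def RelMultAt (T : Set (E × ℝ)) (x : E × ℝ) (k : ℕ) : Prop :=
  ∃ W₀ : Set (E × ℝ), IsOpen W₀ ∧ x ∈ W₀ ∧
    ∀ W : Set (E × ℝ), IsOpen W → x ∈ W → W ⊆ W₀ →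
      {C : Set (E × ℝ) |
        (∃ y ∈ (T \ transformBoundary T) ∩ W,
          C = connectedComponentIn ((T \ transformBoundary T) ∩ W) y) ∧
        x ∈ closure C}.ncard = k

/-- The relative multiplicity of the end `A` (at infinity) equals `k`: the relative multiplicity
equals `k` on a dense open subset of the boundary of the strict transform at infinity of `A`. -/
def EndMult (A : Set E) (k : ℕ) : Prop :=
  ∃ U : Set (E × ℝ), IsOpen U ∧
    transformBoundary (strictTransformInf A) ⊆
      closure (transformBoundary (strictTransformInf A) ∩ U) ∧
    ∀ x ∈ transformBoundary (strictTransformInf A) ∩ U, RelMultAt (strictTransformInf A) x k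

end BlowSpherical

section Algebraic

/-- `X ⊆ ℝ^n` is semialgebraic. -/
def IsSemialgebraic {n : ℕ} (X : Set (EuclideanSpace ℝ (Fin n))) : Prop :=
  ∃ (m : ℕ) (P : Fin m → MvPolynomial (Fin n) ℝ) (k : Fin m → ℕ)
    (Q : (i : Fin m) → Fin (k i) → MvPolynomial (Fin n) ℝ),
    X = ⋃ i, {x | MvPolynomial.eval (fun j => x j) (P i) = 0 ∧
      ∀ l, 0 < MvPolynomial.eval (fun j => x j) (Q i l)}

/-- The map `h` is semialgebraic on `X`: its graph over `X` is a semialgebraic set. -/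
def IsSemialgebraicMapOn {n m : ℕ} (h : EuclideanSpace ℝ (Fin n) → EuclideanSpace ℝ (Fin m))
    (X : Set (EuclideanSpace ℝ (Fin n))) : Prop :=
  IsSemialgebraic { z : EuclideanSpace ℝ (Fin (n + m)) |
    ∃ x ∈ X, (∀ i : Fin n, z (Fin.castAdd m i) = x i) ∧ ∀ j : Fin m, z (Fin.natAdd n j) = h x j }

/-- `γ` is a continuous semialgebraic arc on `(ε, ∞)`. -/
def IsSemialgebraicArc {n : ℕ} (γ : ℝ → EuclideanSpace ℝ (Fin n)) (ε : ℝ) : Prop :=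
  ContinuousOn γ (Set.Ioi ε) ∧
  IsSemialgebraic { z : EuclideanSpace ℝ (Fin (1 + n)) |
    ∃ t ∈ Set.Ioi ε, z (Fin.castAdd n 0) = t ∧ ∀ j : Fin n, z (Fin.natAdd 1 j) = γ t j }

/-- `X ⊆ ℂ^n` is a complex algebraic set. -/
def IsComplexAlgebraic {n : ℕ} (X : Set (EuclideanSpace ℂ (Fin n))) : Prop :=
  ∃ (m : ℕ) (P : Fin m → MvPolynomial (Fin n) ℂ),
    X = {x | ∀ i, MvPolynomial.eval (fun j => x j) (P i) = 0}

/-- `X` is an irreducible complex algebraic set. -/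
def IsIrreducibleAlg {n : ℕ} (X : Set (EuclideanSpace ℂ (Fin n))) : Prop :=
  X.Nonempty ∧ IsComplexAlgebraic X ∧
    ∀ A B : Set (EuclideanSpace ℂ (Fin n)),
      IsComplexAlgebraic A → IsComplexAlgebraic B → X = A ∪ B → X = A ∨ X = B

/-- `C` is an irreducible component of `X`: a maximal irreducible algebraic subset of `X`. -/
def IsIrredComponent {n : ℕ} (C X : Set (EuclideanSpace ℂ (Fin n))) : Prop :=
  IsIrreducibleAlg C ∧ C ⊆ X ∧
    ∀ C' : Set (EuclideanSpace ℂ (Fin n)), IsIrreducibleAlg C' → C' ⊆ X → C ⊆ C' → C = C'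

/-- The (Krull) dimension of the algebraic set `C` equals `d`: there is a strictly increasing
chain of `d+1` irreducible algebraic sets ending in `C`, and no such chain of `d+2` sets. -/
def HasAlgDim {n : ℕ} (C : Set (EuclideanSpace ℂ (Fin n))) (d : ℕ) : Prop :=
  (∃ f : Fin (d + 1) → Set (EuclideanSpace ℂ (Fin n)),
    (∀ i, IsIrreducibleAlg (f i)) ∧ StrictMono f ∧ f (Fin.last d) = C) ∧
  ¬ ∃ f : Fin (d + 2) → Set (EuclideanSpace ℂ (Fin n)),
    (∀ i, IsIrreducibleAlg (f i)) ∧ StrictMono f ∧ f (Fin.last (d + 1)) = C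

/-- `X ⊆ ℂ^n` is a complex algebraic curve: a nonempty complex algebraic set all of whose
irreducible components have complex dimension 1. -/
def IsComplexAlgebraicCurve {n : ℕ} (X : Set (EuclideanSpace ℂ (Fin n))) : Prop :=
  IsComplexAlgebraic X ∧ X.Nonempty ∧ ∀ C, IsIrredComponent C X → HasAlgDim C 1

/-- `X ⊆ ℂ^n` is a pure dimensional complex algebraic set. -/
def IsPureDimComplexAlgebraic {n : ℕ} (X : Set (EuclideanSpace ℂ (Fin n))) : Prop :=
  IsComplexAlgebraic X ∧ X.Nonempty ∧ ∃ d, ∀ C, IsIrredComponent C X → HasAlgDim C d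

/-- `S` is a 1-dimensional complex submanifold: locally the image of a holomorphic embedding,
with nowhere-vanishing derivative, of an open subset of `ℂ`. -/
def IsOneDimComplexSubmanifold {n : ℕ} (S : Set (EuclideanSpace ℂ (Fin n))) : Prop :=
  ∀ z ∈ S, ∃ (W : Set (EuclideanSpace ℂ (Fin n))) (V : Set ℂ)
    (f : ℂ → EuclideanSpace ℂ (Fin n)),
    IsOpen W ∧ z ∈ W ∧ IsOpen V ∧ DifferentiableOn ℂ f V ∧ Set.InjOn f V ∧
    (∀ t ∈ V, derivWithin f V t ≠ 0) ∧ f '' V = S ∩ W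

/-- The set of singular points of `X ⊆ ℂ^n`. -/
def SingSet {n : ℕ} (X : Set (EuclideanSpace ℂ (Fin n))) : Set (EuclideanSpace ℂ (Fin n)) :=
  {p ∈ X | ¬ ∃ U : Set (EuclideanSpace ℂ (Fin n)), IsOpen U ∧ p ∈ U ∧
    IsOneDimComplexSubmanifold (X ∩ U)}

/-- The embedding `ι : ℂ^n → ℙ^n(ℂ)`, `x ↦ [1 : x]`. -/
def projIota {n : ℕ} (x : EuclideanSpace ℂ (Fin n)) : Projectivization ℂ (Fin (n + 1) → ℂ) :=
  Projectivization.mk ℂ (Fin.cons 1 (fun j => x j)) (by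
    intro hzero
    have h0 := congrFun hzero 0
    simp at h0)

end Algebraic

open scoped ComplexConjugate

/-- The algebraic subset of `ℂ^n` cut out by an ideal. -/
def zeroSet {n : ℕ} (I : Ideal (MvPolynomial (Fin n) ℂ)) : Set (EuclideanSpace ℂ (Fin n)) :=
  {x | ∀ p ∈ I, MvPolynomial.eval (fun j => x j) p = 0}

/-- The ideal of polynomials vanishing on a subset of `ℂ^n`. -/
def vanIdeal {n : ℕ} (A : Set (EuclideanSpace ℂ (Fin n))) : Ideal (MvPolynomial (Fin n) ℂ) where
  carrier := {p | ∀ x ∈ A, MvPolynomial.eval (fun j => x j) p = 0}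
  zero_mem' _ _ := map_zero _
  add_mem' {p q} hp hq x hx := by simp only [hq x hx, hp x hx, add_zero, map_add]
  smul_mem' p q hq x hx := by simp only [hq x hx, smul_eq_mul, mul_zero, map_mul]

theorem zeroSet_anti {n : ℕ} {I J : Ideal (MvPolynomial (Fin n) ℂ)} (h : I ≤ J) :
    zeroSet J ⊆ zeroSet I := fun _ hx p hp => hx p (h hp)

theorem vanIdeal_anti {n : ℕ} {A B : Set (EuclideanSpace ℂ (Fin n))} (h : A ⊆ B) :
    vanIdeal B ≤ vanIdeal A := fun _ hp x hx => hp x (h hx)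

theorem isComplexAlgebraic_zeroSet {n : ℕ} (I : Ideal (MvPolynomial (Fin n) ℂ)) :
    IsComplexAlgebraic (zeroSet I) := by
  obtain ⟨m, P, hP⟩ := Submodule.fg_iff_exists_fin_generating_family.1
    (IsNoetherian.noetherian I)
  refine ⟨m, P, ?_⟩
  ext x
  constructor
  · intro hx i
    exact hx _ (hP ▸ Submodule.subset_span ⟨i, rfl⟩)
  · intro hx p hp
    have : I ≤ vanIdeal {x} := by
      rw [← hP]
      refine Submodule.span_le.2 ?_
      rintro _ ⟨i, rfl⟩ y hy
      rw [Set.mem_singleton_iff.1 hy]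
      exact hx i
    exact this hp x rfl

theorem zeroSet_vanIdeal {n : ℕ} {A : Set (EuclideanSpace ℂ (Fin n))}
    (hA : IsComplexAlgebraic A) : zeroSet (vanIdeal A) = A := by
  obtain ⟨m, P, rfl⟩ := hA
  ext x
  constructor
  · intro hx i
    exact hx _ fun y hy => hy i
  · intro hx p hp
    exact hp x hx

theorem vanIdeal_zeroSet {n : ℕ} (I : Ideal (MvPolynomial (Fin n) ℂ)) [hI : I.IsPrime] :
    vanIdeal (zeroSet I) = I := by
  have h := MvPolynomial.IsPrime.vanishingIdeal_zeroLocus (K := ℂ) I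
  refine le_antisymm (fun p hp => ?_) fun p hp x hx => hx p hp
  rw [← h]
  intro x hx
  exact hp (WithLp.toLp 2 x) fun q hq => hx q hq

theorem isIrreducibleAlg_zeroSet {n : ℕ} (I : Ideal (MvPolynomial (Fin n) ℂ))
    [hI : I.IsPrime] : IsIrreducibleAlg (zeroSet I) := by
  refine ⟨?_, isComplexAlgebraic_zeroSet I, ?_⟩
  · by_contra h
    rw [Set.not_nonempty_iff_eq_empty] at h
    have h1 := vanIdeal_zeroSet I
    rw [h] at h1
    apply hI.ne_top
    rw [← h1]
    exact eq_top_iff.2 fun p _ x hx => hx.elim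
  · intro A B hA hB hAB
    by_contra! hc
    have key : ∀ C : Set (EuclideanSpace ℂ (Fin n)), IsComplexAlgebraic C → C ⊆ zeroSet I →
        zeroSet I ≠ C → ∃ p ∈ vanIdeal C, p ∉ I := by
      intro C hC hCI hne
      by_contra! hc
      exact hne (Set.Subset.antisymm (by
        rw [← zeroSet_vanIdeal hC]; exact zeroSet_anti hc) hCI)
    obtain ⟨p, hp, hpI⟩ := key A hA (hAB ▸ Set.subset_union_left) hc.1
    obtain ⟨q, hq, hqI⟩ := key B hB (hAB ▸ Set.subset_union_right) hc.2
    have : p * q ∈ vanIdeal (zeroSet I) := by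
      intro x hx
      rw [hAB] at hx
      rcases hx with hx | hx
      · simp [hp x hx]
      · simp [hq x hx]
    rw [vanIdeal_zeroSet] at this
    exact (hI.mem_or_mem this).elim hpI hqI

theorem isPrime_vanIdeal {n : ℕ} {C : Set (EuclideanSpace ℂ (Fin n))}
    (hC : IsIrreducibleAlg C) : (vanIdeal C).IsPrime := by
  obtain ⟨⟨x₀, hx₀⟩, hCa, hCi⟩ := hC
  refine ⟨fun h => ?_, fun {p q} hpq => ?_⟩
  · have : (1 : MvPolynomial (Fin n) ℂ) ∈ vanIdeal C := h ▸ Submodule.mem_top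
    simpa using this x₀ hx₀
  · have key : C = zeroSet (vanIdeal C ⊔ Ideal.span {p}) ∪ zeroSet (vanIdeal C ⊔ Ideal.span {q}) := by
      apply Set.Subset.antisymm
      · intro x hx
        have h0 := hpq x hx
        rw [map_mul, mul_eq_zero] at h0
        refine h0.imp (fun h => ?_) (fun h => ?_) <;>
        · have : vanIdeal C ⊔ Ideal.span {_} ≤ vanIdeal {x} := sup_le
            (vanIdeal_anti (by simpa using hx))
            ((Ideal.span_singleton_le_iff_mem _).2 (by
              intro y hy; rw [Set.mem_singleton_iff.1 hy]; exact h))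
          exact fun r hr => this hr x rfl
      · have h3 := zeroSet_vanIdeal hCa
        refine Set.union_subset ?_ ?_ <;>
        · conv_rhs => rw [← h3]
          exact zeroSet_anti le_sup_left
    have hm : ∀ r, C = zeroSet (vanIdeal C ⊔ Ideal.span {r}) → r ∈ vanIdeal C := by
      intro r hr x hx
      rw [hr] at hx
      exact hx r (Ideal.mem_sup_right (Ideal.mem_span_singleton_self r))
    exact (hCi _ _ (isComplexAlgebraic_zeroSet _) (isComplexAlgebraic_zeroSet _) key).imp
      (hm p) (hm q)

theorem isIrredComponent_zeroSet {n : ℕ} {X : Set (EuclideanSpace ℂ (Fin n))}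
    (hX : IsComplexAlgebraic X) {I : Ideal (MvPolynomial (Fin n) ℂ)}
    (hI : I ∈ (vanIdeal X).minimalPrimes) : IsIrredComponent (zeroSet I) X := by
  have hp : I.IsPrime := hI.1.1
  refine ⟨isIrreducibleAlg_zeroSet I, ?_, ?_⟩
  · rw [← zeroSet_vanIdeal hX]
    exact zeroSet_anti hI.1.2
  · intro C' hC' hC'X hle
    have h1 : vanIdeal C' ≤ I := by
      rw [← vanIdeal_zeroSet I]; exact vanIdeal_anti hle
    have h2 : I ≤ vanIdeal C' := hI.2 ⟨isPrime_vanIdeal hC', vanIdeal_anti hC'X⟩ h1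
    rw [← zeroSet_vanIdeal hC'.2.1, le_antisymm h1 h2]

theorem noether_rank_le_one {n : ℕ} (I : Ideal (MvPolynomial (Fin n) ℂ)) [hI : I.IsPrime]
    (hd : HasAlgDim (zeroSet I) 1) {s : ℕ}
    (g : MvPolynomial (Fin s) ℂ →ₐ[ℂ] (MvPolynomial (Fin n) ℂ ⧸ I))
    (hg : Function.Injective g) (hgi : g.IsIntegral) : s ≤ 1 := by
  by_contra! hs
  apply hd.2
  algebraize [g.toRingHom]
  have hinj : Function.Injective (algebraMap (MvPolynomial (Fin s) ℂ)
    (MvPolynomial (Fin n) ℂ ⧸ I)) := hg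
  have hdim : ((2 : ℕ) : WithBot ℕ∞) ≤ ringKrullDim (MvPolynomial (Fin s) ℂ) := by
    rw [MvPolynomial.ringKrullDim_of_isNoetherianRing]
    simp
    exact_mod_cast hs
  obtain ⟨l, hl⟩ := Order.le_krullDim_iff.1 hdim
  have := l.head.isPrime
  obtain ⟨Q, -, hQp, hQ⟩ := Ideal.exists_ideal_over_prime_of_isIntegral
    (S := MvPolynomial (Fin n) ℂ ⧸ I) l.head.asIdeal ⊥ (by
      rw [Ideal.comap_bot_of_injective _ hinj]; exact bot_le)
  have : Q.LiesOver l.head.asIdeal := ⟨hQ.symm⟩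
  obtain ⟨L, hL, -, -⟩ := Ideal.exists_ltSeries_of_hasGoingUp l Q
  rw [hl] at hL
  have hsm : StrictMono L := L.strictMono
  have h3 : ∀ i : Fin 3, (i : ℕ) < L.length + 1 := fun i => by omega
  let J : Fin 3 → Ideal (MvPolynomial (Fin n) ℂ) := fun i =>
    (L ⟨i, h3 i⟩).asIdeal.comap (Ideal.Quotient.mk I)
  have hJp : ∀ i, (J i).IsPrime := fun i =>
    have := (L ⟨i, h3 i⟩).isPrime
    Ideal.comap_isPrime _ _
  have hJlt : ∀ i j, i < j → J i < J j := by
    intro i j hij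
    have : (L ⟨i, h3 i⟩).asIdeal < (L ⟨j, h3 j⟩).asIdeal := hsm (Fin.mk_lt_mk.2 hij)
    refine lt_of_le_of_ne (Ideal.comap_mono this.le) fun h => this.ne ?_
    exact Ideal.comap_injective_of_surjective _ Ideal.Quotient.mk_surjective h
  have hJI : ∀ i, I ≤ J i := fun i p hp => by
    change Ideal.Quotient.mk I p ∈ (L ⟨i, h3 i⟩).asIdeal
    rw [Ideal.Quotient.eq_zero_iff_mem.2 hp]
    exact zero_mem _
  have hz : ∀ A B : Ideal (MvPolynomial (Fin n) ℂ), A.IsPrime → B.IsPrime → A < B →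
      zeroSet B < zeroSet A := by
    intro A B hA hB hAB
    refine lt_of_le_of_ne (zeroSet_anti hAB.le) fun h => hAB.ne ?_
    rw [← vanIdeal_zeroSet A, ← vanIdeal_zeroSet B, h]
  have hI1 : I < J 1 := lt_of_le_of_lt (hJI 0) (hJlt 0 1 (by decide))
  refine ⟨![zeroSet (J 2), zeroSet (J 1), zeroSet I], ?_, ?_, rfl⟩
  · intro i
    have := hJp
    fin_cases i
    · exact isIrreducibleAlg_zeroSet (J 2)
    · exact isIrreducibleAlg_zeroSet (J 1)
    · exact isIrreducibleAlg_zeroSet I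
  · rw [Fin.strictMono_iff_lt_succ]
    intro i
    fin_cases i
    · exact hz _ _ (hJp 1) (hJp 2) (hJlt 1 2 (by decide))
    · exact hz _ _ hI (hJp 1) hI1

theorem exists_relation_of_hasAlgDim_one {n : ℕ} (I : Ideal (MvPolynomial (Fin n) ℂ))
    [hI : I.IsPrime] (hd : HasAlgDim (zeroSet I) 1) (i j : Fin n) :
    ∃ P : Polynomial (Polynomial ℂ), P ≠ 0 ∧ ∀ x ∈ zeroSet I, P.evalEval (x i) (x j) = 0 := by
  obtain ⟨s, -, g, hg, hgi⟩ := exists_integral_inj_algHom_of_quotient I hI.ne_top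
  have hs := noether_rank_le_one I hd g hg hgi
  have htr : Algebra.trdeg ℂ (MvPolynomial (Fin n) ℂ ⧸ I) = s := by
    algebraize [g.toRingHom]
    have hinj : Function.Injective (algebraMap (MvPolynomial (Fin s) ℂ)
      (MvPolynomial (Fin n) ℂ ⧸ I)) := hg
    have : FaithfulSMul (MvPolynomial (Fin s) ℂ) (MvPolynomial (Fin n) ℂ ⧸ I) :=
      (faithfulSMul_iff_algebraMap_injective _ _).2 hinj
    have : IsScalarTower ℂ (MvPolynomial (Fin s) ℂ) (MvPolynomial (Fin n) ℂ ⧸ I) :=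
      IsScalarTower.of_algebraMap_eq fun c => (g.commutes c).symm
    have : Algebra.IsIntegral (MvPolynomial (Fin s) ℂ) (MvPolynomial (Fin n) ℂ ⧸ I) := ⟨hgi⟩
    rw [← trdeg_add_eq ℂ (MvPolynomial (Fin s) ℂ), MvPolynomial.trdeg_of_isDomain,
      trdeg_eq_zero]
    simp
  let a : Fin 2 → (MvPolynomial (Fin n) ℂ ⧸ I) :=
    ![Ideal.Quotient.mk I (.X i), Ideal.Quotient.mk I (.X j)]
  have hna : ¬ AlgebraicIndependent ℂ a := by
    intro h
    have := h.lift_cardinalMk_le_trdeg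
    rw [htr] at this
    simp at this
    have h2 : (2 : ℕ) ≤ s := by exact_mod_cast this
    omega
  rw [algebraicIndependent_iff] at hna
  push Not at hna
  obtain ⟨p, hp, hp0⟩ := hna
  refine ⟨(Polynomial.Bivariate.equivMvPolynomial ℂ).symm p, by simpa using hp0, ?_⟩
  intro x hx
  have h1 : (Polynomial.evalEval (x i) (x j)
      ((Polynomial.Bivariate.equivMvPolynomial ℂ).symm p)) = MvPolynomial.aeval ![x i, x j] p := by
    rw [← Polynomial.coe_aevalAeval_eq_evalEval]
    have : (Polynomial.aevalAeval (x i) (x j)).comp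
      ((Polynomial.Bivariate.equivMvPolynomial ℂ).symm.toAlgHom) =
      MvPolynomial.aeval ![x i, x j] := by
      ext k; fin_cases k <;> simp
    exact DFunLike.congr_fun this p
  rw [h1]
  have h2 : (MvPolynomial.aeval ![MvPolynomial.X i, MvPolynomial.X j] p :
      MvPolynomial (Fin n) ℂ) ∈ I := by
    rw [← Ideal.Quotient.eq_zero_iff_mem, ← hp]
    have : ((Ideal.Quotient.mkₐ ℂ I).comp (MvPolynomial.aeval ![MvPolynomial.X i, MvPolynomial.X j]))
        = MvPolynomial.aeval a := by
      ext k; fin_cases k <;> simp [a]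
    exact DFunLike.congr_fun this p
  have h3 := hx _ h2
  have h4 : ((MvPolynomial.aeval (fun j => x j)).comp
      (MvPolynomial.aeval ![MvPolynomial.X i, MvPolynomial.X j]) :
      MvPolynomial (Fin 2) ℂ →ₐ[ℂ] ℂ) = MvPolynomial.aeval ![x i, x j] := by
    ext k; fin_cases k <;> simp
  rw [← h4]
  exact h3

/-- Any two coordinates on a complex algebraic curve satisfy a nontrivial polynomial relation. -/
theorem IsComplexAlgebraicCurve.exists_relation {n : ℕ} {X : Set (EuclideanSpace ℂ (Fin n))}
    (hX : IsComplexAlgebraicCurve X) (i j : Fin n) :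
    ∃ P : Polynomial (Polynomial ℂ), P ≠ 0 ∧ ∀ x ∈ X, P.evalEval (x i) (x j) = 0 := by
  have hfin := Ideal.finite_minimalPrimes_of_isNoetherianRing _ (vanIdeal X)
  have hex : ∀ I : Ideal (MvPolynomial (Fin n) ℂ), ∃ P : Polynomial (Polynomial ℂ), P ≠ 0 ∧
      (I ∈ (vanIdeal X).minimalPrimes → ∀ x ∈ zeroSet I, P.evalEval (x i) (x j) = 0) := by
    intro I
    by_cases hI : I ∈ (vanIdeal X).minimalPrimes
    · have : I.IsPrime := hI.1.1
      obtain ⟨P, h1, h2⟩ := exists_relation_of_hasAlgDim_one I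
        (hX.2.2 _ (isIrredComponent_zeroSet hX.1 hI)) i j
      exact ⟨P, h1, fun _ => h2⟩
    · exact ⟨1, one_ne_zero, fun h => absurd h hI⟩
  choose P hP0 hP using hex
  refine ⟨∏ I ∈ hfin.toFinset, P I, Finset.prod_ne_zero_iff.2 fun I _ => hP0 I, ?_⟩
  intro x hx
  have hp : (vanIdeal {x}).IsPrime := isPrime_vanIdeal
    ⟨⟨x, rfl⟩, by
      have : ({x} : Set (EuclideanSpace ℂ (Fin n))) = zeroSet (vanIdeal {x}) := by
        refine Set.Subset.antisymm (by rintro y rfl p hp; exact hp y rfl) ?_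
        intro y hy
        rw [Set.mem_singleton_iff]
        ext k
        have := hy (MvPolynomial.X k - MvPolynomial.C (x k)) (by
          intro z hz; rw [Set.mem_singleton_iff.1 hz]; simp)
        simpa [sub_eq_zero] using this
      rw [this]; exact isComplexAlgebraic_zeroSet _, by
      intro A B _ _ h
      rcases Set.subset_singleton_iff_eq.1 (h ▸ Set.subset_union_left : A ⊆ {x}) with hA | hA
      · right; rw [h, hA, Set.empty_union]
      · left; exact hA.symm⟩
  obtain ⟨I, hI, hIx⟩ := Ideal.exists_minimalPrimes_le
    (vanIdeal_anti (Set.singleton_subset_iff.2 hx) : vanIdeal X ≤ vanIdeal {x})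
  rw [Polynomial.evalEval_prod]
  exact Finset.prod_eq_zero (hfin.mem_toFinset.2 hI)
    (hP I hI x fun p hp => hIx hp x rfl)

open Polynomial in
/-- A bivariate polynomial can be replaced, outside finitely many values of the first variable,
by one whose zeros in the second variable are simple. -/
theorem exists_separable_relation {P : ℂ[X][X]} (hP : P ≠ 0) :
    ∃ (Q : ℂ[X][X]) (B : Set ℂ), B.Finite ∧ ∀ t, t ∉ B → ∀ s, P.evalEval t s = 0 →
      Q.evalEval t s = 0 ∧ (derivative Q).evalEval t s ≠ 0 := by
  classical
  let K := FractionRing ℂ[X]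
  let ι : ℂ[X] →+* K := algebraMap ℂ[X] K
  have hι : Function.Injective ι := IsFractionRing.injective ℂ[X] K
  have hmap : Function.Injective (Polynomial.map ι) := Polynomial.map_injective ι hι
  let M := nonZeroDivisors ℂ[X]
  have clear : ∀ U : K[X], ∃ (b : ℂ[X]) (V : ℂ[X][X]), b ≠ 0 ∧ V.map ι = C (ι b) * U := by
    intro U
    obtain ⟨b, hbM, hb⟩ := IsLocalization.integerNormalization_spec M U
    refine ⟨b, IsLocalization.integerNormalization M U, nonZeroDivisors.ne_zero hbM, ?_⟩
    rw [hb, Algebra.smul_def]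
    rfl
  have hPK : P.map ι ≠ 0 := (Polynomial.map_ne_zero_iff hι).2 hP
  set R := UniqueFactorizationMonoid.radical (P.map ι) with hR
  obtain ⟨N, W, hW⟩ := (UniqueFactorizationMonoid.exists_dvd_pow_iff_radical_dvd (b := R) hPK).2
    dvd_rfl
  have hsep : R.Separable := PerfectField.separable_iff_squarefree.2
    UniqueFactorizationMonoid.squarefree_radical
  obtain ⟨U, V, hUV⟩ := hsep
  obtain ⟨q, Q, hq, hQ⟩ := clear R
  obtain ⟨w, W', hw, hW'⟩ := clear W
  obtain ⟨u, U', hu, hU'⟩ := clear U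
  obtain ⟨v, V', hv, hV'⟩ := clear V
  have e1 : C w * Q ^ N = C (q ^ N) * (P * W') := by
    apply hmap
    simp only [Polynomial.map_mul, Polynomial.map_pow, map_C, hQ, hW', mul_pow, map_pow]
    rw [hW]; ring
  have e2 : C (u * v * q) = C v * U' * Q + C u * V' * derivative Q := by
    apply hmap
    have : (derivative Q).map ι = C (ι q) * derivative R := by
      rw [← derivative_map, hQ, derivative_C_mul]
    simp only [Polynomial.map_mul, Polynomial.map_add, map_C, hQ, hU', hV', this, map_mul]
    linear_combination - C (ι u) * C (ι v) * C (ι q) * hUV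
  refine ⟨Q, {t | (w * (u * v * q)).IsRoot t},
    Polynomial.finite_setOfPred_isRoot (by positivity), ?_⟩
  intro t ht s hs
  rw [Set.mem_ofPred_eq, IsRoot, eval_mul, mul_eq_zero, not_or] at ht
  have hQ0 : Q.evalEval t s = 0 := by
    have := congrArg (evalEval t s) e1
    simp only [evalEval_mul, evalEval_C, evalEval_pow, hs, zero_mul, mul_zero] at this
    exact eq_zero_of_pow_eq_zero ((mul_eq_zero.1 this).resolve_left ht.1)
  refine ⟨hQ0, fun h => ht.2 ?_⟩
  have := congrArg (evalEval t s) e2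
  simpa [evalEval_mul, evalEval_C, evalEval_add, hQ0, h] using this

open Polynomial in
theorem contDiff_evalEval (P : ℂ[X][X]) {k : WithTop ℕ∞} :
    ContDiff ℂ k fun v : ℂ × ℂ => P.evalEval v.1 v.2 := by
  induction P using Polynomial.induction_on' with
  | add p q hp hq => simpa [evalEval_add] using hp.add hq
  | monomial m a =>
    simp only [evalEval, eval_monomial, eval_mul, eval_pow, eval_C]
    exact ((Polynomial.contDiff_aeval a k).comp contDiff_fst).mul (contDiff_snd.pow m)

open Polynomial in
theorem hasDerivAt_evalEval (P : ℂ[X][X]) (t s : ℂ) :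
    HasDerivAt (fun s => P.evalEval t s) ((derivative P).evalEval t s) s := by
  have h1 : ∀ P : ℂ[X][X], ∀ s, P.evalEval t s = (P.map (evalRingHom t)).eval s := by
    intro P s; rw [map_evalRingHom_eval]
  simp only [h1, ← derivative_map]
  exact Polynomial.hasDerivAt _ _

open Polynomial in
/-- Outside finitely many `t₀`, the zeros of a bivariate polynomial are locally contained in the
graph of an analytic function. -/
theorem exists_local_root {P : ℂ[X][X]} (hP : P ≠ 0) :
    ∃ B : Set ℂ, B.Finite ∧ ∀ t₀, t₀ ∉ B → ∀ s₀, P.evalEval t₀ s₀ = 0 →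
      ∃ φ : ℂ → ℂ, AnalyticAt ℂ φ t₀ ∧ φ t₀ = s₀ ∧
        ∀ᶠ v : ℂ × ℂ in 𝓝 (t₀, s₀), P.evalEval v.1 v.2 = 0 → φ v.1 = v.2 := by
  obtain ⟨Q, B, hB, hQ⟩ := exists_separable_relation hP
  refine ⟨B, hB, fun t₀ ht₀ s₀ hs₀ => ?_⟩
  obtain ⟨hQ0, hQ1⟩ := hQ t₀ ht₀ s₀ hs₀
  set f : ℂ × ℂ → ℂ := fun v => Q.evalEval v.1 v.2 with hf
  have cdf : ContDiffAt ℂ ⊤ f (t₀, s₀) := (contDiff_evalEval Q).contDiffAt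
  have hval : (fderiv ℂ f (t₀, s₀) ∘L .inr ℂ ℂ ℂ) 1 = (derivative Q).evalEval t₀ s₀ := by
    have h1 : HasFDerivAt f (fderiv ℂ f (t₀, s₀)) (t₀, s₀) :=
      (cdf.differentiableAt (by simp)).hasFDerivAt
    have h2 : HasDerivAt (fun s : ℂ => (t₀, s)) ((0 : ℂ), (1 : ℂ)) s₀ :=
      (hasDerivAt_const s₀ t₀).prodMk (hasDerivAt_id s₀)
    have h3 := h1.comp_hasDerivAt s₀ h2
    have := h3.unique (hasDerivAt_evalEval Q t₀ s₀)
    simpa using this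
  have if₂ : (fderiv ℂ f (t₀, s₀) ∘L .inr ℂ ℂ ℂ).IsInvertible := by
    refine ⟨ContinuousLinearEquiv.unitsEquivAut ℂ (Units.mk0 _ hQ1), ?_⟩
    ext
    simp [← hval]
  refine ⟨cdf.implicitFunction (by simp) if₂,
    (cdf.contDiffAt_implicitFunction (by simp) if₂).analyticAt,
    cdf.implicitFunction_apply_self (by simp) if₂, ?_⟩
  have hB' : ∀ᶠ v : ℂ × ℂ in 𝓝 (t₀, s₀), v.1 ∉ B :=
    continuous_fst.continuousAt.eventually (hB.isClosed.compl_mem_nhds ht₀)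
  filter_upwards [cdf.eventually_apply_eq_iff_implicitFunction (by simp) if₂, hB'] with v h1 h2 h3
  refine h1.1 ?_
  rw [hf]
  simp only
  rw [(hQ _ h2 _ h3).1, hQ0]

/-- The analytic and algebraic properties of a complex algebraic curve without isolated points
that enter the proof. -/
structure IsGraphCurve {n : ℕ} (X : Set (EuclideanSpace ℂ (Fin n))) : Prop where
  isClosed : IsClosed X
  exists_relation : ∀ i j : Fin n, ∃ P : Polynomial (Polynomial ℂ), P ≠ 0 ∧
    ∀ x ∈ X, P.evalEval (x i) (x j) = 0
  exists_local_graph : ∀ j : Fin n, ∃ B : Set ℂ, B.Finite ∧ ∀ x₀ ∈ X, x₀ j ∉ B →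
    ∃ φ : ℂ → EuclideanSpace ℂ (Fin n), AnalyticAt ℂ φ (x₀ j) ∧ φ (x₀ j) = x₀ ∧
      (∀ᶠ t in 𝓝 (x₀ j), φ t ∈ X ∧ φ t j = t) ∧ ∀ᶠ x in 𝓝 x₀, x ∈ X → φ (x j) = x

theorem IsComplexAlgebraic.isClosed {n : ℕ} {X : Set (EuclideanSpace ℂ (Fin n))}
    (hX : IsComplexAlgebraic X) : IsClosed X := by
  obtain ⟨m, P, rfl⟩ := hX
  simp only [Set.ofPred_forall]
  refine isClosed_iInter fun i => isClosed_eq ?_ continuous_const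
  exact (MvPolynomial.continuous_eval (P i)).comp (PiLp.continuous_ofLp 2 _)

theorem IsComplexAlgebraicCurve.isGraphCurve {n : ℕ} {X : Set (EuclideanSpace ℂ (Fin n))}
    (hX : IsComplexAlgebraicCurve X) (hacc : ∀ x ∈ X, ∃ᶠ y in 𝓝[≠] x, y ∈ X) :
    IsGraphCurve X := by
  refine ⟨hX.1.isClosed, hX.exists_relation, fun j => ?_⟩
  choose P hP0 hP using hX.exists_relation j
  choose B hB hroot using fun i => exists_local_root (hP0 i)
  refine ⟨⋃ i, B i, Set.finite_iUnion hB, fun x₀ hx₀ hj => ?_⟩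
  simp only [Set.mem_iUnion, not_exists] at hj
  choose φ hφa hφ0 hφ using fun i => hroot i _ (hj i) (x₀ i) (hP i x₀ hx₀)
  let ψ : ℂ → Fin n → ℂ := fun t i => if i = j then t else φ i t
  have hψa : ∀ i, AnalyticAt ℂ (fun t => ψ t i) (x₀ j) := by
    intro i
    by_cases h : i = j
    · simp only [ψ, h, if_true]; exact analyticAt_id
    · simp only [ψ, h, if_false]; exact hφa i
  have hψ0 : WithLp.toLp 2 (ψ (x₀ j)) = x₀ := by
    ext i
    by_cases h : i = j
    · simp [ψ, h]
    · simp [ψ, h, hφ0]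
  have hgraph : ∀ᶠ x in 𝓝 x₀, x ∈ X → WithLp.toLp 2 (ψ (x j)) = x := by
    have : ∀ i, ∀ᶠ x : EuclideanSpace ℂ (Fin n) in 𝓝 x₀,
        (P i).evalEval (x j) (x i) = 0 → φ i (x j) = x i := fun i => by
      have hc : Continuous fun x : EuclideanSpace ℂ (Fin n) => (x j, x i) := by fun_prop
      exact (hc.continuousAt (x := x₀)).eventually (hφ i)
    filter_upwards [Filter.eventually_all.2 this] with x hx hxX
    ext i
    by_cases h : i = j
    · simp [ψ, h]
    · simp [ψ, h, hx i (hP i x hxX)]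
  refine ⟨fun t => WithLp.toLp 2 (ψ t), ?_, hψ0, ?_, hgraph⟩
  · have h1 : AnalyticAt ℂ ψ (x₀ j) := AnalyticAt.pi hψa
    exact ((PiLp.continuousLinearEquiv 2 ℂ fun _ : Fin n => ℂ).symm :
      (Fin n → ℂ) →L[ℂ] EuclideanSpace ℂ (Fin n)).analyticAt _ |>.comp h1
  · obtain ⟨m, F, hF⟩ := hX.1
    have hfreq : ∃ᶠ t in 𝓝[≠] (x₀ j), WithLp.toLp 2 (ψ t) ∈ X := by
      have ht : Filter.Tendsto (fun x : EuclideanSpace ℂ (Fin n) => x j) (𝓝 x₀) (𝓝 (x₀ j)) := by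
        have hc : Continuous fun x : EuclideanSpace ℂ (Fin n) => x j := by fun_prop
        exact hc.continuousAt
      have h1 : ∃ᶠ x in 𝓝 x₀, x ∈ X ∧ x j ≠ x₀ j := by
        have h2 := hacc x₀ hx₀
        rw [nhdsWithin, Filter.frequently_inf_principal] at h2
        refine (h2.and_eventually hgraph).mono ?_
        rintro x ⟨⟨hne, hxX⟩, hx⟩
        refine ⟨hxX, fun h => hne ?_⟩
        rw [Set.mem_singleton_iff, ← hx hxX, h, hψ0]
      rw [nhdsWithin, Filter.frequently_inf_principal]
      refine ht.frequently ((h1.and_eventually hgraph).mono ?_)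
      rintro x ⟨⟨hxX, hne⟩, hx⟩
      exact ⟨hne, by rw [hx hxX]; exact hxX⟩
    have hall : ∀ k, ∀ᶠ t in 𝓝 (x₀ j), MvPolynomial.aeval (ψ t) (F k) = 0 := fun k => by
      have ha : AnalyticAt ℂ (fun t => MvPolynomial.aeval (ψ t) (F k)) (x₀ j) :=
        AnalyticAt.aeval_mvPolynomial hψa (F k)
      refine ha.frequently_zero_iff_eventually_zero.1 (hfreq.mono fun t ht => ?_)
      rw [hF] at ht
      exact ht k
    filter_upwards [Filter.eventually_all.2 hall] with t ht
    refine ⟨?_, by simp [ψ]⟩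
    rw [hF]
    exact fun k => ht k

open Polynomial in
theorem eq_zero_of_evalEval_eq_zero {P : ℂ[X][X]} (a : ℂ)
    (h : ∀ t s, t ≠ a → P.evalEval t s = 0) : P = 0 := by
  have h1 : ∀ t, t ≠ a → P.map (evalRingHom t) = 0 := by
    intro t ht
    refine Polynomial.funext fun s => ?_
    rw [map_evalRingHom_eval, h t s ht, eval_zero]
  ext1 k
  rw [coeff_zero]
  refine Polynomial.eq_zero_of_infinite_isRoot _ (Set.Infinite.mono (s := {a}ᶜ) ?_
    (Set.finite_singleton a).infinite_compl)
  intro t ht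
  have := congrArg (fun p => coeff p k) (h1 t ht)
  simpa using this

open Polynomial in
/-- The zeros `σ` of a polynomial `F(σ, t)` near `σ₀` converge to `σ₀` as `t → 0`. -/
theorem exists_isolated_root {F : ℂ[X][X]} (hF : F ≠ 0) (σ₀ : ℂ) :
    ∃ ε₀ > 0, ∀ ε > 0, ∃ r > 0, ∀ t σ : ℂ, t ≠ 0 → ‖t‖ < r → ‖σ - σ₀‖ ≤ ε₀ →
      F.evalEval σ t = 0 → ‖σ - σ₀‖ ≤ ε := by
  obtain ⟨F₁, hFX, hF₁⟩ := exists_eq_pow_rootMultiplicity_mul_and_not_dvd F hF 0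
  rw [map_zero, sub_zero] at hFX hF₁
  rw [X_dvd_iff] at hF₁
  set q := F₁.coeff 0 with hq
  have hq0 : ∀ σ, F₁.evalEval σ 0 = q.eval σ := by
    intro σ; simp [evalEval, hq, coeff_zero_eq_eval_zero]
  have hfin : {σ | q.IsRoot σ}.Finite := Polynomial.finite_setOfPred_isRoot hF₁
  have hnear : ∀ᶠ σ in 𝓝 σ₀, σ ∉ {σ | q.IsRoot σ} \ {σ₀} :=
    (hfin.subset Set.sdiff_subset).isClosed.compl_mem_nhds (by simp)
  obtain ⟨ε₀, hε₀, hball⟩ := Metric.nhds_basis_closedBall.eventually_iff.1 hnear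
  refine ⟨ε₀, hε₀, fun ε hε => ?_⟩
  set K : Set ℂ := Metric.closedBall σ₀ ε₀ \ Metric.ball σ₀ ε
  have hK : IsCompact K := (isCompact_closedBall σ₀ ε₀).diff Metric.isOpen_ball
  have hcont : Continuous fun z : ℂ × ℂ => F₁.evalEval z.2 z.1 :=
    (contDiff_evalEval F₁ (k := 0)).continuous.comp continuous_swap
  have hev : ∀ᶠ t in 𝓝 (0 : ℂ), ∀ σ ∈ K, F₁.evalEval σ t ≠ 0 := by
    refine hK.eventually_forall_of_forall_eventually fun σ hσ => ?_
    refine hcont.continuousAt.eventually_ne ?_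
    simp only [hq0]
    intro h0
    refine hball hσ.1 ⟨h0, ?_⟩
    rintro rfl
    exact hσ.2 (Metric.mem_ball_self hε)
  obtain ⟨r, hr, hr'⟩ := Metric.nhds_basis_ball.eventually_iff.1 hev
  refine ⟨r, hr, fun t σ ht htr hσ h0 => ?_⟩
  by_contra! hlt
  refine hr' (by simpa using htr) σ ⟨by simpa [dist_eq_norm] using hσ,
    by simpa [dist_eq_norm] using hlt.le⟩ ?_
  rw [hFX, evalEval_mul, evalEval_pow, evalEval_X] at h0
  exact (mul_eq_zero.1 h0).resolve_left (pow_ne_zero _ ht)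

/-- The radial coordinate of a spherical blow-up, at a point (`true`) or at infinity (`false`). -/
def radial (b : Bool) (s : ℝ) : ℝ := if b then s else s⁻¹

open Polynomial in
theorem exists_isolated_slope {P : ℂ[X][X]} (hP : P ≠ 0) (b : Bool) (c d σ₀ : ℂ) :
    ∃ ε₀ > 0, ∀ ε > 0, ∃ r > 0, ∀ t σ : ℂ, t ≠ 0 → radial b ‖t‖ < r → ‖σ - σ₀‖ ≤ ε₀ →
      P.evalEval (c + t) (d + σ * t) = 0 → ‖σ - σ₀‖ ≤ ε := by
  let F : ℂ[X][X] := aevalAeval (C (C c) + X : ℂ[X][X]) (C (C d) + C X * X) P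
  have hFe : ∀ σ t, F.evalEval σ t = P.evalEval (c + t) (d + σ * t) := by
    intro σ t
    rw [← coe_aevalAeval_eq_evalEval, ← coe_aevalAeval_eq_evalEval]
    have : (aevalAeval σ t : ℂ[X][X] →ₐ[ℂ] ℂ).comp
        (aevalAeval (C (C c) + X : ℂ[X][X]) (C (C d) + C X * X)) =
        aevalAeval (c + t) (d + σ * t) := by
      ext
      · simp
      · simp; ring
    exact DFunLike.congr_fun this P
  have hF : F ≠ 0 := by
    intro h
    refine hP (eq_zero_of_evalEval_eq_zero c fun t s hts => ?_)
    have h1 := hFe ((s - d) / (t - c)) (t - c)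
    rw [h, evalEval_zero, div_mul_cancel₀ _ (sub_ne_zero.2 hts)] at h1
    simpa using h1.symm
  cases b with
  | true =>
    obtain ⟨ε₀, hε₀, h⟩ := exists_isolated_root hF σ₀
    refine ⟨ε₀, hε₀, fun ε hε => ?_⟩
    obtain ⟨r, hr, h⟩ := h ε hε
    exact ⟨r, hr, fun t σ ht htr hσ h0 => h t σ ht (by simpa [radial] using htr) hσ
      (by rw [hFe, h0])⟩
  | false =>
    have hF' : F.reverse ≠ 0 := by simpa [reverse_eq_zero] using hF
    obtain ⟨ε₀, hε₀, h⟩ := exists_isolated_root hF' σ₀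
    refine ⟨ε₀, hε₀, fun ε hε => ?_⟩
    obtain ⟨r, hr, h⟩ := h ε hε
    refine ⟨r, hr, fun t σ ht htr hσ h0 => h t⁻¹ σ (inv_ne_zero ht)
      (by simpa [radial] using htr) hσ ?_⟩
    have : Invertible t := invertibleOfNonzero ht
    rw [← eval₂_evalRingHom, ← invOf_eq_inv t, eval₂_reverse_eq_zero_iff, eval₂_evalRingHom,
      hFe, h0]

theorem radial_pos (b : Bool) {s : ℝ} (hs : 0 < s) : 0 < radial b s := by
  cases b <;> simp [radial, hs]

theorem radial_mul (b : Bool) (a s : ℝ) : radial b (a * s) = radial b a * radial b s := by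
  cases b <;> simp [radial, mul_comm]

theorem radial_le_mul (b : Bool) {A s s' : ℝ} (hs : 0 < s) (hs' : 0 < s') (h : s ≤ A * s')
    (h' : s' ≤ A * s) : radial b s ≤ A * radial b s' := by
  cases b with
  | true => simpa [radial] using h
  | false =>
    simp only [radial, Bool.false_eq_true, if_false]
    rw [← div_eq_mul_inv, le_div_iff₀ hs', inv_mul_le_iff₀ hs, mul_comm]
    exact h'

theorem continuousAt_radial (b : Bool) {s : ℝ} (hs : s ≠ 0) : ContinuousAt (radial b) s := by
  cases b with
  | true => exact (continuousAt_id : ContinuousAt (fun s : ℝ => s) s)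
  | false => exact (continuousAt_inv₀ hs : ContinuousAt (fun s : ℝ => s⁻¹) s)

/-- The punctured disc of radius `r` centred at `0` or at infinity. -/
def punct (b : Bool) (r : ℝ) : Set ℂ := {t | t ≠ 0 ∧ radial b ‖t‖ < r}

theorem punct_mono (b : Bool) {r r' : ℝ} (h : r ≤ r') : punct b r ⊆ punct b r' :=
  fun _ ht => ⟨ht.1, ht.2.trans_le h⟩

theorem isOpen_punct (b : Bool) (r : ℝ) : IsOpen (punct b r) := by
  rw [isOpen_iff_mem_nhds]
  intro t ht
  have h : ContinuousAt (fun t : ℂ => radial b ‖t‖) t :=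
    (continuousAt_radial b (norm_ne_zero_iff.2 ht.1)).comp continuous_norm.continuousAt
  exact (eventually_ne_nhds ht.1).and (h.eventually_lt_const ht.2)

section Sector

variable {n : ℕ}

/-- The part of `X` over a punctured disc which stays in a conical neighbourhood of the complex
line through `c` directed by `v`, seen as a branched cover through the `j`-th coordinate. -/
def sec (X : Set (EuclideanSpace ℂ (Fin n))) (b : Bool) (c : EuclideanSpace ℂ (Fin n))
    (j : Fin n) (v : EuclideanSpace ℂ (Fin n)) (ε r : ℝ) : Set (EuclideanSpace ℂ (Fin n)) :=
  {x ∈ X | x j - c j ∈ punct b r ∧ ‖x - c - (x j - c j) • v‖ ≤ ε * ‖x j - c j‖}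

/-- The parameters `ε, r` are small enough for `sec X b c j v ε r` to be a finite covering of the
punctured disc. -/
structure GoodSec (X : Set (EuclideanSpace ℂ (Fin n))) (b : Bool) (c : EuclideanSpace ℂ (Fin n))
    (j : Fin n) (v : EuclideanSpace ℂ (Fin n)) (ε r : ℝ) : Prop where
  eps_pos : 0 < ε
  r_pos : 0 < r
  v_j : v j = 1
  isClosed : IsClosed X
  shrink : sec X b c j v ε r ⊆ sec X b c j v (ε / 2) r
  local_graph : ∀ x₀ ∈ X, x₀ j - c j ∈ punct b r →
    ∃ φ : ℂ → EuclideanSpace ℂ (Fin n), AnalyticAt ℂ φ (x₀ j) ∧ φ (x₀ j) = x₀ ∧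
      (∀ᶠ t in 𝓝 (x₀ j), φ t ∈ X ∧ φ t j = t) ∧ ∀ᶠ x in 𝓝 x₀, x ∈ X → φ (x j) = x

variable {X : Set (EuclideanSpace ℂ (Fin n))} {b : Bool} {c v : EuclideanSpace ℂ (Fin n)}
  {j : Fin n} {ε r : ℝ}

theorem sec_mono {ε' r' : ℝ} (hε : ε ≤ ε') (hr : r ≤ r') :
    sec X b c j v ε r ⊆ sec X b c j v ε' r' := fun _ hx =>
  ⟨hx.1, punct_mono b hr hx.2.1, hx.2.2.trans (by gcongr)⟩

theorem eventually_punct_avoid (b : Bool) (c : ℂ) {B : Set ℂ} (hB : B.Finite) :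
    ∀ᶠ r in 𝓝[>] (0 : ℝ), ∀ t ∈ punct b r, c + t ∉ B := by
  have : ∀ β ∈ B, ∀ᶠ r in 𝓝[>] (0 : ℝ), ∀ t ∈ punct b r, c + t ≠ β := by
    intro β _
    by_cases h : β = c
    · filter_upwards with r t ht h'
      exact ht.1 (by simpa [h] using h')
    · have hpos : 0 < radial b ‖β - c‖ := radial_pos b (norm_pos_iff.2 (sub_ne_zero.2 h))
      filter_upwards [Ioo_mem_nhdsGT hpos] with r hr t ht h'
      have : t = β - c := by rw [← h']; ring
      rw [this] at ht
      exact absurd ht.2 (not_lt.2 hr.2.le)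
  filter_upwards [(Filter.eventually_all_finite hB).2 this] with r hr t ht htB
  exact hr _ htB t ht rfl

theorem norm_le_of_coord_le {z : EuclideanSpace ℂ (Fin n)} {δ : ℝ} (h : ∀ i, ‖z i‖ ≤ δ)
    (hδ : 0 ≤ δ) : ‖z‖ ≤ (n + 1 : ℝ) * δ := by
  rw [← abs_of_nonneg (show 0 ≤ (n + 1 : ℝ) * δ by positivity), ← abs_of_nonneg (norm_nonneg z),
    ← sq_le_sq, EuclideanSpace.norm_sq_eq]
  calc ∑ i, ‖z i‖ ^ 2 ≤ ∑ _i : Fin n, δ ^ 2 := by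
        gcongr with i; exact h i
    _ = n * δ ^ 2 := by simp
    _ ≤ ((n + 1) * δ) ^ 2 := by
        have h1 : (0 : ℝ) ≤ n := Nat.cast_nonneg n
        nlinarith [sq_nonneg δ, mul_nonneg h1 (sq_nonneg δ),
          mul_nonneg (sq_nonneg (n : ℝ)) (sq_nonneg δ)]

theorem IsGraphCurve.exists_sec_subset (hX : IsGraphCurve X) (b : Bool)
    (c v : EuclideanSpace ℂ (Fin n)) (j : Fin n) :
    ∃ ε₀ > 0, ∀ ε > 0, ∃ r > 0, sec X b c j v ε₀ r ⊆ sec X b c j v ε r := by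
  choose P hP0 hP using fun i => hX.exists_relation j i
  choose ε₀ hε₀ h using fun i => exists_isolated_slope (hP0 i) b (c j) (c i) (v i)
  obtain ⟨e, he, hemin⟩ : ∃ e > 0, ∀ i, e ≤ ε₀ i := by
    have : ∀ᶠ e in 𝓝[>] (0 : ℝ), ∀ i, e ≤ ε₀ i :=
      Filter.eventually_all.2 fun i => mem_of_superset (Ioo_mem_nhdsGT (hε₀ i)) fun _ h => h.2.le
    obtain ⟨e, h1, h2⟩ := (this.and self_mem_nhdsWithin).exists
    exact ⟨e, h2, h1⟩
  refine ⟨e, he, fun ε hε => ?_⟩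
  choose r hr h' using fun i => h i (ε / (n + 1)) (by positivity)
  obtain ⟨ρ, hρ, hρmin⟩ : ∃ ρ > 0, ∀ i, ρ ≤ r i := by
    have : ∀ᶠ e in 𝓝[>] (0 : ℝ), ∀ i, e ≤ r i :=
      Filter.eventually_all.2 fun i => mem_of_superset (Ioo_mem_nhdsGT (hr i)) fun _ h => h.2.le
    obtain ⟨e, h1, h2⟩ := (this.and self_mem_nhdsWithin).exists
    exact ⟨e, h2, h1⟩
  refine ⟨ρ, hρ, fun x hx => ⟨hx.1, hx.2.1, ?_⟩⟩
  set t := x j - c j with ht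
  have ht0 : t ≠ 0 := hx.2.1.1
  have htn : 0 < ‖t‖ := norm_pos_iff.2 ht0
  have hcoord : ∀ i, ‖(x - c - t • v) i‖ = ‖(x i - c i) / t - v i‖ * ‖t‖ := by
    intro i
    rw [← norm_mul, sub_mul, div_mul_cancel₀ _ ht0]
    simp [mul_comm]
  have key : ∀ i, ‖(x - c - t • v) i‖ ≤ ε / (n + 1) * ‖t‖ := by
    intro i
    rw [hcoord i]
    gcongr
    refine h' i t _ ht0 (hx.2.1.2.trans_le (hρmin i)) ?_ ?_
    · have h1 := (PiLp.norm_apply_le (x - c - t • v) i).trans hx.2.2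
      rw [hcoord i] at h1
      exact (le_of_mul_le_mul_right h1 htn).trans (hemin i)
    · rw [div_mul_cancel₀ _ ht0]
      have := hP i x hx.1
      rwa [show c j + t = x j by simp [ht], show c i + (x i - c i) = x i by ring]
  calc ‖x - c - t • v‖ ≤ (n + 1) * (ε / (n + 1) * ‖t‖) :=
        norm_le_of_coord_le key (by positivity)
    _ = ε * ‖t‖ := by field_simp

theorem IsGraphCurve.exists_goodSec (hX : IsGraphCurve X) (b : Bool)
    (c : EuclideanSpace ℂ (Fin n)) {j : Fin n} {v : EuclideanSpace ℂ (Fin n)} (hv : v j = 1) :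
    ∃ ε₀ > 0, ∀ ε > 0, ε ≤ ε₀ → ∀ᶠ r in 𝓝[>] (0 : ℝ), GoodSec X b c j v ε r := by
  obtain ⟨ε₀, hε₀, h⟩ := hX.exists_sec_subset b c v j
  obtain ⟨B, hB, hg⟩ := hX.exists_local_graph j
  refine ⟨ε₀, hε₀, fun ε hε hle => ?_⟩
  obtain ⟨r, hr, hsub⟩ := h (ε / 2) (by positivity)
  filter_upwards [eventually_punct_avoid b (c j) hB, Ioo_mem_nhdsGT hr] with r' h1 h2
  refine ⟨hε, h2.1, hv, hX.isClosed, fun x hx => ?_, fun x hx hxj => hg x hx ?_⟩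
  · exact ⟨hx.1, hx.2.1, (hsub (sec_mono hle h2.2.le hx)).2.2⟩
  · simpa using h1 _ hxj

end Sector

theorem isCoveringMap_of_isProperMap {A B : Type*} [TopologicalSpace A] [TopologicalSpace B]
    [T2Space A] {f : A → B} (hf : IsProperMap f)
    (hs : ∀ a, ∃ s : B → A, s (f a) = a ∧ (∀ᶠ b in 𝓝 (f a), ContinuousAt s b ∧ f (s b) = b) ∧
      ∀ᶠ x in 𝓝 a, s (f x) = x) : IsCoveringMap f := by
  rw [isCoveringMap_iff_isCoveringMapOn_univ]
  refine hf.isClosedMap.isCoveringMapOn_of_isLocalHomeomorphOn (fun b _ => ?_) (fun a _ => ?_)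
  · have hc : IsCompact (f ⁻¹' {b}) := hf.isCompact_preimage isCompact_singleton
    choose s hs1 hs2 hs3 using hs
    obtain ⟨F, hF, hcov⟩ := hc.elim_nhds_subcover (fun a => {x | s a (f x) = x})
      (fun a _ => hs3 a)
    refine (F.finite_toSet.image fun a => s a b).subset fun x hx => ?_
    obtain ⟨a, ha, hxa⟩ := Set.mem_iUnion₂.1 (hcov hx)
    refine ⟨a, ha, ?_⟩
    have h1 : f x = b := hx
    have h2 : s a (f x) = x := hxa
    rw [← h1]; exact h2
  · obtain ⟨s, hs1, hs2, hs3⟩ := hs a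
    obtain ⟨U, hU, hUo, haU⟩ := eventually_nhds_iff.1 hs3
    have hsa : ∀ᶠ b in 𝓝 (f a), s b ∈ U :=
      hs2.self_of_nhds.1.eventually (by rw [hs1]; exact hUo.mem_nhds haU)
    obtain ⟨V, hV, hVo, haV⟩ := eventually_nhds_iff.1 (hs2.and hsa)
    refine ⟨⟨⟨⟨f, s, U ∩ f ⁻¹' V, V, fun x hx => hx.2, fun b hb => ⟨(hV b hb).2, ?_⟩,
      fun x hx => hU x hx.1, fun b hb => (hV b hb).1.2⟩, ?_, ?_⟩, ?_, hVo⟩, ⟨haU, haV⟩, rfl⟩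
    · rw [Set.mem_preimage, (hV b hb).1.2]; exact hb
    · exact hf.continuous.continuousOn
    · exact fun b hb => (hV b hb).1.1.continuousWithinAt
    · exact hUo.inter (hVo.preimage hf.continuous)

namespace GoodSec

variable {n : ℕ} {X : Set (EuclideanSpace ℂ (Fin n))} {b : Bool}
  {c v : EuclideanSpace ℂ (Fin n)} {j : Fin n} {ε r : ℝ}

theorem continuous_coord (j : Fin n) : Continuous fun x : EuclideanSpace ℂ (Fin n) => x j := by
  fun_prop

/-- The branched cover of the punctured disc. -/
def proj (X : Set (EuclideanSpace ℂ (Fin n))) (b : Bool) (c : EuclideanSpace ℂ (Fin n))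
    (j : Fin n) (v : EuclideanSpace ℂ (Fin n)) (ε r : ℝ) (x : sec X b c j v ε r) : punct b r :=
  ⟨x.1 j - c j, x.2.2.1⟩

theorem continuous_proj : Continuous (proj X b c j v ε r) := by
  refine Continuous.subtype_mk ?_ _
  have := (continuous_coord j).comp (continuous_subtype_val (p := (· ∈ sec X b c j v ε r)))
  exact this.sub continuous_const

theorem isProperMap_proj (h : GoodSec X b c j v ε r) : IsProperMap (proj X b c j v ε r) := by
  have : LocallyCompactSpace (punct b r) := (isOpen_punct b r).locallyCompactSpace
  rw [isProperMap_iff_isCompact_preimage]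
  refine ⟨continuous_proj, fun K hK => ?_⟩
  rw [Subtype.isCompact_iff]
  have hK' : IsCompact (Subtype.val '' K) := hK.image continuous_subtype_val
  set K' : Set ℂ := Subtype.val '' K
  set T : Set (EuclideanSpace ℂ (Fin n)) := {x | x ∈ X ∧ x j - c j ∈ K' ∧
    ‖x - c - (x j - c j) • v‖ ≤ ε * ‖x j - c j‖}
  have hT : Subtype.val '' (proj X b c j v ε r ⁻¹' K) = T := by
    ext x
    constructor
    · rintro ⟨y, hy, rfl⟩
      exact ⟨y.2.1, ⟨_, hy, rfl⟩, y.2.2.2⟩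
    · rintro ⟨h1, ⟨t, ht, htx⟩, h3⟩
      have h2 : x j - c j ∈ punct b r := htx ▸ t.2
      refine ⟨⟨x, h1, h2, h3⟩, ?_, rfl⟩
      have : proj X b c j v ε r ⟨x, h1, h2, h3⟩ = t := Subtype.ext htx.symm
      rw [Set.mem_preimage, this]
      exact ht
  rw [hT]
  have hcj : Continuous fun x : EuclideanSpace ℂ (Fin n) => x j - c j :=
    (continuous_coord j).sub continuous_const
  have hcl : IsClosed T := by
    have h3 : IsClosed {x : EuclideanSpace ℂ (Fin n) |
        ‖x - c - (x j - c j) • v‖ ≤ ε * ‖x j - c j‖} :=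
      isClosed_le (by fun_prop) (by fun_prop)
    exact h.isClosed.inter ((hK'.isClosed.preimage hcj).inter h3)
  refine Metric.isCompact_of_isClosed_isBounded hcl ?_
  obtain ⟨M, hM⟩ := hK'.isBounded.exists_norm_le
  refine (Metric.isBounded_closedBall (x := c) (r := ε * M + M * ‖v‖)).subset fun x hx => ?_
  rw [mem_closedBall_iff_norm]
  calc ‖x - c‖ = ‖(x - c - (x j - c j) • v) + (x j - c j) • v‖ := by rw [sub_add_cancel]
    _ ≤ ε * ‖x j - c j‖ + ‖x j - c j‖ * ‖v‖ := (norm_add_le _ _).trans (by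
        rw [norm_smul]; gcongr; exact hx.2.2)
    _ ≤ ε * M + M * ‖v‖ := by
        have := hM _ hx.2.1
        have := h.eps_pos
        gcongr

theorem local_section (h : GoodSec X b c j v ε r) {x₀ : EuclideanSpace ℂ (Fin n)}
    (hx₀ : x₀ ∈ sec X b c j v ε r) :
    ∃ φ : ℂ → EuclideanSpace ℂ (Fin n), φ (x₀ j - c j) = x₀ ∧
      (∀ᶠ t in 𝓝 (x₀ j - c j), DifferentiableAt ℂ φ t ∧ φ t ∈ sec X b c j v ε r ∧
        φ t j - c j = t) ∧
      ∀ᶠ x in 𝓝 x₀, x ∈ X → φ (x j - c j) = x := by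
  obtain ⟨φ, hφa, hφ0, hφX, hφ⟩ := h.local_graph x₀ hx₀.1 hx₀.2.1
  refine ⟨fun t => φ (c j + t), by simp [hφ0], ?_, by simpa using hφ⟩
  have ht : Tendsto (fun t => c j + t) (𝓝 (x₀ j - c j)) (𝓝 (x₀ j)) := by
    have : Continuous fun t : ℂ => c j + t := by fun_prop
    simpa using this.tendsto (x₀ j - c j)
  have hopen : ∀ᶠ x in 𝓝 x₀, x j - c j ∈ punct b r ∧
      ‖x - c - (x j - c j) • v‖ < ε * ‖x j - c j‖ := by
    have hcj : Continuous fun x : EuclideanSpace ℂ (Fin n) => x j - c j :=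
      (continuous_coord j).sub continuous_const
    refine (hcj.continuousAt.eventually ((isOpen_punct b r).mem_nhds hx₀.2.1)).and ?_
    refine ContinuousAt.eventually_lt (by fun_prop) (by fun_prop) ?_
    have h1 := (h.shrink hx₀).2.2
    have h2 : 0 < ‖x₀ j - c j‖ := norm_pos_iff.2 hx₀.2.1.1
    have := h.eps_pos
    nlinarith
  have hc : Tendsto φ (𝓝 (x₀ j)) (𝓝 x₀) := by
    simpa [ContinuousAt, hφ0] using hφa.continuousAt
  filter_upwards [ht.eventually hφX, ht.eventually (hc.eventually hopen),
    ht.eventually hφa.eventually_analyticAt] with t h1 h2 h3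
  refine ⟨?_, ⟨h1.1, h2.1, h2.2.le⟩, by rw [h1.2]; ring⟩
  exact h3.differentiableAt.comp t ((differentiableAt_const _).add differentiableAt_id)

theorem isCoveringMap_proj (h : GoodSec X b c j v ε r) :
    IsCoveringMap (proj X b c j v ε r) := by
  classical
  refine isCoveringMap_of_isProperMap h.isProperMap_proj fun a => ?_
  obtain ⟨φ, hφ0, hφ1, hφ2⟩ := h.local_section a.2
  refine ⟨fun t => if ht : φ t.1 ∈ sec X b c j v ε r then ⟨φ t.1, ht⟩ else a, ?_, ?_, ?_⟩
  · have : φ (proj X b c j v ε r a).1 = a.1 := hφ0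
    simp [this]
  · have hval : Tendsto (Subtype.val : punct b r → ℂ) (𝓝 (proj X b c j v ε r a))
        (𝓝 (a.1 j - c j)) := continuous_subtype_val.continuousAt
    filter_upwards [hval.eventually hφ1.eventually_nhds] with t ht
    have h1 := ht.self_of_nhds
    constructor
    · rw [IsInducing.subtypeVal.continuousAt_iff]
      have hc : ContinuousAt (fun t : punct b r => φ t.1) t :=
        h1.1.continuousAt.comp continuous_subtype_val.continuousAt
      refine hc.congr ?_
      filter_upwards [continuous_subtype_val.continuousAt.eventually ht] with s hs
      simp [hs.2.1]
    · simp only [h1.2.1, dif_pos]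
      exact Subtype.ext h1.2.2
  · have hval : Tendsto (Subtype.val : sec X b c j v ε r → _) (𝓝 a) (𝓝 a.1) :=
      continuous_subtype_val.continuousAt
    filter_upwards [hval.eventually hφ2] with x hx
    have : φ (proj X b c j v ε r x).1 = x.1 := hx x.2.1
    simp [this]

theorem eqOn_of_coord_eq (h : GoodSec X b c j v ε r) {A : Type*} [TopologicalSpace A] {s : Set A}
    (hs : IsPreconnected s) {g₁ g₂ : A → EuclideanSpace ℂ (Fin n)} (h₁ : ContinuousOn g₁ s)
    (h₂ : ContinuousOn g₂ s) (hm₁ : ∀ a ∈ s, g₁ a ∈ sec X b c j v ε r)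
    (hm₂ : ∀ a ∈ s, g₂ a ∈ sec X b c j v ε r) (hc : ∀ a ∈ s, g₁ a j = g₂ a j) {a : A} (ha : a ∈ s)
    (hag : g₁ a = g₂ a) : EqOn g₁ g₂ s := by
  have : PreconnectedSpace s := isPreconnected_iff_preconnectedSpace.1 hs
  have key := h.isCoveringMap_proj.eq_of_comp_eq
    (g₁ := fun a : s => (⟨g₁ a, hm₁ a a.2⟩ : sec X b c j v ε r))
    (g₂ := fun a : s => (⟨g₂ a, hm₂ a a.2⟩ : sec X b c j v ε r))
    (h₁.domRestrict.subtype_mk _) (h₂.domRestrict.subtype_mk _)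
    (funext fun a => Subtype.ext (by simp [proj, hc a a.2])) ⟨a, ha⟩ (Subtype.ext hag)
  intro x hx
  exact congrArg Subtype.val (congrFun key ⟨x, hx⟩)

theorem exists_lift (h : GoodSec X b c j v ε r) {K : Set ℂ} (hK : Convex ℝ K) (hKo : IsOpen K)
    {f : ℂ → ℂ} (hf : ContinuousOn f K) (hm : ∀ z ∈ K, f z ∈ punct b r) {z₀ : ℂ} (hz₀ : z₀ ∈ K)
    {x₀ : EuclideanSpace ℂ (Fin n)} (hx₀ : x₀ ∈ sec X b c j v ε r) (hxz : x₀ j - c j = f z₀) :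
    ∃ g : ℂ → EuclideanSpace ℂ (Fin n), ContinuousOn g K ∧
      (∀ z ∈ K, g z ∈ sec X b c j v ε r ∧ g z j - c j = f z) ∧ g z₀ = x₀ := by
  classical
  have : ContractibleSpace K := hK.contractibleSpace ⟨z₀, hz₀⟩
  have : LocallyPathConnectedSpace K := hKo.locallyPathConnectedSpace
  obtain ⟨F, ⟨hF0, hF⟩, -⟩ := h.isCoveringMap_proj.existsUnique_continuousMap_lifts
    (⟨fun z : K => (⟨f z, hm z z.2⟩ : punct b r), hf.domRestrict.subtype_mk _⟩ : C(K, punct b r))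
    ⟨z₀, hz₀⟩ ⟨x₀, hx₀⟩ (Subtype.ext hxz)
  have hg : ∀ z (hz : z ∈ K), (if hz : z ∈ K then (F ⟨z, hz⟩).1 else x₀) = (F ⟨z, hz⟩).1 :=
    fun z hz => dif_pos hz
  refine ⟨fun z => if hz : z ∈ K then (F ⟨z, hz⟩).1 else x₀, ?_, fun z hz => ?_, ?_⟩
  · rw [continuousOn_iff_continuous_domRestrict]
    refine (continuous_subtype_val.comp F.continuous).congr fun z => ?_
    simp
  · simp only [hz, dif_pos]
    exact ⟨(F ⟨z, hz⟩).2, congrArg Subtype.val (congrFun hF ⟨z, hz⟩)⟩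
  · simp [hz₀, hF0]

theorem differentiableAt_section (h : GoodSec X b c j v ε r) {g : ℂ → EuclideanSpace ℂ (Fin n)}
    {t : ℂ} (hg : ContinuousAt g t)
    (hm : ∀ᶠ s in 𝓝 t, g s ∈ sec X b c j v ε r ∧ g s j - c j = s) : DifferentiableAt ℂ g t := by
  obtain ⟨φ, -, hφ1, hφ2⟩ := h.local_section hm.self_of_nhds.1
  rw [hm.self_of_nhds.2] at hφ1
  refine hφ1.self_of_nhds.1.congr_of_eventuallyEq ?_
  filter_upwards [hm, hg.eventually hφ2] with s h1 h2
  have := h2 h1.1.1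
  rw [h1.2] at this
  exact this.symm

theorem norm_deriv_section_le (h : GoodSec X b c j v ε r) {g : ℂ → EuclideanSpace ℂ (Fin n)}
    {t : ℂ} (ht : t ≠ 0) (hg : ContinuousOn g (Metric.ball t (‖t‖ / 2)))
    (hm : ∀ s ∈ Metric.ball t (‖t‖ / 2), g s ∈ sec X b c j v ε r ∧ g s j - c j = s) :
    ‖deriv g t‖ ≤ ‖v‖ + 6 * ε := by
  have htn : 0 < ‖t‖ := norm_pos_iff.2 ht
  have hsub : Metric.closedBall t (‖t‖ / 4) ⊆ Metric.ball t (‖t‖ / 2) :=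
    Metric.closedBall_subset_ball (by linarith)
  have hd : ∀ s ∈ Metric.ball t (‖t‖ / 2), DifferentiableAt ℂ g s := fun s hs =>
    h.differentiableAt_section (hg.continuousAt (Metric.isOpen_ball.mem_nhds hs))
      (mem_of_superset (Metric.isOpen_ball.mem_nhds hs) hm)
  let f : ℂ → EuclideanSpace ℂ (Fin n) := fun s => g s - c - s • v
  have hfd : ∀ s ∈ Metric.ball t (‖t‖ / 2), DifferentiableAt ℂ f s := fun s hs =>
    ((hd s hs).sub_const c).sub (differentiableAt_id.smul_const v)
  have hdf : deriv g t = deriv f t + v := by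
    have h1 : HasDerivAt f (deriv g t - (1 : ℂ) • v) t :=
      (((hd t (Metric.mem_ball_self (by linarith))).hasDerivAt).sub_const c).sub
        ((hasDerivAt_id t).smul_const v)
    rw [h1.deriv]; simp
  have hb : ‖deriv f t‖ ≤ (ε * (‖t‖ + ‖t‖ / 4)) / (‖t‖ / 4) := by
    refine Complex.norm_deriv_le_of_forall_mem_sphere_norm_le (by linarith) ?_ fun s hs => ?_
    · refine (DifferentiableOn.diffContOnCl fun s hs => ?_)
      rw [closure_ball _ (by linarith)] at hs
      exact (hfd s (hsub hs)).differentiableWithinAt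
    · have hs' := hsub (Metric.sphere_subset_closedBall hs)
      have h1 := (hm s hs').1.2.2
      rw [(hm s hs').2] at h1
      refine h1.trans ?_
      have := h.eps_pos
      gcongr
      have : ‖s - t‖ = ‖t‖ / 4 := by simpa [dist_eq_norm] using hs
      calc ‖s‖ = ‖t + (s - t)‖ := by congr 1; ring
        _ ≤ ‖t‖ + ‖t‖ / 4 := (norm_add_le _ _).trans (by rw [this])
  have h5 : (ε * (‖t‖ + ‖t‖ / 4)) / (‖t‖ / 4) = 5 * ε := by field_simp; ring
  rw [hdf]
  have := h.eps_pos
  linarith [norm_add_le (deriv f t) v]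

end GoodSec

/-- A convex piece of a sector with axis directed by `w`, near `0` or near infinity. -/
def cone (b : Bool) (w : ℂ) (δ ρ : ℝ) : Set ℂ :=
  {t | (0 < (t * conj w).re ∧ radial b (t * conj w).re < ρ) ∧
    |(t * conj w).im| < δ * (t * conj w).re}

theorem cone_mono (b : Bool) (w : ℂ) {δ δ' ρ ρ' : ℝ} (hδ : δ ≤ δ') (hρ : ρ ≤ ρ') :
    cone b w δ ρ ⊆ cone b w δ' ρ' := fun _ ht =>
  ⟨⟨ht.1.1, ht.1.2.trans_le hρ⟩, ht.2.trans_le (mul_le_mul_of_nonneg_right hδ ht.1.1.le)⟩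

theorem convex_cone (b : Bool) (w : ℂ) (δ ρ : ℝ) : Convex ℝ (cone b w δ ρ) := by
  have hI : Convex ℝ {s : ℝ | 0 < s ∧ radial b s < ρ} := by
    cases b with
    | true => exact convex_Ioo 0 ρ
    | false =>
      rcases le_or_gt ρ 0 with h | h
      · have : {s : ℝ | 0 < s ∧ radial false s < ρ} = ∅ := by
          ext s
          simp only [radial, Set.mem_empty_iff_false, iff_false]
          rintro ⟨h1, h2⟩
          have : 0 < s⁻¹ := inv_pos.2 h1
          simp at h2
          linarith
        rw [this]
        exact convex_empty
      · have : {s : ℝ | 0 < s ∧ radial false s < ρ} = Ioi ρ⁻¹ := by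
          ext s
          have h0 : ρ⁻¹ > 0 := inv_pos.2 h
          constructor
          · rintro ⟨h1, h2⟩
            exact (inv_lt_comm₀ h1 h).1 h2
          · intro h1
            exact ⟨h0.trans h1, (inv_lt_comm₀ (h0.trans h1) h).2 h1⟩
        rw [this]
        exact convex_Ioi _
  let R : ℂ →ₗ[ℝ] ℝ := Complex.reLm ∘ₗ LinearMap.mulRight ℝ (conj w)
  let J : ℂ →ₗ[ℝ] ℝ := Complex.imLm ∘ₗ LinearMap.mulRight ℝ (conj w)
  have h1 : Convex ℝ ((δ • R - J) ⁻¹' Ioi 0) := (convex_Ioi (0 : ℝ)).linear_preimage (δ • R - J)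
  have h2 : Convex ℝ ((δ • R + J) ⁻¹' Ioi 0) := (convex_Ioi (0 : ℝ)).linear_preimage (δ • R + J)
  have heq : cone b w δ ρ = (R ⁻¹' {s | 0 < s ∧ radial b s < ρ}) ∩
      (((δ • R - J) ⁻¹' Ioi 0) ∩ ((δ • R + J) ⁻¹' Ioi 0)) := by
    ext t
    have e1 : R t = (t * conj w).re := rfl
    have e2 : J t = (t * conj w).im := rfl
    simp only [cone, abs_lt, Set.mem_inter_iff, Set.mem_preimage, Set.mem_Ioi,
      LinearMap.sub_apply, LinearMap.add_apply, LinearMap.smul_apply, smul_eq_mul, e1, e2,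
      Set.mem_ofPred_eq]
    constructor
    · rintro ⟨h1, h2, h3⟩
      exact ⟨h1, by linarith, by linarith⟩
    · rintro ⟨h1, h2, h3⟩
      exact ⟨h1, by linarith, by linarith⟩
  rw [heq]
  exact (hI.linear_preimage R).inter (h1.inter h2)

theorem isOpen_cone (b : Bool) (w : ℂ) (δ ρ : ℝ) : IsOpen (cone b w δ ρ) := by
  rw [isOpen_iff_mem_nhds]
  intro t ht
  have hre : ContinuousAt (fun t : ℂ => (t * conj w).re) t := by fun_prop
  have him : ContinuousAt (fun t : ℂ => |(t * conj w).im|) t := by fun_prop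
  have hr : ContinuousAt (fun t : ℂ => radial b (t * conj w).re) t :=
    ContinuousAt.comp (f := fun t : ℂ => (t * conj w).re) (continuousAt_radial b ht.1.1.ne') hre
  exact ((hre.eventually (lt_mem_nhds ht.1.1)).and (hr.eventually_lt_const ht.1.2)).and
    (him.eventually_lt (continuousAt_const.mul hre) ht.2)

theorem norm_le_two_mul_re {w t : ℂ} {δ : ℝ} (hw : ‖w‖ = 1) (hδ : δ ≤ 1)
    (hre : 0 < (t * conj w).re) (him : |(t * conj w).im| < δ * (t * conj w).re) :
    (t * conj w).re ≤ ‖t‖ ∧ ‖t‖ ≤ 2 * (t * conj w).re := by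
  have hn : ‖t * conj w‖ = ‖t‖ := by simp [hw]
  have h1 := Complex.abs_re_le_norm (t * conj w)
  have h2 := Complex.norm_le_abs_re_add_abs_im (t * conj w)
  rw [hn, abs_of_pos hre] at h1 h2
  exact ⟨h1, by nlinarith⟩

theorem cone_subset_punct (b : Bool) {w : ℂ} (hw : ‖w‖ = 1) {δ ρ : ℝ} (hδ : δ ≤ 1) :
    cone b w δ ρ ⊆ punct b (2 * ρ) := by
  intro t ht
  obtain ⟨h1, h2⟩ := norm_le_two_mul_re hw hδ ht.1.1 ht.2
  have h3 : 0 < ‖t‖ := ht.1.1.trans_le h1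
  refine ⟨norm_pos_iff.1 h3, (radial_le_mul b h3 ht.1.1 h2 (by linarith)).trans_lt ?_⟩
  linarith [ht.1.2]

theorem mem_cone (b : Bool) {w : ℂ} (hw : ‖w‖ = 1) {δ ρ : ℝ} (hδ : δ ≤ 1) {t : ℂ}
    (ht : t ∈ punct b ρ) (hre : 0 < (t * conj w).re)
    (him : |(t * conj w).im| < δ * (t * conj w).re) : t ∈ cone b w δ (2 * ρ) := by
  obtain ⟨h1, h2⟩ := norm_le_two_mul_re hw hδ hre him
  refine ⟨⟨hre, (radial_le_mul b hre (norm_pos_iff.2 ht.1) (by linarith [hre.trans_le h1])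
    h2).trans_lt ?_⟩, him⟩
  linarith [ht.2]

theorem norm_bounds_of_mem_ball {s t : ℂ} (hs : s ∈ Metric.ball t (‖t‖ / 2)) :
    ‖s‖ ≤ 2 * ‖t‖ ∧ ‖t‖ ≤ 2 * ‖s‖ ∧ s ≠ 0 := by
  rw [mem_ball_iff_norm] at hs
  have h1 := norm_sub_norm_le s t
  have h2 := norm_sub_norm_le t s
  rw [norm_sub_rev t s] at h2
  have h0 := norm_nonneg (s - t)
  refine ⟨by linarith, by linarith, norm_pos_iff.1 (by linarith)⟩

theorem ball_subset_punct {b : Bool} {t : ℂ} {r : ℝ} (ht : t ∈ punct b (r / 2)) :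
    Metric.ball t (‖t‖ / 2) ⊆ punct b r := by
  intro s hs
  obtain ⟨h1, h2, h3⟩ := norm_bounds_of_mem_ball hs
  refine ⟨h3, (radial_le_mul b (norm_pos_iff.2 h3) (norm_pos_iff.2 ht.1) h1 h2).trans_lt ?_⟩
  linarith [ht.2]

section Sheet

variable {n : ℕ}

/-- Near the direction `v`, the curve `X` is a graph over the `j`-th coordinate. -/
def IsSheeted (X : Set (EuclideanSpace ℂ (Fin n))) (b : Bool) (c : EuclideanSpace ℂ (Fin n))
    (j : Fin n) (v : EuclideanSpace ℂ (Fin n)) : Prop :=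
  ∃ ε > 0, ∃ r > 0, InjOn (fun x => x j) (sec X b c j v ε r)

variable {X : Set (EuclideanSpace ℂ (Fin n))} {b : Bool} {c v : EuclideanSpace ℂ (Fin n)}
  {j : Fin n}

theorem exists_path_of_innerDist_lt {E : Type*} [NormedAddCommGroup E] {X : Set E} {x y : E}
    {L : ENNReal} (h : innerDist X x y < L) : ∃ γ : ℝ → E, ContinuousOn γ (Icc 0 1) ∧
      MapsTo γ (Icc 0 1) X ∧ γ 0 = x ∧ γ 1 = y ∧ eVariationOn γ (Icc 0 1) < L := by
  simpa only [innerDist, iInf_lt_iff, exists_prop] using h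

theorem IsLNE.isSheeted (hX : IsGraphCurve X) (hL : IsLNE X) (b : Bool)
    (c : EuclideanSpace ℂ (Fin n)) (hv : v j = 1) : IsSheeted X b c j v := by
  obtain ⟨C, hC, hd⟩ := hL
  obtain ⟨ε, hε, hgood⟩ := hX.exists_goodSec b c hv
  obtain ⟨r, h⟩ := (hgood ε hε le_rfl).exists
  have hr := h.r_pos
  set M : ℝ := 2 * (1 + 4 * C * (1 + ‖v‖)) with hM
  have hM1 : 8 * C ≤ M := by nlinarith [norm_nonneg v]
  have hMpos : 0 < M := by linarith
  obtain ⟨ε', hε', h1, h2⟩ : ∃ ε' > 0, ε' * M ≤ ε ∧ ε' * M ≤ 1 := by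
    refine ⟨min ε 1 / M, by positivity, ?_, ?_⟩ <;> rw [div_mul_cancel₀ _ hMpos.ne']
    exacts [min_le_left _ _, min_le_right _ _]
  refine ⟨ε', hε', r / 2, by positivity, fun x hx y hy hxy => ?_⟩
  by_contra hne
  have hxy : x j = y j := hxy
  set t := x j - c j with ht
  have hty : y j - c j = t := by rw [ht, hxy]
  have ht0 : 0 < ‖t‖ := norm_pos_iff.2 hx.2.1.1
  have hdist : ‖x - y‖ ≤ 2 * ε' * ‖t‖ := by
    have e1 := hx.2.2
    have e2 := hy.2.2
    rw [hty] at e2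
    calc ‖x - y‖ = ‖(x - c - t • v) - (y - c - t • v)‖ := by congr 1; abel
      _ ≤ ε' * ‖t‖ + ε' * ‖t‖ := (norm_sub_le _ _).trans (add_le_add e1 e2)
      _ = _ := by ring
  have hlt : innerDist X x y < ENNReal.ofReal (4 * C * ε' * ‖t‖) := by
    refine (hd x hx.1 y hy.1).trans_lt ?_
    have : 0 < C * ε' * ‖t‖ := by positivity
    rw [ENNReal.ofReal_lt_ofReal_iff (by linarith)]
    nlinarith
  obtain ⟨γ, hγ, hγX, hγ0, hγ1, hlen⟩ := exists_path_of_innerDist_lt hlt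
  have hclose : ∀ s ∈ Icc (0 : ℝ) 1, ‖γ s - x‖ < 4 * C * ε' * ‖t‖ := by
    intro s hs
    have := (eVariationOn.edist_le γ hs (left_mem_Icc.2 zero_le_one)).trans_lt hlen
    rwa [hγ0, edist_dist, dist_eq_norm,
      ENNReal.ofReal_lt_ofReal_iff_of_nonneg (norm_nonneg _)] at this
  have hcoord : ∀ s ∈ Icc (0 : ℝ) 1, ‖(γ s j - c j) - t‖ < 4 * C * ε' * ‖t‖ := by
    intro s hs
    refine lt_of_le_of_lt ?_ (hclose s hs)
    have := PiLp.norm_apply_le (γ s - x) j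
    rw [ht]
    have e : (γ s - x) j = (γ s j - c j) - (x j - c j) := by simp
    rwa [e] at this
  have hball : ∀ s ∈ Icc (0 : ℝ) 1, γ s j - c j ∈ Metric.ball t (‖t‖ / 2) := by
    intro s hs
    rw [mem_ball_iff_norm]
    refine (hcoord s hs).trans_le ?_
    have : 8 * C * ε' ≤ 1 := by nlinarith
    nlinarith
  have hpunct := ball_subset_punct hx.2.1
  have hsec : ∀ s ∈ Icc (0 : ℝ) 1, γ s ∈ sec X b c j v ε r := by
    intro s hs
    refine ⟨hγX hs, hpunct (hball s hs), ?_⟩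
    have hb := (norm_bounds_of_mem_ball (hball s hs)).2.1
    have e1 : ‖γ s - c - (γ s j - c j) • v‖ ≤
        ε' * ‖t‖ + 4 * C * ε' * ‖t‖ + 4 * C * ε' * ‖t‖ * ‖v‖ := by
      calc ‖γ s - c - (γ s j - c j) • v‖
          = ‖(x - c - t • v) + (γ s - x) - ((γ s j - c j) - t) • v‖ := by
            congr 1; rw [sub_smul (γ s j - c j) t v]; abel
        _ ≤ ‖x - c - t • v‖ + ‖γ s - x‖ + ‖((γ s j - c j) - t) • v‖ :=
            (norm_sub_le _ _).trans (add_le_add_left (norm_add_le _ _) _)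
        _ ≤ _ := by
            rw [norm_smul]
            gcongr
            · exact hx.2.2
            · exact (hclose s hs).le
            · exact (hcoord s hs).le
    have e2 : ε' * ‖t‖ + 4 * C * ε' * ‖t‖ + 4 * C * ε' * ‖t‖ * ‖v‖ = ε' * M * ‖t‖ / 2 := by
      rw [hM]; ring
    have e3 : 0 ≤ ‖γ s j - c j‖ := norm_nonneg _
    rw [e2] at e1
    nlinarith
  obtain ⟨g, hg, hgm, hg0⟩ := h.exists_lift (convex_ball t (‖t‖ / 2)) Metric.isOpen_ball
    (f := id) continuousOn_id hpunct (Metric.mem_ball_self (by positivity))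
    (sec_mono (by nlinarith) (by linarith) hx) rfl
  have hcγ : ContinuousOn (fun s => γ s j - c j) (Icc 0 1) :=
    ((GoodSec.continuous_coord j).comp_continuousOn hγ).sub continuousOn_const
  have key := h.eqOn_of_coord_eq isPreconnected_Icc hγ (hg.comp hcγ hball) hsec
    (fun s hs => (hgm _ (hball s hs)).1)
    (fun s hs => by
      have := (hgm _ (hball s hs)).2
      simp only [id, sub_left_inj] at this
      exact this.symm) (left_mem_Icc.2 zero_le_one)
    (by simp only [Function.comp, hγ0]; exact hg0.symm)
  have h1 := key (right_mem_Icc.2 zero_le_one)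
  simp only [Function.comp, hγ1, hty] at h1
  exact hne (hg0.symm.trans h1.symm)

end Sheet

section Direction

variable {E F : Type*} [NormedAddCommGroup E] [NormedSpace ℝ E]
  [NormedAddCommGroup F] [NormedSpace ℝ F]

/-- The inverse of the spherical blow-up, at `c` or at infinity. -/
def dirMap (b : Bool) (c x : E) : E × ℝ := (‖x - c‖⁻¹ • (x - c), radial b ‖x - c‖)

/-- The trace on `X` of the neighbourhoods of the boundary point `(u, 0)` of the blow-up. -/
def dirFilter (X : Set E) (b : Bool) (c u : E) : Filter E :=
  comap (dirMap b c) (𝓝 (u, 0)) ⊓ 𝓟 (X \ {c})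

/-- A filter with a basis of preconnected sets. -/
def HasPreconnectedBasis {α : Type*} [TopologicalSpace α] (l : Filter α) : Prop :=
  ∀ S ∈ l, ∃ Z ∈ l, Z ⊆ S ∧ IsPreconnected Z

theorem tendsto_dirFilter {X : Set E} {Y : Set F} {h : E → F} {b : Bool} {c u : E} {c' v : F}
    {Φ : E × ℝ → F × ℝ} (hm : MapsTo h X Y)
    (hΦ : ContinuousWithinAt Φ (dirMap b c '' (X \ {c})) (u, 0)) (huv : Φ (u, 0) = (v, 0))
    (hcomm : ∀ x ∈ X, x ≠ c → h x ≠ c' → Φ (dirMap b c x) = dirMap b c' (h x))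
    (hev : ∀ᶠ x in dirFilter X b c u, h x ≠ c') :
    Tendsto h (dirFilter X b c u) (dirFilter Y b c' v) := by
  have hmem : ∀ᶠ x in dirFilter X b c u, x ∈ X \ {c} :=
    mem_inf_of_right (mem_principal_self _)
  have h1 : Tendsto (dirMap b c) (dirFilter X b c u) (𝓝[dirMap b c '' (X \ {c})] (u, 0)) := by
    refine tendsto_nhdsWithin_iff.2 ⟨tendsto_comap.mono_left inf_le_left, ?_⟩
    filter_upwards [hmem] with x hx using ⟨x, hx, rfl⟩
  refine tendsto_inf.2 ⟨tendsto_comap_iff.2 ?_, tendsto_principal.2 ?_⟩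
  · rw [← huv]
    refine (hΦ.tendsto.comp h1).congr' ?_
    filter_upwards [hmem, hev] with x hx hx'
    exact hcomm x hx.1 hx.2 hx'
  · filter_upwards [hmem, hev] with x hx hx' using ⟨hm hx.1, hx'⟩

theorem HasPreconnectedBasis.of_tendsto {α β : Type*} [TopologicalSpace α] [TopologicalSpace β]
    {l : Filter α} {l' : Filter β} {h : α → β} {g : β → α} {Y : Set β}
    (hl' : HasPreconnectedBasis l') (hh : Tendsto h l l') (hg : Tendsto g l' l)
    (hgh : ∀ᶠ x in l, g (h x) = x) (hY : Y ∈ l') (hgc : ContinuousOn g Y) :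
    HasPreconnectedBasis l := by
  intro S hS
  obtain ⟨Z, hZ, hZS, hZp⟩ := hl' _ (inter_mem (hg hS) hY)
  refine ⟨g '' Z, ?_, ?_, hZp.image g (hgc.mono fun z hz => (hZS hz).2)⟩
  · filter_upwards [hgh, hh hZ] with x hx hxZ using ⟨h x, hxZ, hx⟩
  · rintro _ ⟨z, hz, rfl⟩
    exact (hZS hz).1

end Direction

section Wedge

variable {n : ℕ}

/-- The part of a conical neighbourhood of a complex line over a sector. -/
def wedge (X : Set (EuclideanSpace ℂ (Fin n))) (b : Bool) (c : EuclideanSpace ℂ (Fin n))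
    (j : Fin n) (v : EuclideanSpace ℂ (Fin n)) (w : ℂ) (ε δ ρ : ℝ) :
    Set (EuclideanSpace ℂ (Fin n)) :=
  {x ∈ sec X b c j v ε ρ | x j - c j ∈ cone b w δ ρ}

/-- The unit vector of the complex line spanned by `v` with phase `w`. -/
def dirOf (v : EuclideanSpace ℂ (Fin n)) (w : ℂ) : EuclideanSpace ℂ (Fin n) :=
  ((‖v‖⁻¹ : ℝ) * w : ℂ) • v

variable {X : Set (EuclideanSpace ℂ (Fin n))} {b : Bool} {c v : EuclideanSpace ℂ (Fin n)}
  {j : Fin n} {w : ℂ} {ε δ ρ : ℝ}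

theorem ne_zero_of_coord_eq_one (hv : v j = 1) : v ≠ 0 := by
  rintro rfl
  simp at hv

theorem exists_dirOf {u : EuclideanSpace ℂ (Fin n)} (hu : ‖u‖ = 1) :
    ∃ (j : Fin n) (v : EuclideanSpace ℂ (Fin n)) (w : ℂ), v j = 1 ∧ ‖w‖ = 1 ∧ u = dirOf v w := by
  obtain ⟨j, hj⟩ : ∃ j, u j ≠ 0 := by
    by_contra! h
    have : u = 0 := by ext i; exact h i
    simp [this] at hu
  refine ⟨j, (u j)⁻¹ • u, u j / ‖u j‖, by simp [hj], by simp [hj], ?_⟩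
  have : (‖u j‖ : ℂ) ≠ 0 := by simpa using hj
  rw [dirOf, smul_smul, norm_smul, hu]
  have e : (((‖(u j)⁻¹‖ * 1)⁻¹ : ℝ) : ℂ) * (u j / ‖u j‖) * (u j)⁻¹ = 1 := by
    simp only [norm_inv, mul_one, inv_inv]
    field_simp
  rw [e, one_smul]

theorem wedge_mem_dirFilter (hv : v j = 1) (hw : ‖w‖ = 1) (hε : 0 < ε) (hδ : 0 < δ) (hρ : 0 < ρ) :
    wedge X b c j v w ε δ ρ ∈ dirFilter X b c (dirOf v w) := by
  have hv0 : 0 < ‖v‖ := norm_pos_iff.2 (ne_zero_of_coord_eq_one hv)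
  set u := dirOf v w with hu
  have huj : u j = (‖v‖⁻¹ : ℝ) * w := by simp [hu, dirOf, hv]
  have hww : w * conj w = 1 := by rw [Complex.mul_conj, Complex.normSq_eq_norm_sq, hw]; simp
  have hujw : u j * conj w = (‖v‖⁻¹ : ℝ) := by rw [huj, mul_assoc, hww, mul_one]
  have huj0 : 0 < ‖u j‖ := by rw [huj]; simp [hw, hv0]
  have huv : u - u j • v = 0 := by rw [huj, hu, dirOf, sub_self]
  have hz1 : Continuous fun z : EuclideanSpace ℂ (Fin n) × ℝ => z.1 j :=
    (GoodSec.continuous_coord j).comp continuous_fst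
  have hre : ContinuousAt (fun z : EuclideanSpace ℂ (Fin n) × ℝ => (z.1 j * conj w).re) (u, 0) :=
    (Complex.continuous_re.comp (hz1.mul continuous_const)).continuousAt
  have him : ContinuousAt (fun z : EuclideanSpace ℂ (Fin n) × ℝ => |(z.1 j * conj w).im|) (u, 0) :=
    (Complex.continuous_im.comp (hz1.mul continuous_const)).abs.continuousAt
  have hreu : 0 < (u j * conj w).re := by rw [hujw, Complex.ofReal_re]; positivity
  have h1 : ∀ᶠ z : EuclideanSpace ℂ (Fin n) × ℝ in 𝓝 (u, 0), 0 < (z.1 j * conj w).re :=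
    hre.eventually (lt_mem_nhds hreu)
  have h2 : ∀ᶠ z : EuclideanSpace ℂ (Fin n) × ℝ in 𝓝 (u, 0),
      |(z.1 j * conj w).im| < δ * (z.1 j * conj w).re := by
    refine him.eventually_lt (continuousAt_const.mul hre) ?_
    simp only [hujw, Complex.ofReal_im, abs_zero, Complex.ofReal_re]
    positivity
  have h3 : ∀ᶠ z : EuclideanSpace ℂ (Fin n) × ℝ in 𝓝 (u, 0),
      ‖z.1 - z.1 j • v‖ < ε * ‖z.1 j‖ := by
    refine ContinuousAt.eventually_lt ?_ ?_ ?_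
    · exact (continuous_fst.sub (hz1.smul continuous_const)).norm.continuousAt
    · exact (continuous_const.mul hz1.norm).continuousAt
    · simp only [huv, norm_zero]
      positivity
  have h4 : ∀ᶠ z : EuclideanSpace ℂ (Fin n) × ℝ in 𝓝 (u, 0),
      z.2 * radial b (z.1 j * conj w).re < ρ := by
    refine (ContinuousAt.mul continuousAt_snd (ContinuousAt.comp (g := radial b)
      (continuousAt_radial b hreu.ne') hre)).eventually_lt_const ?_
    simpa using hρ
  have h5 : ∀ᶠ z : EuclideanSpace ℂ (Fin n) × ℝ in 𝓝 (u, 0), z.2 * radial b ‖z.1 j‖ < ρ := by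
    refine (ContinuousAt.mul continuousAt_snd (ContinuousAt.comp (g := radial b)
      (f := fun z : EuclideanSpace ℂ (Fin n) × ℝ => ‖z.1 j‖)
      (continuousAt_radial b huj0.ne') hz1.norm.continuousAt)).eventually_lt_const ?_
    simpa using hρ
  refine mem_inf_iff_superset.2 ⟨_, preimage_mem_comap (h1.and (h2.and (h3.and (h4.and h5)))), _,
    mem_principal_self _, ?_⟩
  rintro x ⟨⟨g1, g2, g3, g4, g5⟩, hx, hxc⟩
  simp only [dirMap] at g1 g2 g3 g4 g5
  have hR : 0 < ‖x - c‖ := norm_pos_iff.2 (sub_ne_zero.2 hxc)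
  set R := ‖x - c‖ with hRdef
  set z := R⁻¹ • (x - c) with hz
  have hxz : x - c = R • z := by rw [hz, smul_smul, mul_inv_cancel₀ hR.ne', one_smul]
  have hxj : x j - c j = R * z j := by
    have := congrArg (fun y : EuclideanSpace ℂ (Fin n) => y j) hxz
    simpa using this
  have hn : ‖x j - c j‖ = R * ‖z j‖ := by rw [hxj]; simp [abs_of_pos hR]
  have hre' : ((x j - c j) * conj w).re = R * (z j * conj w).re := by
    rw [hxj, mul_assoc, Complex.re_ofReal_mul]
  have him' : ((x j - c j) * conj w).im = R * (z j * conj w).im := by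
    rw [hxj, mul_assoc, Complex.im_ofReal_mul]
  have hz0 : z j ≠ 0 := by
    intro h0
    simp [h0] at g1
  refine ⟨⟨hx, ⟨?_, ?_⟩, ?_⟩, ⟨?_, ?_⟩, ?_⟩
  · rw [hxj]; exact mul_ne_zero (by exact_mod_cast hR.ne') hz0
  · rw [hn, radial_mul]; exact g5
  · have : x - c - (x j - c j) • v = (R : ℂ) • (z - z j • v) := by
      rw [hxj, smul_sub, smul_smul, hxz]; simp
    rw [this, norm_smul, hn]
    simp only [Complex.norm_real, Real.norm_eq_abs, abs_of_pos hR]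
    nlinarith
  · rw [hre']; positivity
  · rw [hre', radial_mul]; exact g4
  · rw [hre', him', abs_mul, abs_of_pos hR]
    nlinarith

theorem exists_wedge_subset (hv : v j = 1) (hw : ‖w‖ = 1) {S : Set (EuclideanSpace ℂ (Fin n))}
    (hS : S ∈ dirFilter X b c (dirOf v w)) :
    ∃ ε > 0, ∃ δ > 0, ∃ ρ > 0, wedge X b c j v w ε δ ρ ⊆ S := by
  have hv0 : v ≠ 0 := ne_zero_of_coord_eq_one hv
  obtain ⟨V, hV, W, hW, hVW⟩ := mem_inf_iff_superset.1 hS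
  obtain ⟨N, hN, hNV⟩ := mem_comap.1 hV
  rw [mem_principal] at hW
  have hwv : w • v ≠ 0 := smul_ne_zero (by rintro rfl; simp at hw) hv0
  let Ψ : (ℂ × EuclideanSpace ℂ (Fin n)) × ℝ → EuclideanSpace ℂ (Fin n) × ℝ := fun q =>
    (‖q.1.1 • v + q.1.2‖⁻¹ • (q.1.1 • v + q.1.2), q.2 * radial b ‖q.1.1 • v + q.1.2‖)
  have hΨ0 : Ψ ((w, 0), 0) = (dirOf v w, 0) := by
    simp only [Ψ, add_zero, zero_mul, norm_smul, hw, one_mul, dirOf,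
      mul_smul, Complex.coe_smul]
  have hin : Continuous fun q : (ℂ × EuclideanSpace ℂ (Fin n)) × ℝ => q.1.1 • v + q.1.2 := by
    fun_prop
  have hΨ : ContinuousAt Ψ ((w, 0), 0) := by
    have hne : ‖((w, (0 : EuclideanSpace ℂ (Fin n))), (0 : ℝ)).1.1 • v + 0‖ ≠ 0 := by
      simpa using hwv
    refine ContinuousAt.prodMk ((hin.norm.continuousAt.inv₀ hne).smul hin.continuousAt)
      (continuousAt_snd.mul ?_)
    exact ContinuousAt.comp (g := radial b)
      (f := fun q : (ℂ × EuclideanSpace ℂ (Fin n)) × ℝ => ‖q.1.1 • v + q.1.2‖)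
      (continuousAt_radial b hne) hin.norm.continuousAt
  have hpre : Ψ ⁻¹' N ∈ 𝓝 ((w, (0 : EuclideanSpace ℂ (Fin n))), (0 : ℝ)) :=
    hΨ (by rw [hΨ0]; exact hN)
  obtain ⟨η, hη, hball⟩ := Metric.mem_nhds_iff.1 hpre
  refine ⟨η / 2, by positivity, min 1 (η / 4), by positivity, η, hη, fun x hx => hVW ⟨hNV ?_, hW ?_⟩⟩
  · obtain ⟨⟨hxX, ⟨ht0, htr⟩, hxv⟩, ⟨hre, -⟩, him⟩ := hx
    set t := x j - c j with ht
    have hT : 0 < ‖t‖ := norm_pos_iff.2 ht0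
    set e := (‖t‖⁻¹ : ℝ) • (x - c - t • v) with he
    set θ := t / ‖t‖ with hθ
    have hTc : (‖t‖ : ℂ) ≠ 0 := by exact_mod_cast hT.ne'
    have hxc : x - c = ‖t‖ • (θ • v + e) := by
      rw [he, smul_add, smul_smul ‖t‖ ‖t‖⁻¹, mul_inv_cancel₀ hT.ne', one_smul, hθ]
      have : ‖t‖ • (t / ‖t‖) • v = t • v := by
        rw [← smul_assoc, Complex.real_smul, mul_div_cancel₀ _ hTc]
      rw [this]; abel
    have hmem : ((θ, e), radial b ‖t‖) ∈ Metric.ball ((w, 0), (0 : ℝ)) η := by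
      rw [mem_ball_iff_norm]
      simp only [Prod.mk_sub_mk, Prod.norm_mk, sub_zero, sup_lt_iff]
      refine ⟨⟨?_, ?_⟩, ?_⟩
      · have e1 : ‖θ - w‖ = ‖θ * conj w - 1‖ := by
          have hww : w * conj w = 1 := by
            rw [Complex.mul_conj, Complex.normSq_eq_norm_sq, hw]; simp
          rw [← hww, ← sub_mul, norm_mul, RCLike.norm_conj, hw, mul_one]
        have hθw : t * conj w = ‖t‖ * (θ * conj w) := by rw [hθ]; field_simp
        rw [hθw, Complex.re_ofReal_mul] at hre
        rw [hθw, Complex.re_ofReal_mul, Complex.im_ofReal_mul, abs_mul, abs_of_pos hT] at him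
        have hre2 : 0 < (θ * conj w).re := pos_of_mul_pos_right hre hT.le
        have hn1 : ‖θ * conj w‖ = 1 := by
          rw [norm_mul, RCLike.norm_conj, hw, hθ, norm_div]; simp [hT.ne']
        have hsq : (θ * conj w).re ^ 2 + (θ * conj w).im ^ 2 = 1 := by
          have := Complex.sq_norm (θ * conj w)
          rw [hn1, Complex.normSq_apply] at this
          nlinarith
        have him2 : |(θ * conj w).im| < min 1 (η / 4) * (θ * conj w).re := by
          rw [mul_left_comm] at him
          exact lt_of_mul_lt_mul_left him hT.le
        set p := (θ * conj w).re with hp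
        set q := (θ * conj w).im with hq
        have hp1 : p ≤ 1 := by nlinarith [sq_nonneg q]
        have hq1 : |q| < min 1 (η / 4) := him2.trans_le (by
          have : 0 < min 1 (η / 4) := by positivity
          nlinarith)
        have hq2 : |q| < 1 := hq1.trans_le (min_le_left _ _)
        have hq4 : |q| < η / 4 := hq1.trans_le (min_le_right _ _)
        have hpq : 1 - |q| ≤ p := by
          have := sq_abs q
          nlinarith [abs_nonneg q]
        rw [e1]
        have := Complex.norm_le_abs_re_add_abs_im (θ * conj w - 1)
        simp only [Complex.sub_re, Complex.one_re, Complex.sub_im, Complex.one_im, sub_zero] at this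
        rw [← hp, ← hq, abs_of_nonpos (show p - 1 ≤ 0 by linarith)] at this
        linarith
      · rw [he, norm_smul]
        simp only [norm_inv, norm_norm]
        rw [inv_mul_lt_iff₀ hT]
        nlinarith
      · rw [Real.norm_eq_abs, abs_of_pos (radial_pos b hT)]
        exact htr
    have := hball hmem
    rw [Set.mem_preimage] at this
    have hnorm : ‖x - c‖ = ‖t‖ * ‖θ • v + e‖ := by
      rw [hxc, norm_smul, norm_norm]
    have heq : dirMap b c x = Ψ ((θ, e), radial b ‖t‖) := by
      simp only [dirMap, Ψ, hnorm, radial_mul]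
      rw [hxc, smul_smul, mul_inv, mul_right_comm, inv_mul_cancel₀ hT.ne', one_mul]
    rw [Set.mem_preimage, heq]
    exact this
  · refine ⟨hx.1.1, ?_⟩
    rintro rfl
    exact hx.1.2.1.1 (sub_self _)

end Wedge

section Sheeted

variable {n : ℕ} {X : Set (EuclideanSpace ℂ (Fin n))} {b : Bool}
  {c v : EuclideanSpace ℂ (Fin n)} {j : Fin n} {w : ℂ}

theorem IsSheeted.hasPreconnectedBasis (hs : IsSheeted X b c j v) (hX : IsGraphCurve X)
    (hv : v j = 1) (hw : ‖w‖ = 1) :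
    HasPreconnectedBasis (dirFilter X b c (dirOf v w)) := by
  intro S hS
  obtain ⟨ε₁, hε₁, δ₁, hδ₁, ρ₁, hρ₁, hsub⟩ := exists_wedge_subset hv hw hS
  obtain ⟨ε₂, hε₂, r₂, hr₂, hinj⟩ := hs
  obtain ⟨ε₀, hε₀, hgood⟩ := hX.exists_goodSec b c hv
  set ε := min ε₀ (min ε₁ ε₂) with hε
  have hε_pos : 0 < ε := by positivity
  obtain ⟨r, h, hr⟩ := ((hgood ε hε_pos (min_le_left _ _)).and
    (Ioo_mem_nhdsGT (show 0 < min ρ₁ r₂ by positivity))).exists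
  have hr1 : r ≤ ρ₁ := hr.2.le.trans (min_le_left _ _)
  have hr2 : r ≤ r₂ := hr.2.le.trans (min_le_right _ _)
  set K := cone b w (min 1 δ₁) (r / 2) with hK
  have hKr : K ⊆ punct b r := by
    have := cone_subset_punct b hw (ρ := r / 2) (min_le_left 1 δ₁)
    rwa [mul_div_cancel₀ _ two_ne_zero] at this
  refine ⟨{x ∈ sec X b c j v ε r | x j - c j ∈ K}, ?_, ?_, ?_⟩
  · refine mem_of_superset (wedge_mem_dirFilter hv hw hε_pos (show 0 < min 1 δ₁ by positivity)
      (half_pos h.r_pos)) fun x hx => ⟨sec_mono le_rfl (by linarith [h.r_pos]) hx.1, hx.2⟩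
  · refine Subset.trans (fun x hx => ?_) hsub
    exact ⟨sec_mono ((min_le_right _ _).trans (min_le_left _ _)) hr1 hx.1,
      cone_mono b w (min_le_right _ _) (by linarith [h.r_pos]) hx.2⟩
  · rcases Set.eq_empty_or_nonempty {x ∈ sec X b c j v ε r | x j - c j ∈ K} with he | ⟨x₀, hx₀, hxK⟩
    · rw [he]; exact isPreconnected_empty
    · obtain ⟨g, hg, hgm, -⟩ := h.exists_lift (convex_cone b w _ _) (isOpen_cone b w _ _) (f := id)
        continuousOn_id hKr hxK hx₀ rfl
      convert (convex_cone b w _ _).isPreconnected.image g hg using 1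
      ext x
      constructor
      · rintro ⟨hx, hxK⟩
        refine ⟨x j - c j, hxK, ?_⟩
        have hsec : sec X b c j v ε r ⊆ sec X b c j v ε₂ r₂ :=
          sec_mono ((min_le_right _ _).trans (min_le_right _ _)) hr2
        refine hinj (hsec (hgm _ hxK).1) (hsec hx) ?_
        simpa using (hgm _ hxK).2
      · rintro ⟨t, ht, rfl⟩
        refine ⟨(hgm t ht).1, ?_⟩
        rw [(hgm t ht).2]
        exact ht

theorem isSheeted_of_hasPreconnectedBasis (hX : IsGraphCurve X) (hv : v j = 1)
    (hD : ∀ w : ℂ, ‖w‖ = 1 → HasPreconnectedBasis (dirFilter X b c (dirOf v w))) :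
    IsSheeted X b c j v := by
  obtain ⟨ε₀, hε₀, hgood⟩ := hX.exists_goodSec b c hv
  obtain ⟨r, h⟩ := (hgood ε₀ hε₀ le_rfl).exists
  let p : Set ℂ → Prop := fun s => ∃ ε > 0, ∃ ρ > 0, ∀ x ∈ sec X b c j v ε ρ,
    ∀ x' ∈ sec X b c j v ε ρ, x j = x' j → (x j - c j) / ‖x j - c j‖ ∈ s → x = x'
  have hp : p (Metric.sphere 0 1) := by
    refine (isCompact_sphere (0 : ℂ) 1).induction_on (p := p) ?_ ?_ ?_ ?_
    · exact ⟨1, one_pos, 1, one_pos, fun x _ x' _ _ hs => hs.elim⟩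
    · rintro s s' hss ⟨ε, hε, ρ, hρ, h⟩
      exact ⟨ε, hε, ρ, hρ, fun x hx x' hx' he hs => h x hx x' hx' he (hss hs)⟩
    · rintro s s' ⟨ε, hε, ρ, hρ, h⟩ ⟨ε', hε', ρ', hρ', h'⟩
      refine ⟨min ε ε', by positivity, min ρ ρ', by positivity, fun x hx x' hx' he hs => ?_⟩
      rcases hs with hs | hs
      · exact h x (sec_mono (min_le_left _ _) (min_le_left _ _) hx) x'
          (sec_mono (min_le_left _ _) (min_le_left _ _) hx') he hs
      · exact h' x (sec_mono (min_le_right _ _) (min_le_right _ _) hx) x'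
          (sec_mono (min_le_right _ _) (min_le_right _ _) hx') he hs
    · intro w hw
      have hw : ‖w‖ = 1 := by simpa using hw
      obtain ⟨Z, hZ, hZsub, hZp⟩ := hD w hw _
        (wedge_mem_dirFilter hv hw hε₀ one_pos (half_pos h.r_pos))
      obtain ⟨ε₁, hε₁, δ₁, hδ₁, ρ₁, hρ₁, hsub⟩ := exists_wedge_subset hv hw hZ
      set δ := min 1 δ₁ with hδ
      have hδ0 : 0 < δ := by positivity
      have hV : {θ : ℂ | 0 < (θ * conj w).re ∧ |(θ * conj w).im| < δ * (θ * conj w).re} ∈ 𝓝 w := by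
        have hww : w * conj w = 1 := by rw [Complex.mul_conj, Complex.normSq_eq_norm_sq, hw]; simp
        have hre : ContinuousAt (fun t : ℂ => (t * conj w).re) w := by fun_prop
        have him : ContinuousAt (fun t : ℂ => |(t * conj w).im|) w := by fun_prop
        refine (hre.eventually (lt_mem_nhds ?_)).and
          (him.eventually_lt (continuousAt_const.mul hre) ?_) <;> simp [hww, hδ0]
      refine ⟨_, mem_nhdsWithin_of_mem_nhds hV, ε₁, hε₁, ρ₁ / 2, by positivity,
        fun x hx x' hx' he hθ => ?_⟩
      have ht0 : 0 < ‖x j - c j‖ := norm_pos_iff.2 hx.2.1.1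
      set t := x j - c j with ht
      have hcone : t ∈ cone b w δ ρ₁ := by
        have htθ : t * conj w = ‖t‖ * (t / ‖t‖ * conj w) := by
          have : (‖t‖ : ℂ) ≠ 0 := by exact_mod_cast ht0.ne'
          field_simp
        have h1 := hθ.1
        have h2 := hθ.2
        have hmc := mem_cone b hw (min_le_left 1 δ₁) hx.2.1 (t := t) (ρ := ρ₁ / 2)
        rw [mul_div_cancel₀ _ two_ne_zero] at hmc
        refine hmc ?_ ?_
        · rw [htθ, Complex.re_ofReal_mul]; positivity
        · rw [htθ, Complex.re_ofReal_mul, Complex.im_ofReal_mul, abs_mul, abs_of_pos ht0]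
          nlinarith
      have htx' : x' j - c j = t := by rw [ht, he]
      have hxZ : x ∈ Z := hsub ⟨sec_mono le_rfl (by linarith) hx,
        cone_mono b w (min_le_right _ _) le_rfl hcone⟩
      have hxZ' : x' ∈ Z := hsub ⟨sec_mono le_rfl (by linarith) hx',
        htx' ▸ cone_mono b w (min_le_right _ _) le_rfl hcone⟩
      have hKr : cone b w 1 (r / 2) ⊆ punct b r := by
        have := cone_subset_punct b hw (ρ := r / 2) le_rfl
        rwa [mul_div_cancel₀ _ two_ne_zero] at this
      have hsec : ∀ z ∈ Z, z ∈ sec X b c j v ε₀ r := fun z hz =>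
        sec_mono le_rfl (by linarith [h.r_pos]) (hZsub hz).1
      obtain ⟨g, hg, hgm, hgx⟩ := h.exists_lift (convex_cone b w _ _) (isOpen_cone b w _ _) (f := id)
        continuousOn_id hKr (hZsub hxZ).2 (hsec x hxZ) rfl
      have hcj : Continuous fun x : EuclideanSpace ℂ (Fin n) => x j - c j :=
        (GoodSec.continuous_coord j).sub continuous_const
      have key := h.eqOn_of_coord_eq hZp continuousOn_id
        (hg.comp hcj.continuousOn fun z hz => (hZsub hz).2) hsec
        (fun z hz => (hgm _ (hZsub hz).2).1)
        (fun z hz => by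
          have := (hgm _ (hZsub hz).2).2
          simp only [id, sub_left_inj] at this
          exact this.symm) hxZ hgx.symm
      have h1 := key hxZ'
      simp only [Function.comp, id, htx'] at h1
      exact hgx.symm.trans h1.symm
  obtain ⟨ε, hε, ρ, hρ, h⟩ := hp
  refine ⟨ε, hε, ρ, hρ, fun x hx x' hx' he => h x hx x' hx' he ?_⟩
  have : x j - c j ≠ 0 := hx.2.1.1
  simp [this]

end Sheeted

section Transfer

variable {E F : Type*} [NormedAddCommGroup E] [NormedSpace ℝ E]
  [NormedAddCommGroup F] [NormedSpace ℝ F] {X : Set E} {Y : Set F} {b : Bool} {c u : E}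

theorem tendsto_dirMap_dirFilter :
    Tendsto (dirMap b c) (dirFilter X b c u) (𝓝[dirMap b c '' (X \ {c})] (u, 0)) := by
  refine tendsto_nhdsWithin_iff.2 ⟨tendsto_comap.mono_left inf_le_left, ?_⟩
  filter_upwards [mem_inf_of_right (mem_principal_self _)] with x hx using ⟨x, hx, rfl⟩

theorem eventually_mem_dirFilter : ∀ᶠ x in dirFilter X b c u, x ∈ X \ {c} :=
  mem_inf_of_right (mem_principal_self _)

theorem tendsto_radial_dirFilter :
    Tendsto (fun x => radial b ‖x - c‖) (dirFilter X b c u) (𝓝 0) :=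
  (continuous_snd.tendsto (u, (0 : ℝ))).comp
    (tendsto_dirMap_dirFilter.mono_right nhdsWithin_le_nhds)

theorem dirFilter_le_nhdsWithin : dirFilter X true c u ≤ 𝓝[X] c := by
  refine le_inf ?_ (inf_le_right.trans (principal_mono.2 sdiff_subset))
  have h := tendsto_radial_dirFilter (X := X) (b := true) (c := c) (u := u)
  exact tendsto_iff_norm_sub_tendsto_zero.2 (by simpa [radial] using h)

theorem dirFilter_le_atInftyOn : dirFilter X false 0 u ≤ atInftyOn X := by
  refine le_inf ?_ (inf_le_right.trans (principal_mono.2 sdiff_subset))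
  rw [← tendsto_iff_comap]
  have h := tendsto_radial_dirFilter (X := X) (b := false) (c := 0) (u := u)
  have h2 : Tendsto (fun x : E => ‖x‖⁻¹) (dirFilter X false 0 u) (𝓝[>] 0) := by
    refine tendsto_nhdsWithin_iff.2 ⟨by simpa [radial] using h, ?_⟩
    filter_upwards [eventually_mem_dirFilter] with x hx
    exact inv_pos.2 (norm_pos_iff.2 hx.2)
  simpa [Pi.inv_def] using h2.inv_tendsto_nhdsGT_zero

theorem HasPreconnectedBasis.dirFilter_transfer {h : E → F} {g : F → E} {c₂ : F}
    {Φ : E × ℝ → F × ℝ} {Ψ : F × ℝ → E × ℝ}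
    (hm : MapsTo h X Y) (hgm : MapsTo g Y X) (hgh : ∀ x ∈ X, g (h x) = x)
    (hhg : ∀ y ∈ Y, h (g y) = y) (hgc : ContinuousOn g Y)
    (hlim : Tendsto (fun x => radial b ‖h x - c₂‖) (dirFilter X b c u) (𝓝 0))
    (hexc : ∀ᶠ x in dirFilter X b c u, h x ≠ c₂)
    (hexc' : ∀ v, ∀ᶠ y in dirFilter Y b c₂ v, g y ≠ c)
    (hΦ : ContinuousOn Φ (closure (dirMap b c '' (X \ {c}))))
    (hΦm : MapsTo Φ (closure (dirMap b c '' (X \ {c}))) (closure (dirMap b c₂ '' (Y \ {c₂}))))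
    (hΨ : ContinuousOn Ψ (closure (dirMap b c₂ '' (Y \ {c₂}))))
    (hΨΦ : ∀ z ∈ closure (dirMap b c '' (X \ {c})), Ψ (Φ z) = z)
    (hcomm : ∀ x ∈ X, x ≠ c → h x ≠ c₂ → Φ (dirMap b c x) = dirMap b c₂ (h x))
    (hD : ∀ v, ‖v‖ = 1 → HasPreconnectedBasis (dirFilter Y b c₂ v)) :
    HasPreconnectedBasis (dirFilter X b c u) := by
  rcases eq_or_neBot (dirFilter X b c u) with hbot | hne
  · intro S _
    exact ⟨∅, by rw [hbot]; trivial, empty_subset _, isPreconnected_empty⟩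
  have hu : (u, (0 : ℝ)) ∈ closure (dirMap b c '' (X \ {c})) :=
    mem_closure_of_tendsto (tendsto_dirMap_dirFilter.mono_right nhdsWithin_le_nhds)
      (by filter_upwards [eventually_mem_dirFilter] with x hx using ⟨x, hx, rfl⟩)
  have hΦu : ContinuousWithinAt Φ (dirMap b c '' (X \ {c})) (u, 0) :=
    (hΦ _ hu).mono subset_closure
  have ht : Tendsto (fun x => dirMap b c₂ (h x)) (dirFilter X b c u) (𝓝 (Φ (u, 0))) := by
    refine (hΦu.tendsto.comp tendsto_dirMap_dirFilter).congr' ?_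
    filter_upwards [eventually_mem_dirFilter, hexc] with x hx hx'
    exact hcomm x hx.1 hx.2 hx'
  have h2 : (Φ (u, 0)).2 = 0 :=
    tendsto_nhds_unique ((continuous_snd.tendsto _).comp ht) hlim
  have h1 : ‖(Φ (u, 0)).1‖ = 1 := by
    refine tendsto_nhds_unique ((continuous_fst.norm.tendsto _).comp ht)
      (tendsto_const_nhds.congr' ?_)
    filter_upwards [hexc] with x hx
    have : ‖h x - c₂‖ ≠ 0 := by simpa [sub_eq_zero] using hx
    simp [dirMap, norm_smul, this]
  obtain ⟨v, hv⟩ : ∃ v, Φ (u, 0) = (v, 0) := ⟨(Φ (u, 0)).1, Prod.ext rfl h2⟩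
  rw [hv] at h1
  refine (hD v h1).of_tendsto (tendsto_dirFilter hm hΦu hv hcomm hexc)
    (tendsto_dirFilter hgm (Φ := Ψ) ?_ ?_ ?_ (hexc' v)) ?_
    (eventually_mem_dirFilter.mono fun y hy => hy.1) hgc
  · exact (hΨ _ (hv ▸ hΦm hu)).mono subset_closure
  · rw [← hv, hΨΦ _ hu]
  · intro y hy hyc hgy
    have := hcomm (g y) (hgm hy) hgy (by rwa [hhg y hy])
    rw [hhg y hy] at this
    rw [← this, hΨΦ _ (subset_closure ⟨_, ⟨hgm hy, hgy⟩, rfl⟩)]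
  · filter_upwards [eventually_mem_dirFilter] with x hx using hgh x hx.1

theorem blowupInvInf_eq_dirMap : (blowupInvInf : E → E × ℝ) = dirMap false 0 := by
  ext x <;> simp [blowupInvInf, dirMap, radial]

theorem blowupInv_eq_dirMap : (blowupInv c : E → E × ℝ) = dirMap true c := by
  ext x <;> simp [blowupInv, dirMap, radial]

end Transfer

section

variable {n m : ℕ} {X : Set (EuclideanSpace ℂ (Fin n))} {Y : Set (EuclideanSpace ℂ (Fin m))}
  {h : EuclideanSpace ℂ (Fin n) → EuclideanSpace ℂ (Fin m)}

theorem tendsto_norm_atInftyOn_of_leftInverse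
    {g : EuclideanSpace ℂ (Fin m) → EuclideanSpace ℂ (Fin n)}
    (hX : IsClosed X) (hc : ContinuousOn h X) (hgm : MapsTo g Y X) (hhg : ∀ y ∈ Y, h (g y) = y) :
    Tendsto (fun y => ‖g y‖) (atInftyOn Y) atTop := by
  refine tendsto_atTop.2 fun R => ?_
  have hK : IsCompact (h '' (X ∩ Metric.closedBall 0 R)) :=
    (((isCompact_closedBall 0 R).inter_left hX)).image_of_continuousOn (hc.mono inter_subset_left)
  obtain ⟨C, hC⟩ := hK.isBounded.exists_norm_le
  have h1 : ∀ᶠ y in atInftyOn Y, C < ‖y‖ :=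
    (tendsto_comap.mono_left inf_le_left).eventually (eventually_gt_atTop C)
  filter_upwards [h1, mem_inf_of_right (mem_principal_self _)] with y hy hyY
  by_contra! hlt
  exact absurd (hC y ⟨g y, ⟨hgm hyY, by simpa using hlt.le⟩, hhg y hyY⟩) (not_le.2 hy)

theorem IsBSHomeo.isSheeted_finite (hh : IsBSHomeo h X Y) (hX : IsGraphCurve X)
    (hY : IsGraphCurve Y)
    (hS : ∀ (c v : EuclideanSpace ℂ (Fin m)) (j : Fin m), v j = 1 → IsSheeted Y true c j v)
    {p : EuclideanSpace ℂ (Fin n)} (hp : p ∈ X) {j : Fin n} {v : EuclideanSpace ℂ (Fin n)}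
    (hv : v j = 1) : IsSheeted X true p j v := by
  obtain ⟨⟨hbij, hhc, g, hgh, hhg, hgc⟩, hfin, -⟩ := hh
  have hgm : MapsTo g Y X := fun y hy => by
    obtain ⟨x, hx, rfl⟩ := hbij.surjOn hy
    rwa [hgh x hx]
  obtain ⟨qo, -, hlim, Φ, ⟨hΦb, hΦc, Ψ, hΨΦ, hΦΨ, hΨc⟩, hcomm⟩ := hfin p (subset_closure hp)
  have hcp : Tendsto h (𝓝[X] p) (𝓝 (h p)) := hhc p hp
  have : (𝓝[X] p).NeBot := mem_closure_iff_nhdsWithin_neBot.1 (subset_closure hp)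
  obtain rfl : qo = some (h p) := by
    cases qo with
    | none => exact absurd hcp.norm (not_tendsto_nhds_of_tendsto_atTop hlim _)
    | some q => exact congrArg some (tendsto_nhds_unique hlim hcp)
  refine isSheeted_of_hasPreconnectedBasis hX hv fun w hw => ?_
  simp only [strictTransformO, strictTransform, blowupInvO, IsCenter, blowupInv_eq_dirMap]
    at hΦb hΦc hΨΦ hΨc hcomm
  refine HasPreconnectedBasis.dirFilter_transfer hbij.mapsTo hgm hgh hhg hgc ?_ ?_ ?_ hΦc
    hΦb.mapsTo hΨc hΨΦ hcomm ?_
  · simpa [radial] using tendsto_iff_norm_sub_tendsto_zero.1 (hcp.mono_left dirFilter_le_nhdsWithin)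
  · filter_upwards [eventually_mem_dirFilter] with x hx hxp
    exact hx.2 (hbij.injOn hx.1 hp hxp)
  · intro v
    filter_upwards [eventually_mem_dirFilter] with y hy hyp
    exact hy.2 (by rw [mem_singleton_iff, ← hyp, hhg y hy.1])
  · intro u hu
    obtain ⟨j', v', w', hv', hw', rfl⟩ := exists_dirOf hu
    exact (hS _ v' j' hv').hasPreconnectedBasis hY hv' hw'

theorem IsBSHomeo.isSheeted_inf (hh : IsBSHomeo h X Y) (hX : IsGraphCurve X)
    (hY : IsGraphCurve Y)
    (hS : ∀ (v : EuclideanSpace ℂ (Fin m)) (j : Fin m), v j = 1 → IsSheeted Y false 0 j v)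
    {j : Fin n} {v : EuclideanSpace ℂ (Fin n)}
    (hv : v j = 1) : IsSheeted X false 0 j v := by
  obtain ⟨⟨hbij, hhc, g, hgh, hhg, hgc⟩, -, hinf⟩ := hh
  have hgm : MapsTo g Y X := fun y hy => by
    obtain ⟨x, hx, rfl⟩ := hbij.surjOn hy
    rwa [hgh x hx]
  have hgt := tendsto_norm_atInftyOn_of_leftInverse hX.isClosed hhc hgm hhg
  have hht := tendsto_norm_atInftyOn_of_leftInverse hY.isClosed hgc hbij.mapsTo hgh
  obtain ⟨qo, -, hlim, Φ, ⟨hΦb, hΦc, Ψ, hΨΦ, hΦΨ, hΨc⟩, hcomm⟩ := hinf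
  refine isSheeted_of_hasPreconnectedBasis hX hv fun w hw => ?_
  rcases eq_or_neBot (dirFilter X false 0 (dirOf v w)) with hbot | hne
  · intro S _
    exact ⟨∅, by rw [hbot]; trivial, empty_subset _, isPreconnected_empty⟩
  have : (atInftyOn X).NeBot := hne.mono dirFilter_le_atInftyOn
  obtain rfl : qo = none := by
    cases qo with
    | none => rfl
    | some q => exact absurd (Tendsto.norm hlim) (not_tendsto_nhds_of_tendsto_atTop hht _)
  simp only [strictTransformO, strictTransformInf, blowupInvO, IsCenter, blowupInvInf_eq_dirMap]
    at hΦb hΦc hΨΦ hΨc hcomm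
  refine HasPreconnectedBasis.dirFilter_transfer hbij.mapsTo hgm hgh hhg hgc ?_ ?_ ?_ hΦc
    hΦb.mapsTo hΨc hΨΦ hcomm ?_
  · simpa [radial, Pi.inv_def] using (hht.mono_left dirFilter_le_atInftyOn).inv_tendsto_atTop
  · filter_upwards [(hht.mono_left dirFilter_le_atInftyOn).eventually_gt_atTop 0] with x hx
    exact norm_pos_iff.1 hx
  · intro v
    filter_upwards [(hgt.mono_left dirFilter_le_atInftyOn).eventually_gt_atTop 0] with x hx
    exact norm_pos_iff.1 hx
  · intro u hu
    obtain ⟨j', v', w', hv', hw', rfl⟩ := exists_dirOf hu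
    exact (hS v' j' hv').hasPreconnectedBasis hY hv' hw'

end

section InnerDist

variable {E : Type*} [NormedAddCommGroup E] {X : Set E} {x y z : E}

theorem innerDist_le_eVariationOn {γ : ℝ → E} (hγ : ContinuousOn γ (Icc 0 1))
    (hm : MapsTo γ (Icc 0 1) X) : innerDist X (γ 0) (γ 1) ≤ eVariationOn γ (Icc 0 1) :=
  iInf_le_of_le γ <| iInf_le_of_le hγ <| iInf_le_of_le hm <| iInf_le_of_le rfl <|
    iInf_le_of_le rfl le_rfl

theorem innerDist_self (hx : x ∈ X) : innerDist X x x = 0 := by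
  have h := innerDist_le_eVariationOn (X := X) (γ := fun _ : ℝ => x) continuousOn_const
    fun _ _ => hx
  rw [eVariationOn.constant_on (by rintro _ ⟨_, _, rfl⟩ _ ⟨_, _, rfl⟩; rfl)] at h
  exact le_antisymm h bot_le

theorem innerDist_comm_le : innerDist X y x ≤ innerDist X x y := by
  refine le_of_forall_gt fun L hL => ?_
  obtain ⟨γ, hγ, hm, rfl, rfl, hlen⟩ := exists_path_of_innerDist_lt hL
  have hmap : MapsTo (fun s : ℝ => 1 - s) (Icc 0 1) (Icc 0 1) := fun s hs =>
    ⟨by linarith [hs.2], by linarith [hs.1]⟩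
  have h := innerDist_le_eVariationOn (X := X) (γ := γ ∘ fun s : ℝ => 1 - s)
    (hγ.comp (by fun_prop) hmap) (hm.comp hmap)
  simp only [Function.comp, sub_zero, sub_self] at h
  refine (h.trans ?_).trans_lt hlen
  exact eVariationOn.comp_le_of_antitoneOn γ (fun s : ℝ => 1 - s)
    (fun a _ b _ hab => sub_le_sub_left hab 1) hmap

theorem innerDist_comm : innerDist X x y = innerDist X y x :=
  le_antisymm innerDist_comm_le innerDist_comm_le

theorem innerDist_triangle : innerDist X x z ≤ innerDist X x y + innerDist X y z := by
  refine ENNReal.le_of_forall_pos_le_add fun η hη hfin => ?_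
  have hη' : (η / 2 : ENNReal) ≠ 0 := by simpa using hη.ne'
  obtain ⟨γ₁, h₁, hm₁, h₁0, h₁1, hl₁⟩ := exists_path_of_innerDist_lt
    (ENNReal.lt_add_right (ENNReal.add_lt_top.1 hfin).1.ne hη')
  obtain ⟨γ₂, h₂, hm₂, h₂0, h₂1, hl₂⟩ := exists_path_of_innerDist_lt
    (ENNReal.lt_add_right (ENNReal.add_lt_top.1 hfin).2.ne hη')
  let γ : ℝ → E := fun s => if s ≤ 1 / 2 then γ₁ (2 * s) else γ₂ (2 * s - 1)
  have e₁ : EqOn γ (γ₁ ∘ fun s => 2 * s) (Icc 0 (1 / 2)) := fun s hs => by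
    simp only [γ, if_pos hs.2, Function.comp]
  have e₂ : EqOn γ (γ₂ ∘ fun s => 2 * s - 1) (Icc (1 / 2) 1) := fun s hs => by
    rcases hs.1.eq_or_lt with rfl | hlt
    · simp [γ, h₁1, h₂0]
    · simp only [γ, if_neg (not_le.2 hlt), Function.comp]
  have m₁ : MapsTo (fun s : ℝ => 2 * s) (Icc 0 (1 / 2)) (Icc 0 1) := fun s hs =>
    ⟨by linarith [hs.1], by linarith [hs.2]⟩
  have m₂ : MapsTo (fun s : ℝ => 2 * s - 1) (Icc (1 / 2) 1) (Icc 0 1) := fun s hs =>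
    ⟨by linarith [hs.1], by linarith [hs.2]⟩
  have c₁ : ContinuousOn γ (Icc 0 (1 / 2)) := (h₁.comp (by fun_prop) m₁).congr e₁
  have c₂ : ContinuousOn γ (Icc (1 / 2) 1) := (h₂.comp (by fun_prop) m₂).congr e₂
  have hU : Icc (0 : ℝ) 1 = Icc 0 (1 / 2) ∪ Icc (1 / 2) 1 :=
    (Icc_union_Icc_eq_Icc (by norm_num) (by norm_num)).symm
  have hγ : ContinuousOn γ (Icc 0 1) := hU ▸ c₁.union_of_isClosed c₂ isClosed_Icc isClosed_Icc
  have hm : MapsTo γ (Icc 0 1) X := by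
    rw [hU]
    exact ((hm₁.comp m₁).congr e₁.symm).union ((hm₂.comp m₂).congr e₂.symm)
  have h := innerDist_le_eVariationOn hγ hm
  have h0 : γ 0 = x := by simp [γ, h₁0]
  have h1 : γ 1 = z := by norm_num [γ, h₂1]
  have hsum := eVariationOn.Icc_add_Icc γ (s := univ) (a := 0) (b := 1 / 2) (c := 1)
    (by norm_num) (by norm_num) trivial
  simp only [univ_inter] at hsum
  rw [h0, h1, ← hsum, eVariationOn.eq_of_eqOn e₁, eVariationOn.eq_of_eqOn e₂] at h
  have k₁ := eVariationOn.comp_le_of_monotoneOn γ₁ (fun s : ℝ => 2 * s)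
    (fun a _ b _ hab => by simpa using hab) m₁
  have k₂ := eVariationOn.comp_le_of_monotoneOn γ₂ (fun s : ℝ => 2 * s - 1)
    (fun a _ b _ hab => by simpa using hab) m₂
  calc _ ≤ _ := h
    _ ≤ (innerDist X x y + η / 2) + (innerDist X y z + η / 2) :=
      add_le_add (k₁.trans hl₁.le) (k₂.trans hl₂.le)
    _ = innerDist X x y + innerDist X y z + η := by
      rw [add_add_add_comm, ENNReal.add_halves]

theorem innerDist_triangle_ofReal {a b : ℝ} (ha : 0 ≤ a) (hb : 0 ≤ b)
    (hxy : innerDist X x y ≤ ENNReal.ofReal a) (hyz : innerDist X y z ≤ ENNReal.ofReal b) :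
    innerDist X x z ≤ ENNReal.ofReal (a + b) := by
  rw [ENNReal.ofReal_add ha hb]
  exact innerDist_triangle.trans (add_le_add hxy hyz)

theorem innerDist_le_of_lipschitzOnWith {γ : ℝ → E} {K : NNReal}
    (hγ : LipschitzOnWith K γ (Icc 0 1)) (hm : MapsTo γ (Icc 0 1) X) :
    innerDist X (γ 0) (γ 1) ≤ K := by
  refine (innerDist_le_eVariationOn hγ.continuousOn hm).trans ?_
  refine (hγ.comp_eVariationOn_le (f := γ) (g := id) (s := Icc 0 1) (mapsTo_id _)).trans ?_
  have := (monotoneOn_id (s := Icc (0 : ℝ) 1)).eVariationOn_eq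
    (left_mem_Icc.2 zero_le_one) (right_mem_Icc.2 zero_le_one)
  rw [inter_self] at this
  rw [this]
  simp

theorem innerDist_le_of_norm_deriv_le [NormedSpace ℝ E] {γ γ' : ℝ → E} {K : ℝ} (hK : 0 ≤ K)
    (hγ : ∀ s ∈ Icc (0 : ℝ) 1, HasDerivAt γ (γ' s) s) (hγ' : ∀ s ∈ Icc (0 : ℝ) 1, ‖γ' s‖ ≤ K)
    (hm : MapsTo γ (Icc 0 1) X) : innerDist X (γ 0) (γ 1) ≤ ENNReal.ofReal K :=
  innerDist_le_of_lipschitzOnWith (K := K.toNNReal)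
    ((convex_Icc 0 1).lipschitzOnWith_of_nnnorm_hasDerivWithin_le
      (fun s hs => (hγ s hs).hasDerivWithinAt)
      fun s hs => by rw [← NNReal.coe_le_coe, Real.coe_toNNReal _ hK]; exact hγ' s hs) hm

end InnerDist

section Sheet

variable {n : ℕ} {X : Set (EuclideanSpace ℂ (Fin n))} {b : Bool} {c v : EuclideanSpace ℂ (Fin n)}
  {j : Fin n} {ε r L : ℝ} {φ : ℂ → EuclideanSpace ℂ (Fin n)}

theorem convex_setOf_radial_exp_lt (b : Bool) (r : ℝ) :
    Convex ℝ {z : ℂ | radial b (Real.exp z.re) < r} := by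
  have h : Convex ℝ {s : ℝ | radial b (Real.exp s) < r} := by
    refine OrdConnected.convex ⟨fun s hs s' hs' a ha => ?_⟩
    simp only [Set.mem_ofPred_eq] at hs hs' ⊢
    cases b
    · refine lt_of_le_of_lt ?_ hs
      simp only [radial, Bool.false_eq_true, if_false]
      exact inv_anti₀ (Real.exp_pos _) (Real.exp_le_exp.2 ha.1)
    · refine lt_of_le_of_lt ?_ hs'
      simp only [radial, if_true]
      exact Real.exp_le_exp.2 ha.2
  exact h.linear_preimage Complex.reLm

theorem isOpen_setOf_radial_exp_lt (b : Bool) (r : ℝ) :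
    IsOpen {z : ℂ | radial b (Real.exp z.re) < r} := by
  refine isOpen_lt (continuous_iff_continuousAt.2 fun z => ?_) continuous_const
  exact ContinuousAt.comp (g := radial b) (f := fun z : ℂ => Real.exp z.re)
    (continuousAt_radial b (Real.exp_pos _).ne')
    (Real.continuous_exp.comp Complex.continuous_re).continuousAt

theorem GoodSec.exists_mem_of_nonempty (h : GoodSec X b c j v ε r)
    (hne : (sec X b c j v ε r).Nonempty) {t : ℂ} (ht : t ∈ punct b r) :
    ∃ x ∈ sec X b c j v ε r, x j - c j = t := by
  obtain ⟨x₀, hx₀⟩ := hne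
  have hexp : ∀ {s : ℂ}, s ≠ 0 → Real.exp (Complex.log s).re = ‖s‖ := fun hs => by
    rw [Complex.log_re, Real.exp_log (norm_pos_iff.2 hs)]
  obtain ⟨g, -, hg, -⟩ := h.exists_lift (convex_setOf_radial_exp_lt b r)
    (isOpen_setOf_radial_exp_lt b r) (f := Complex.exp) Complex.continuous_exp.continuousOn
    (fun z hz => ⟨Complex.exp_ne_zero z, by rw [Complex.norm_exp]; exact hz⟩)
    (z₀ := Complex.log (x₀ j - c j)) (by
      rw [Set.mem_ofPred_eq, hexp hx₀.2.1.1]; exact hx₀.2.1.2) hx₀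
    (Complex.exp_log hx₀.2.1.1).symm
  obtain ⟨h1, h2⟩ := hg (Complex.log t) (by rw [Set.mem_ofPred_eq, hexp ht.1]; exact ht.2)
  exact ⟨_, h1, by rw [h2, Complex.exp_log ht.1]⟩

/-- A holomorphic graph with bounded derivative over a punctured disc (or a neighbourhood of
infinity) in the coordinate `j` centred at `c`. -/
structure IsSheet (X : Set (EuclideanSpace ℂ (Fin n))) (b : Bool) (c : EuclideanSpace ℂ (Fin n))
    (j : Fin n) (r L : ℝ) (φ : ℂ → EuclideanSpace ℂ (Fin n)) : Prop where
  mem : ∀ t ∈ punct b r, φ t ∈ X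
  coord : ∀ t ∈ punct b r, φ t j - c j = t
  differentiableAt : ∀ t ∈ punct b r, DifferentiableAt ℂ φ t
  norm_deriv_le : ∀ t ∈ punct b r, ‖deriv φ t‖ ≤ L
  norm_sub_le : ∀ t ∈ punct b r, ‖φ t - c‖ ≤ L * ‖t‖
  nonneg : 0 ≤ L

theorem IsSheeted.exists_sheet (hs : IsSheeted X b c j v) (hX : IsGraphCurve X) (hv : v j = 1) :
    ∃ ε > 0, ∃ r > 0, sec X b c j v ε r = ∅ ∨
      ∃ L φ, IsSheet X b c j r L φ ∧ ∀ x ∈ sec X b c j v ε r, φ (x j - c j) = x := by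
  obtain ⟨ε₂, hε₂, r₂, hr₂, hinj⟩ := hs
  obtain ⟨ε₀, hε₀, hgood⟩ := hX.exists_goodSec b c hv
  have hε : 0 < min ε₀ ε₂ := lt_min hε₀ hε₂
  obtain ⟨r, h, -, hr⟩ := ((hgood _ hε (min_le_left _ _)).and (Ioo_mem_nhdsGT hr₂)).exists
  set ε := min ε₀ ε₂
  replace hinj : InjOn (fun x : EuclideanSpace ℂ (Fin n) => x j) (sec X b c j v ε r) :=
    hinj.mono (sec_mono (min_le_right _ _) hr.le)
  have hr0 := h.r_pos
  have hhalf : punct b (r / 2) ⊆ punct b r := punct_mono b (by linarith)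
  refine ⟨ε, hε, r / 2, by positivity, ?_⟩
  rcases (sec X b c j v ε r).eq_empty_or_nonempty with hemp | hne
  · exact Or.inl (subset_eq_empty (sec_mono le_rfl (by linarith)) hemp)
  right
  have hex : ∀ t : ℂ, ∃ x, t ∈ punct b r → x ∈ sec X b c j v ε r ∧ x j - c j = t := fun t => by
    by_cases ht : t ∈ punct b r
    · obtain ⟨x, hx⟩ := h.exists_mem_of_nonempty hne ht
      exact ⟨x, fun _ => hx⟩
    · exact ⟨0, fun h => absurd h ht⟩
  choose φ hφ using hex
  have huniq : ∀ t ∈ punct b r, ∀ x ∈ sec X b c j v ε r, x j - c j = t → φ t = x :=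
    fun t ht x hx hxt => hinj (hφ t ht).1 hx (sub_left_inj.1 ((hφ t ht).2.trans hxt.symm))
  have hcont : ContinuousOn φ (punct b r) := by
    intro t ht
    obtain ⟨η, hη, hball⟩ := Metric.isOpen_iff.1 (isOpen_punct b r) t ht
    obtain ⟨g, hgc, hg, -⟩ := h.exists_lift (convex_ball t η) Metric.isOpen_ball continuousOn_id
      hball (Metric.mem_ball_self hη) (hφ t ht).1 (hφ t ht).2
    refine ContinuousAt.continuousWithinAt
      (ContinuousOn.continuousAt (hgc.congr fun s hs => ?_) (Metric.ball_mem_nhds t hη))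
    exact huniq s (hball hs) (g s) (hg s hs).1 (hg s hs).2
  refine ⟨‖v‖ + 6 * ε, φ, ⟨fun t ht => (hφ t (hhalf ht)).1.1, fun t ht => (hφ t (hhalf ht)).2,
    fun t ht => ?_, fun t ht => ?_, fun t ht => ?_, by positivity⟩, fun x hx => ?_⟩
  · have hn := (isOpen_punct b r).mem_nhds (hhalf ht)
    exact h.differentiableAt_section (hcont.continuousAt hn) (mem_of_superset hn hφ)
  · have hb := ball_subset_punct ht
    exact h.norm_deriv_section_le ht.1 (hcont.mono hb) fun s hs => hφ s (hb hs)
  · obtain ⟨⟨-, -, h1⟩, h2⟩ := hφ t (hhalf ht)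
    rw [h2] at h1
    have : ‖φ t - c‖ ≤ ‖φ t - c - t • v‖ + ‖t • v‖ := by
      simpa using norm_add_le (φ t - c - t • v) (t • v)
    rw [norm_smul] at this
    nlinarith [norm_nonneg t]
  · exact huniq _ (hhalf hx.2.1) x (sec_mono le_rfl (by linarith) hx) rfl

namespace IsSheet

theorem punct_of_norm_mem_uIcc {t t' s : ℂ} (ht : t ∈ punct b r) (ht' : t' ∈ punct b r)
    (hs : ‖s‖ ∈ uIcc ‖t‖ ‖t'‖) : s ∈ punct b r := by
  have h1 : 0 < ‖t‖ := norm_pos_iff.2 ht.1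
  have h2 : 0 < ‖t'‖ := norm_pos_iff.2 ht'.1
  have hs1 := hs.1
  have hs2 := hs.2
  have h3 : 0 < ‖s‖ := (lt_inf_iff.2 ⟨h1, h2⟩).trans_le hs1
  refine ⟨norm_pos_iff.1 h3, ?_⟩
  cases b
  · simp only [radial, Bool.false_eq_true, if_false]
    rcases inf_le_iff.1 hs1 with h | h
    · exact (inv_anti₀ h1 h).trans_lt ht.2
    · exact (inv_anti₀ h2 h).trans_lt ht'.2
  · simp only [radial, if_true]
    rcases le_sup_iff.1 hs2 with h | h
    · exact h.trans_lt ht.2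
    · exact h.trans_lt ht'.2

theorem innerDist_path_le (h : IsSheet X b c j r L φ) {p p' : ℝ → ℂ} {K : ℝ} (hK : 0 ≤ K)
    (hp : ∀ s ∈ Icc (0 : ℝ) 1, HasDerivAt p (p' s) s)
    (hp' : ∀ s ∈ Icc (0 : ℝ) 1, ‖p' s‖ ≤ K) (hm : ∀ s ∈ Icc (0 : ℝ) 1, p s ∈ punct b r) :
    innerDist X (φ (p 0)) (φ (p 1)) ≤ ENNReal.ofReal (L * K) := by
  refine innerDist_le_of_norm_deriv_le (γ := fun s => φ (p s))
    (γ' := fun s => p' s • deriv φ (p s)) (mul_nonneg h.nonneg hK) (fun s hs => ?_)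
    (fun s hs => ?_) fun s hs => h.mem _ (hm s hs)
  · exact (h.differentiableAt _ (hm s hs)).hasDerivAt.scomp s (hp s hs)
  · rw [norm_smul, mul_comm]
    exact mul_le_mul (h.norm_deriv_le _ (hm s hs)) (hp' s hs) (norm_nonneg _) h.nonneg

theorem innerDist_radial_le (h : IsSheet X b c j r L φ) {t : ℂ} {a : ℝ} (ha : 0 < a)
    (ht : t ∈ punct b r) (hat : (a : ℂ) * t ∈ punct b r) :
    innerDist X (φ t) (φ (a * t)) ≤ ENNReal.ofReal (L * (|a - 1| * ‖t‖)) := by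
  have := h.innerDist_path_le (p := fun s : ℝ => (((1 + s * (a - 1) : ℝ) : ℂ)) * t)
    (p' := fun _ => ((a - 1 : ℝ) : ℂ) * t) (K := |a - 1| * ‖t‖) (by positivity)
    (fun s _ => ?_) (fun s _ => by rw [norm_mul, Complex.norm_real, Real.norm_eq_abs])
    (fun s hs => punct_of_norm_mem_uIcc ht hat ?_)
  · simpa using this
  · have h1 : HasDerivAt (fun s : ℝ => 1 + s * (a - 1)) (a - 1) s := by
      simpa using ((hasDerivAt_id s).mul_const (a - 1)).const_add 1
    exact h1.ofReal_comp.mul_const t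
  · have hpos : 0 < 1 + s * (a - 1) := by
      rcases hs.2.eq_or_lt with rfl | hlt
      · linarith
      · nlinarith [mul_nonneg hs.1 ha.le]
    rw [norm_mul, norm_mul, Complex.norm_real, Complex.norm_real, Real.norm_eq_abs,
      Real.norm_eq_abs, abs_of_pos hpos, abs_of_pos ha, mem_uIcc]
    have htn := norm_nonneg t
    rcases le_total 1 a with h1 | h1
    · left
      constructor <;> nlinarith [hs.1, hs.2, mul_nonneg hs.1 (sub_nonneg.2 h1),
        mul_nonneg (sub_nonneg.2 hs.2) (sub_nonneg.2 h1)]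
    · right
      constructor <;> nlinarith [hs.1, hs.2, mul_nonneg hs.1 (sub_nonneg.2 h1),
        mul_nonneg (sub_nonneg.2 hs.2) (sub_nonneg.2 h1)]

theorem innerDist_arc_le (h : IsSheet X b c j r L φ) {t t' : ℂ} (ht : t ∈ punct b r)
    (ht' : t' ∈ punct b r) (hn : ‖t‖ = ‖t'‖) :
    innerDist X (φ t) (φ t') ≤ ENNReal.ofReal (L * (Real.pi / 2 * ‖t - t'‖)) := by
  set θ := (t' / t).arg with hθ
  have htn : 0 < ‖t‖ := norm_pos_iff.2 ht.1
  have hq : ‖t' / t‖ = 1 := by rw [norm_div, hn, div_self (hn ▸ htn.ne')]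
  have hexp : Complex.exp (θ * Complex.I) = t' / t := by
    have := Complex.norm_mul_exp_arg_mul_I (t' / t)
    rwa [hq, Complex.ofReal_one, one_mul] at this
  have hθt : |θ| * ‖t‖ ≤ Real.pi / 2 * ‖t - t'‖ := by
    have := Complex.angle_le_mul_norm_sub (x := 1) (y := t' / t) (by simp) hq
    rw [Complex.angle_one_left (div_ne_zero ht'.1 ht.1)] at this
    calc |θ| * ‖t‖ ≤ (Real.pi / 2 * ‖1 - t' / t‖) * ‖t‖ := by gcongr
      _ = Real.pi / 2 * ‖t - t'‖ := by
        rw [mul_assoc, ← norm_mul, sub_mul, div_mul_cancel₀ _ ht.1, one_mul]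
  have := h.innerDist_path_le (p := fun s : ℝ => t * Complex.exp ((s : ℂ) * (θ * Complex.I)))
    (p' := fun s => t * (Complex.exp ((s : ℂ) * (θ * Complex.I)) * (θ * Complex.I)))
    (K := Real.pi / 2 * ‖t - t'‖) (by positivity)
    (fun s _ => ?_) (fun s _ => ?_) (fun s hs => punct_of_norm_mem_uIcc ht ht' ?_)
  · have h1 : t * Complex.exp (((1 : ℝ) : ℂ) * (θ * Complex.I)) = t' := by
      rw [Complex.ofReal_one, one_mul, hexp, mul_div_cancel₀ _ ht.1]
    have h0 : t * Complex.exp (((0 : ℝ) : ℂ) * (θ * Complex.I)) = t := by simp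
    rwa [h1, h0] at this
  · have h1 : HasDerivAt (fun s : ℝ => (s : ℂ) * (θ * Complex.I)) (θ * Complex.I) s := by
      simpa using ((hasDerivAt_id s).ofReal_comp).mul_const ((θ : ℂ) * Complex.I)
    exact h1.cexp.const_mul t
  · have : (s : ℂ) * (θ * Complex.I) = ((s * θ : ℝ) : ℂ) * Complex.I := by push_cast; ring
    rw [this, norm_mul, norm_mul, Complex.norm_exp_ofReal_mul_I, norm_mul, Complex.norm_I,
      Complex.norm_real, Real.norm_eq_abs]
    linarith
  · have : (s : ℂ) * (θ * Complex.I) = ((s * θ : ℝ) : ℂ) * Complex.I := by push_cast; ring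
    rw [this, norm_mul, Complex.norm_exp_ofReal_mul_I, mul_one]
    exact left_mem_uIcc

theorem innerDist_le (h : IsSheet X b c j r L φ) {t t' : ℂ} (ht : t ∈ punct b r)
    (ht' : t' ∈ punct b r) :
    innerDist X (φ t) (φ t') ≤ ENNReal.ofReal ((1 + Real.pi) * L * ‖t - t'‖) := by
  have htn : 0 < ‖t‖ := norm_pos_iff.2 ht.1
  have htn' : 0 < ‖t'‖ := norm_pos_iff.2 ht'.1
  set a := ‖t'‖ / ‖t‖ with ha
  have ha0 : 0 < a := by positivity
  have hat : ‖(a : ℂ) * t‖ = ‖t'‖ := by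
    rw [norm_mul, Complex.norm_real, Real.norm_eq_abs, abs_of_pos ha0, ha,
      div_mul_cancel₀ _ htn.ne']
  have hm : (a : ℂ) * t ∈ punct b r :=
    punct_of_norm_mem_uIcc ht ht' (by rw [hat]; exact right_mem_uIcc)
  have e1 : |a - 1| * ‖t‖ = |‖t'‖ - ‖t‖| := by
    rw [← abs_of_pos htn, ← abs_mul, abs_of_pos htn, sub_mul, ha, div_mul_cancel₀ _ htn.ne',
      one_mul]
  have e2 : ‖(a : ℂ) * t - t‖ = |‖t'‖ - ‖t‖| := by
    rw [← e1, ← sub_one_mul, norm_mul, ← Complex.ofReal_one, ← Complex.ofReal_sub,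
      Complex.norm_real, Real.norm_eq_abs]
  have e3 : |‖t'‖ - ‖t‖| ≤ ‖t - t'‖ := by
    rw [norm_sub_rev]; exact abs_norm_sub_norm_le _ _
  have e4 : ‖(a : ℂ) * t - t'‖ ≤ 2 * ‖t - t'‖ := by
    have : ‖(a : ℂ) * t - t'‖ ≤ ‖(a : ℂ) * t - t‖ + ‖t - t'‖ := by
      simpa using norm_add_le ((a : ℂ) * t - t) (t - t')
    linarith
  have hL := h.nonneg
  refine (innerDist_triangle_ofReal (by positivity) (by positivity)
    (h.innerDist_radial_le ha0 ht hm) (h.innerDist_arc_le hm ht' hat)).trans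
    (ENNReal.ofReal_le_ofReal ?_)
  rw [e1]
  have : L * (Real.pi / 2 * ‖(a : ℂ) * t - t'‖) ≤ L * (Real.pi / 2 * (2 * ‖t - t'‖)) := by
    gcongr
  have : L * |‖t'‖ - ‖t‖| ≤ L * ‖t - t'‖ := by gcongr
  linarith

theorem innerDist_center_le (h : IsSheet X true c j r L φ) (hc : c ∈ X) {t : ℂ}
    (ht : t ∈ punct true r) : innerDist X (φ t) c ≤ ENNReal.ofReal (L * ‖t‖) := by
  classical
  have htn : 0 < ‖t‖ := norm_pos_iff.2 ht.1
  have hL := h.nonneg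
  let γ : ℝ → EuclideanSpace ℂ (Fin n) := fun s => if s ≤ 0 then c else φ (s * t)
  have hst : ∀ s ∈ Ioc (0 : ℝ) 1, (s : ℂ) * t ∈ punct true r := fun s hs => by
    refine ⟨mul_ne_zero (by exact_mod_cast hs.1.ne') ht.1, ?_⟩
    have := ht.2
    simp only [radial, if_true, norm_mul, Complex.norm_real, Real.norm_eq_abs, abs_of_pos hs.1]
      at this ⊢
    nlinarith [hs.2]
  have hγ : ∀ s, 0 < s → γ s = φ (s * t) := fun s hs => if_neg (not_le.2 hs)
  have hγ0 : γ 0 = c := if_pos le_rfl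
  have hd : ∀ s ∈ Ioc (0 : ℝ) 1, HasDerivAt (fun s : ℝ => φ (s * t)) (t • deriv φ (s * t)) s :=
    fun s hs => by
      have h1 : HasDerivAt (fun s : ℝ => (s : ℂ) * t) t s := by
        simpa using ((hasDerivAt_id s).ofReal_comp).mul_const t
      exact (h.differentiableAt _ (hst s hs)).hasDerivAt.scomp s h1
  have hlip : LipschitzOnWith (L * ‖t‖).toNNReal γ (Ioc 0 1) := by
    have : LipschitzOnWith (L * ‖t‖).toNNReal (fun s : ℝ => φ (s * t)) (Ioc 0 1) :=
      (convex_Ioc 0 1).lipschitzOnWith_of_nnnorm_hasDerivWithin_le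
        (fun s hs => (hd s hs).hasDerivWithinAt) fun s hs => by
          rw [← NNReal.coe_le_coe, Real.coe_toNNReal _ (by positivity), coe_nnnorm, norm_smul,
            mul_comm]
          exact mul_le_mul_of_nonneg_right (h.norm_deriv_le _ (hst s hs)) htn.le
    exact fun s hs s' hs' => by
      rw [hγ s hs.1, hγ s' hs'.1]
      exact this hs hs'
  have hcont0 : ContinuousWithinAt γ (Icc 0 1) 0 := by
    rw [ContinuousWithinAt, hγ0, tendsto_iff_norm_sub_tendsto_zero]
    refine squeeze_zero' (g := fun s : ℝ => L * (|s| * ‖t‖))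
      (Eventually.of_forall fun _ => norm_nonneg _) ?_ ?_
    · filter_upwards [self_mem_nhdsWithin] with s hs
      rcases hs.1.eq_or_lt with rfl | hpos
      · simp [hγ0]
      · rw [hγ s hpos]
        have := h.norm_sub_le _ (hst s ⟨hpos, hs.2⟩)
        rwa [norm_mul, Complex.norm_real, Real.norm_eq_abs] at this
    · refine Tendsto.mono_left ?_ nhdsWithin_le_nhds
      have : Continuous fun s : ℝ => L * (|s| * ‖t‖) := by fun_prop
      simpa using this.tendsto 0
  have hcont : ContinuousOn γ (Icc 0 1) := by
    intro s hs
    rcases hs.1.eq_or_lt with rfl | hpos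
    · exact hcont0
    · refine ContinuousAt.continuousWithinAt ?_
      refine (hd s ⟨hpos, hs.2⟩).continuousAt.congr ?_
      filter_upwards [lt_mem_nhds hpos] with s' hs' using (hγ s' hs').symm
  have hclos : closure (Ioc (0 : ℝ) 1) = Icc 0 1 := closure_Ioc zero_ne_one
  have hlip' : LipschitzOnWith (L * ‖t‖).toNNReal γ (Icc 0 1) := by
    rw [← hclos] at hcont ⊢
    exact hlip.closure hcont
  have := innerDist_le_of_lipschitzOnWith (X := X) hlip' fun s hs => by
    rcases hs.1.eq_or_lt with rfl | hpos
    · rwa [hγ0]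
    · rw [hγ s hpos]
      exact h.mem _ (hst s ⟨hpos, hs.2⟩)
  rw [hγ0, hγ 1 one_pos, Complex.ofReal_one, one_mul] at this
  rw [innerDist_comm]
  exact this

end IsSheet

end Sheet

section Compactness

variable {E : Type*} [NormedAddCommGroup E] [NormedSpace ℝ E] {X : Set E} {b : Bool} {c : E}

theorem exists_nhds_of_mem_dirFilter {u : E} {S : Set E} (hS : S ∈ dirFilter X b c u) :
    ∃ N ∈ 𝓝 u, ∃ ρ > 0, ∀ x ∈ X, x ≠ c → ‖x - c‖⁻¹ • (x - c) ∈ N → radial b ‖x - c‖ < ρ →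
      x ∈ S := by
  rw [dirFilter, mem_inf_principal, mem_comap] at hS
  obtain ⟨V, hV, hVS⟩ := hS
  obtain ⟨N, hN, M, hM, hNM⟩ := mem_nhds_prod_iff.1 hV
  obtain ⟨ρ, hρ, hball⟩ := Metric.mem_nhds_iff.1 hM
  refine ⟨N, hN, ρ, hρ, fun x hx hxc hxN hxρ => hVS (hNM ⟨hxN, hball ?_⟩) ⟨hx, hxc⟩⟩
  rw [mem_ball_zero_iff, Real.norm_eq_abs]
  rwa [dirMap, abs_of_pos (radial_pos b (norm_pos_iff.2 (sub_ne_zero.2 hxc)))]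

theorem norm_mul_norm_sub_le {x y : E} (hx : x ≠ 0) (hy : y ≠ 0) :
    ‖x‖ * ‖‖x‖⁻¹ • x - ‖y‖⁻¹ • y‖ ≤ 2 * ‖x - y‖ := by
  have hx' : ‖x‖ ≠ 0 := norm_ne_zero_iff.2 hx
  have hy' : ‖y‖ ≠ 0 := norm_ne_zero_iff.2 hy
  have e : ‖x‖ • (‖x‖⁻¹ • x - ‖y‖⁻¹ • y) = (x - y) + (‖y‖ - ‖x‖) • (‖y‖⁻¹ • y) := by
    rw [smul_sub, smul_smul, mul_inv_cancel₀ hx', one_smul, sub_smul, smul_smul ‖y‖,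
      mul_inv_cancel₀ hy', one_smul]
    abel
  have h1 : ‖x‖ * ‖‖x‖⁻¹ • x - ‖y‖⁻¹ • y‖ = ‖‖x‖ • (‖x‖⁻¹ • x - ‖y‖⁻¹ • y)‖ := by
    rw [norm_smul, norm_norm]
  rw [h1, e]
  refine (norm_add_le _ _).trans ?_
  have h2 : ‖(‖y‖ - ‖x‖) • (‖y‖⁻¹ • y)‖ = |‖y‖ - ‖x‖| := by
    rw [norm_smul, norm_smul, norm_inv, norm_norm, inv_mul_cancel₀ hy', mul_one, Real.norm_eq_abs]
  have h3 := abs_norm_sub_norm_le y x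
  rw [norm_sub_rev] at h3
  linarith

theorem eventually_norm_add_norm_le {u u' : E} (hne : u ≠ u') :
    ∀ᶠ q in dirFilter X b c u ×ˢ dirFilter X b c u',
      ‖q.1 - c‖ + ‖q.2 - c‖ ≤ 8 / ‖u - u'‖ * ‖q.1 - q.2‖ := by
  have hpos : 0 < ‖u - u'‖ := norm_pos_iff.2 (sub_ne_zero.2 hne)
  have hdir : ∀ w : E, Tendsto (fun x => ‖x - c‖⁻¹ • (x - c)) (dirFilter X b c w) (𝓝 w) :=
    fun w => (continuous_fst.tendsto (w, (0 : ℝ))).comp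
      (tendsto_dirMap_dirFilter.mono_right nhdsWithin_le_nhds)
  have h1 := (((hdir u).comp tendsto_fst).sub ((hdir u').comp tendsto_snd)).norm.eventually
    (lt_mem_nhds (half_lt_self hpos))
  filter_upwards [h1, tendsto_fst.eventually (eventually_mem_dirFilter (X := X) (u := u)),
    tendsto_snd.eventually (eventually_mem_dirFilter (X := X) (u := u'))] with q hq hq1 hq2
  have hx : q.1 - c ≠ 0 := sub_ne_zero.2 hq1.2
  have hy : q.2 - c ≠ 0 := sub_ne_zero.2 hq2.2
  have k1 := norm_mul_norm_sub_le hx hy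
  have k2 := norm_mul_norm_sub_le hy hx
  rw [sub_sub_sub_cancel_right] at k1 k2
  rw [norm_sub_rev (‖q.2 - c‖⁻¹ • (q.2 - c)), norm_sub_rev q.2 q.1] at k2
  simp only [Function.comp] at hq
  rw [div_mul_eq_mul_div, le_div_iff₀ hpos]
  nlinarith [norm_nonneg (q.1 - c), norm_nonneg (q.2 - c)]

variable [ProperSpace E]

theorem exists_forall_of_dirFilter_prod {P : ℝ → E → E → Prop}
    (hP : ∀ C C' x y, C ≤ C' → P C x y → P C' x y)
    (hloc : ∀ u u' : E, ‖u‖ = 1 → ‖u'‖ = 1 →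
      ∃ C, ∀ᶠ q in dirFilter X b c u ×ˢ dirFilter X b c u', P C q.1 q.2) :
    ∃ C, ∃ ρ > 0, ∀ x ∈ X, x ≠ c → radial b ‖x - c‖ < ρ →
      ∀ y ∈ X, y ≠ c → radial b ‖y - c‖ < ρ → P C x y := by
  have key := ((isCompact_sphere (0 : E) 1).prod (isCompact_sphere (0 : E) 1)).induction_on
    (p := fun s => ∃ C, ∃ ρ > 0, ∀ x ∈ X, x ≠ c → radial b ‖x - c‖ < ρ →
      ∀ y ∈ X, y ≠ c → radial b ‖y - c‖ < ρ →
        (‖x - c‖⁻¹ • (x - c), ‖y - c‖⁻¹ • (y - c)) ∈ s → P C x y)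
    ⟨0, 1, one_pos, fun _ _ _ _ _ _ _ _ h => h.elim⟩
    (fun s t hst ⟨C, ρ, hρ, h⟩ => ⟨C, ρ, hρ, fun x hx hxc hxρ y hy hyc hyρ hm =>
      h x hx hxc hxρ y hy hyc hyρ (hst hm)⟩)
    (fun s t ⟨C, ρ, hρ, h⟩ ⟨C', ρ', hρ', h'⟩ => ⟨max C C', min ρ ρ', lt_min hρ hρ',
      fun x hx hxc hxρ y hy hyc hyρ hm => by
        rcases hm with hm | hm
        · exact hP _ _ _ _ (le_max_left _ _) (h x hx hxc (hxρ.trans_le (min_le_left _ _)) y hy hyc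
            (hyρ.trans_le (min_le_left _ _)) hm)
        · exact hP _ _ _ _ (le_max_right _ _) (h' x hx hxc (hxρ.trans_le (min_le_right _ _)) y hy
            hyc (hyρ.trans_le (min_le_right _ _)) hm)⟩)
    (by
      rintro ⟨u, u'⟩ ⟨hu, hu'⟩
      obtain ⟨C, hC⟩ := hloc u u' (by simpa using hu) (by simpa using hu')
      obtain ⟨S, hS, S', hS', hSS'⟩ := mem_prod_iff.1 hC
      obtain ⟨N, hN, ρ, hρ, h⟩ := exists_nhds_of_mem_dirFilter hS
      obtain ⟨N', hN', ρ', hρ', h'⟩ := exists_nhds_of_mem_dirFilter hS'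
      refine ⟨N ×ˢ N', mem_nhdsWithin_of_mem_nhds (prod_mem_nhds hN hN'), C, min ρ ρ',
        lt_min hρ hρ', fun x hx hxc hxρ y hy hyc hyρ hm => hSS' (a := (x, y)) ⟨?_, ?_⟩⟩
      · exact h x hx hxc hm.1 (hxρ.trans_le (min_le_left _ _))
      · exact h' y hy hyc hm.2 (hyρ.trans_le (min_le_right _ _)))
  obtain ⟨C, ρ, hρ, h⟩ := key
  refine ⟨C, ρ, hρ, fun x hx hxc hxρ y hy hyc hyρ => h x hx hxc hxρ y hy hyc hyρ ?_⟩
  have hunit : ∀ z : E, z ≠ c → ‖z - c‖⁻¹ • (z - c) ∈ Metric.sphere (0 : E) 1 := fun z hz => by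
    have : ‖z - c‖ ≠ 0 := by simpa [sub_eq_zero] using hz
    simp [norm_smul, this]
  exact ⟨hunit x hxc, hunit y hyc⟩

theorem exists_forall_of_dirFilter {P : ℝ → E → Prop}
    (hP : ∀ C C' x, C ≤ C' → P C x → P C' x)
    (hloc : ∀ u : E, ‖u‖ = 1 → ∃ C, ∀ᶠ x in dirFilter X b c u, P C x) :
    ∃ C, ∃ ρ > 0, ∀ x ∈ X, x ≠ c → radial b ‖x - c‖ < ρ → P C x := by
  obtain ⟨C, ρ, hρ, h⟩ := exists_forall_of_dirFilter_prod (X := X) (b := b) (c := c)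
    (P := fun C x _ => P C x) (fun C C' x _ => hP C C' x) fun u _ hu _ => by
      obtain ⟨C, hC⟩ := hloc u hu
      exact ⟨C, tendsto_fst.eventually hC⟩
  exact ⟨C, ρ, hρ, fun x hx hxc hxρ => h x hx hxc hxρ x hx hxc hxρ⟩

end Compactness

section LocalLNE

variable {n : ℕ} {X : Set (EuclideanSpace ℂ (Fin n))} {b : Bool} {c : EuclideanSpace ℂ (Fin n)}

theorem exists_sheet_of_dirFilter (hX : IsGraphCurve X)
    (hS : ∀ (j : Fin n) (v : EuclideanSpace ℂ (Fin n)), v j = 1 → IsSheeted X b c j v)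
    {u : EuclideanSpace ℂ (Fin n)} (hu : ‖u‖ = 1) [hne : (dirFilter X b c u).NeBot] :
    ∃ j r L φ, IsSheet X b c j r L φ ∧
      ∀ᶠ x in dirFilter X b c u, x j - c j ∈ punct b r ∧ φ (x j - c j) = x := by
  obtain ⟨j, v, w, hv, hw, rfl⟩ := exists_dirOf hu
  obtain ⟨ε, hε, r, hr, h⟩ := (hS j v hv).exists_sheet hX hv
  have hmem : sec X b c j v ε r ∈ dirFilter X b c (dirOf v w) :=
    mem_of_superset (wedge_mem_dirFilter hv hw hε one_pos hr) fun x hx => hx.1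
  rcases h with h | ⟨L, φ, hφ, hφs⟩
  · rw [h] at hmem
    exact absurd hmem (empty_notMem _)
  · exact ⟨j, r, L, φ, hφ, mem_of_superset hmem fun x hx => ⟨hx.2.1, hφs x hx⟩⟩

theorem exists_innerDist_center_le (hX : IsGraphCurve X) (hc : c ∈ X)
    (hS : ∀ (j : Fin n) (v : EuclideanSpace ℂ (Fin n)), v j = 1 → IsSheeted X true c j v) :
    ∃ C, ∃ ρ > 0, ∀ x ∈ X, x ≠ c → radial true ‖x - c‖ < ρ →
      innerDist X x c ≤ ENNReal.ofReal (C * ‖x - c‖) := by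
  refine exists_forall_of_dirFilter (P := fun C x => innerDist X x c ≤ ENNReal.ofReal (C * ‖x - c‖))
    (fun C C' x hC h => h.trans (ENNReal.ofReal_le_ofReal (by gcongr))) fun u hu => ?_
  rcases eq_or_neBot (dirFilter X true c u) with hbot | hne
  · exact ⟨0, by rw [hbot]; trivial⟩
  obtain ⟨j, r, L, φ, hφ, hev⟩ := exists_sheet_of_dirFilter hX hS hu
  refine ⟨L, ?_⟩
  filter_upwards [hev] with x hx
  have h := hφ.innerDist_center_le hc hx.1
  rw [hx.2] at h
  refine h.trans (ENNReal.ofReal_le_ofReal (mul_le_mul_of_nonneg_left ?_ hφ.nonneg))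
  exact PiLp.norm_apply_le (x - c) j

theorem exists_innerDist_base_le (hX : IsGraphCurve X) {x₀ : EuclideanSpace ℂ (Fin n)}
    (hfin : ∀ x ∈ X, innerDist X x x₀ < ⊤)
    (hS : ∀ (j : Fin n) (v : EuclideanSpace ℂ (Fin n)), v j = 1 → IsSheeted X false 0 j v) :
    ∃ C, ∃ ρ > 0, ∀ x ∈ X, x ≠ 0 → radial false ‖x - 0‖ < ρ →
      innerDist X x x₀ ≤ ENNReal.ofReal (C * ‖x - 0‖) := by
  refine exists_forall_of_dirFilter
    (P := fun C x => innerDist X x x₀ ≤ ENNReal.ofReal (C * ‖x - 0‖))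
    (fun C C' x hC h => h.trans (ENNReal.ofReal_le_ofReal (by gcongr))) fun u hu => ?_
  rcases eq_or_neBot (dirFilter X false 0 u) with hbot | hne
  · exact ⟨0, by rw [hbot]; trivial⟩
  obtain ⟨j, r, L, φ, hφ, hev⟩ := exists_sheet_of_dirFilter hX hS hu
  obtain ⟨x₁, ⟨ht₁, hx₁⟩, hx₁X⟩ := (hev.and eventually_mem_dirFilter).exists
  have hL := hφ.nonneg
  have hlarge : ∀ᶠ x in dirFilter X false 0 u, 1 < ‖x‖ :=
    dirFilter_le_atInftyOn (mem_inf_of_left (preimage_mem_comap (Ioi_mem_atTop 1)))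
  set K := (1 + Real.pi) * L
  have hK : 0 ≤ K := by positivity
  set D := (innerDist X x₁ x₀).toReal
  refine ⟨K + K * ‖x₁‖ + D, ?_⟩
  filter_upwards [hev, hlarge] with x hx hx1
  have h := hφ.innerDist_le hx.1 ht₁
  rw [hx.2, hx₁] at h
  have hD : innerDist X x₁ x₀ ≤ ENNReal.ofReal D := (ENNReal.ofReal_toReal (hfin _ hx₁X.1).ne).ge
  refine (innerDist_triangle_ofReal (by positivity) ENNReal.toReal_nonneg h hD).trans
    (ENNReal.ofReal_le_ofReal ?_)
  have h1 : ‖x j - x₁ j‖ ≤ ‖x - x₁‖ := PiLp.norm_apply_le (x - x₁) j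
  have h2 := norm_sub_le x x₁
  have hD0 : 0 ≤ D := ENNReal.toReal_nonneg
  have h3 : K * ‖x j - x₁ j‖ ≤ K * (‖x‖ + ‖x₁‖) := by gcongr; linarith
  have h4 : K * ‖x₁‖ ≤ K * ‖x₁‖ * ‖x‖ := le_mul_of_one_le_right (by positivity) hx1.le
  have h5 : D ≤ D * ‖x‖ := le_mul_of_one_le_right hD0 hx1.le
  simp only [PiLp.zero_apply, sub_zero]
  linarith

theorem exists_innerDist_le_of_isSheeted (hX : IsGraphCurve X)
    (hS : ∀ (j : Fin n) (v : EuclideanSpace ℂ (Fin n)), v j = 1 → IsSheeted X b c j v)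
    {x₀ : EuclideanSpace ℂ (Fin n)}
    (hcone : ∃ C, ∃ ρ > 0, ∀ x ∈ X, x ≠ c → radial b ‖x - c‖ < ρ →
      innerDist X x x₀ ≤ ENNReal.ofReal (C * ‖x - c‖)) :
    ∃ C, ∃ ρ > 0, ∀ x ∈ X, x ≠ c → radial b ‖x - c‖ < ρ → ∀ y ∈ X, y ≠ c →
      radial b ‖y - c‖ < ρ → innerDist X x y ≤ ENNReal.ofReal (C * ‖x - y‖) := by
  obtain ⟨C₀, ρ, hρ, hC₀⟩ := hcone
  refine exists_forall_of_dirFilter_prod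
    (P := fun C x y => innerDist X x y ≤ ENNReal.ofReal (C * ‖x - y‖))
    (fun C C' x y hC h => h.trans (ENNReal.ofReal_le_ofReal (by gcongr))) fun u u' hu hu' => ?_
  by_cases huu : u = u'
  · subst huu
    rcases eq_or_neBot (dirFilter X b c u) with hbot | hne
    · exact ⟨0, by simp [hbot]⟩
    obtain ⟨j, r, L, φ, hφ, hev⟩ := exists_sheet_of_dirFilter hX hS hu
    refine ⟨(1 + Real.pi) * L, ?_⟩
    filter_upwards [tendsto_fst.eventually hev, tendsto_snd.eventually hev] with q hq1 hq2
    have h := hφ.innerDist_le hq1.1 hq2.1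
    rw [hq1.2, hq2.2, sub_sub_sub_cancel_right] at h
    have hL := hφ.nonneg
    refine h.trans (ENNReal.ofReal_le_ofReal (mul_le_mul_of_nonneg_left ?_ (by positivity)))
    exact PiLp.norm_apply_le (q.1 - q.2) j
  · have hev : ∀ w, ∀ᶠ x in dirFilter X b c w,
        innerDist X x x₀ ≤ ENNReal.ofReal (|C₀| * ‖x - c‖) := fun w => by
      filter_upwards [eventually_mem_dirFilter, tendsto_radial_dirFilter.eventually
        (gt_mem_nhds hρ)] with x hx hxρ
      exact (hC₀ x hx.1 hx.2 hxρ).trans (ENNReal.ofReal_le_ofReal (by gcongr; exact le_abs_self _))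
    refine ⟨|C₀| * (8 / ‖u - u'‖), ?_⟩
    filter_upwards [tendsto_fst.eventually (hev u), tendsto_snd.eventually (hev u'),
      eventually_norm_add_norm_le huu] with q h1 h2 h3
    rw [innerDist_comm] at h2
    refine (innerDist_triangle_ofReal (by positivity) (by positivity) h1 h2).trans
      (ENNReal.ofReal_le_ofReal ?_)
    rw [← mul_add, mul_assoc]
    gcongr

end LocalLNE

section GlobalLNE

theorem exists_innerDist_le_nhdsWithin {n : ℕ} {X : Set (EuclideanSpace ℂ (Fin n))}
    {p : EuclideanSpace ℂ (Fin n)} (hX : IsGraphCurve X) (hp : p ∈ X)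
    (hS : ∀ j v, v j = 1 → IsSheeted X true p j v) :
    ∃ C, ∃ ρ > 0, ∀ x ∈ X, ‖x - p‖ < ρ → ∀ y ∈ X, ‖y - p‖ < ρ →
      innerDist X x y ≤ ENNReal.ofReal (C * ‖x - y‖) := by
  obtain ⟨C₁, ρ₁, hρ₁, h₁⟩ := exists_innerDist_center_le hX hp hS
  obtain ⟨C₂, ρ₂, hρ₂, h₂⟩ := exists_innerDist_le_of_isSheeted hX hS ⟨C₁, ρ₁, hρ₁, h₁⟩
  refine ⟨max C₁ C₂, min ρ₁ ρ₂, lt_min hρ₁ hρ₂, fun x hx hxρ y hy hyρ => ?_⟩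
  rw [lt_min_iff] at hxρ hyρ
  by_cases hxp : x = p <;> by_cases hyp : y = p
  · rw [hxp, hyp, innerDist_self hp]
    exact zero_le
  · rw [hxp, innerDist_comm, norm_sub_rev]
    exact (h₁ y hy hyp (by simpa [radial] using hyρ.1)).trans
      (ENNReal.ofReal_le_ofReal (by gcongr; exact le_max_left _ _))
  · rw [hyp]
    exact (h₁ x hx hxp (by simpa [radial] using hxρ.1)).trans
      (ENNReal.ofReal_le_ofReal (by gcongr; exact le_max_left _ _))
  · exact (h₂ x hx hxp (by simpa [radial] using hxρ.2) y hy hyp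
      (by simpa [radial] using hyρ.2)).trans
      (ENNReal.ofReal_le_ofReal (by gcongr; exact le_max_right _ _))

theorem exists_innerDist_le_of_lt_norm {n : ℕ} {X : Set (EuclideanSpace ℂ (Fin n))}
    {x₀ : EuclideanSpace ℂ (Fin n)} (hX : IsGraphCurve X)
    (hfin : ∀ x ∈ X, innerDist X x x₀ < ⊤) (hS : ∀ j v, v j = 1 → IsSheeted X false 0 j v) :
    ∃ C, 0 ≤ C ∧ ∃ R, 0 ≤ R ∧
      (∀ x ∈ X, R < ‖x‖ → innerDist X x x₀ ≤ ENNReal.ofReal (C * ‖x‖)) ∧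
      ∀ x ∈ X, R < ‖x‖ → ∀ y ∈ X, R < ‖y‖ →
        innerDist X x y ≤ ENNReal.ofReal (C * ‖x - y‖) := by
  obtain ⟨C₁, ρ₁, hρ₁, h₁⟩ := exists_innerDist_base_le hX hfin hS
  obtain ⟨C₂, ρ₂, hρ₂, h₂⟩ := exists_innerDist_le_of_isSheeted hX hS ⟨C₁, ρ₁, hρ₁, h₁⟩
  have hR : 0 ≤ max ρ₁⁻¹ ρ₂⁻¹ := (inv_pos.2 hρ₁).le.trans (le_max_left _ _)
  have hne : ∀ x : EuclideanSpace ℂ (Fin n), max ρ₁⁻¹ ρ₂⁻¹ < ‖x‖ → x ≠ 0 := fun x hx =>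
    norm_pos_iff.1 (hR.trans_lt hx)
  have hr₁ : ∀ x : EuclideanSpace ℂ (Fin n), max ρ₁⁻¹ ρ₂⁻¹ < ‖x‖ →
      radial false ‖x - 0‖ < ρ₁ := fun x hx => by
    simpa [radial] using inv_lt_of_inv_lt₀ hρ₁ ((le_max_left _ _).trans_lt hx)
  have hr₂ : ∀ x : EuclideanSpace ℂ (Fin n), max ρ₁⁻¹ ρ₂⁻¹ < ‖x‖ →
      radial false ‖x - 0‖ < ρ₂ := fun x hx => by
    simpa [radial] using inv_lt_of_inv_lt₀ hρ₂ ((le_max_right _ _).trans_lt hx)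
  refine ⟨max |C₁| |C₂|, (abs_nonneg _).trans (le_max_left _ _), _, hR, fun x hx hxR => ?_,
    fun x hx hxR y hy hyR => ?_⟩
  · have h := h₁ x hx (hne x hxR) (hr₁ x hxR)
    rw [sub_zero] at h
    exact h.trans (ENNReal.ofReal_le_ofReal
      (by gcongr; exact (le_abs_self _).trans (le_max_left _ _)))
  · exact (h₂ x hx (hne x hxR) (hr₂ x hxR) y hy (hne y hyR) (hr₂ y hyR)).trans
      (ENNReal.ofReal_le_ofReal (by gcongr; exact (le_abs_self _).trans (le_max_right _ _)))

variable {E : Type*} [NormedAddCommGroup E] {X : Set E}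

theorem innerDist_lt_top_of_isPreconnected (hX : IsPreconnected X)
    (hloc : ∀ p ∈ X, ∃ C, ∃ ρ > 0, ∀ x ∈ X, ‖x - p‖ < ρ → ∀ y ∈ X, ‖y - p‖ < ρ →
      innerDist X x y ≤ ENNReal.ofReal (C * ‖x - y‖)) {x y : E} (hx : x ∈ X) (hy : y ∈ X) :
    innerDist X x y < ⊤ := by
  refine hX.induction₂ (fun x y => innerDist X x y < ⊤) (fun p hp => ?_)
    (fun x y z _ _ _ hxy hyz => innerDist_triangle.trans_lt (ENNReal.add_lt_top.2 ⟨hxy, hyz⟩))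
    (fun x y _ _ h => by rwa [innerDist_comm]) hx hy
  obtain ⟨C, ρ, hρ, h⟩ := hloc p hp
  filter_upwards [self_mem_nhdsWithin, mem_nhdsWithin_of_mem_nhds (Metric.ball_mem_nhds p hρ)]
    with y hy hyρ
  exact (h p hp (by simpa) y hy (mem_ball_iff_norm.1 hyρ)).trans_lt ENNReal.ofReal_lt_top

theorem exists_innerDist_le_on_isCompact {K : Set E} (hK : IsCompact K) (hKX : K ⊆ X)
    (hfin : ∀ x ∈ X, ∀ y ∈ X, innerDist X x y < ⊤)
    (hloc : ∀ p ∈ X, ∃ C, ∃ ρ > 0, ∀ x ∈ X, ‖x - p‖ < ρ → ∀ y ∈ X, ‖y - p‖ < ρ →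
      innerDist X x y ≤ ENNReal.ofReal (C * ‖x - y‖)) :
    ∃ C, ∀ x ∈ K, ∀ y ∈ K, innerDist X x y ≤ ENNReal.ofReal (C * ‖x - y‖) := by
  have key := (hK.prod hK).induction_on
    (p := fun s => ∃ C, ∀ q ∈ s, q.1 ∈ X → q.2 ∈ X →
      innerDist X q.1 q.2 ≤ ENNReal.ofReal (C * ‖q.1 - q.2‖))
    ⟨0, fun _ h => h.elim⟩ (fun s t hst ⟨C, h⟩ => ⟨C, fun q hq => h q (hst hq)⟩)
    (fun s t ⟨C, h⟩ ⟨C', h'⟩ => ⟨max C C', fun q hq h1 h2 => by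
      rcases hq with hq | hq
      · exact (h q hq h1 h2).trans
          (ENNReal.ofReal_le_ofReal (by gcongr; exact le_max_left _ _))
      · exact (h' q hq h1 h2).trans
          (ENNReal.ofReal_le_ofReal (by gcongr; exact le_max_right _ _))⟩)
    (by
      rintro ⟨p, p'⟩ ⟨hp, hp'⟩
      obtain ⟨C, ρ, hρ, h⟩ := hloc p (hKX hp)
      by_cases hpp : p = p'
      · subst hpp
        refine ⟨Metric.ball p ρ ×ˢ Metric.ball p ρ, mem_nhdsWithin_of_mem_nhds
          (prod_mem_nhds (Metric.ball_mem_nhds p hρ) (Metric.ball_mem_nhds p hρ)), C, ?_⟩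
        rintro ⟨x, y⟩ ⟨hx, hy⟩ hxX hyX
        exact h x hxX (mem_ball_iff_norm.1 hx) y hyX (mem_ball_iff_norm.1 hy)
      obtain ⟨C', ρ', hρ', h'⟩ := hloc p' (hKX hp')
      have hd : 0 < ‖p - p'‖ := norm_pos_iff.2 (sub_ne_zero.2 hpp)
      set δ := ‖p - p'‖ / 4 with hδ
      have hδ' : 0 < δ := by positivity
      refine ⟨Metric.ball p (min ρ δ) ×ˢ Metric.ball p' (min ρ' δ), mem_nhdsWithin_of_mem_nhds
        (prod_mem_nhds (Metric.ball_mem_nhds p (lt_min hρ hδ'))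
          (Metric.ball_mem_nhds p' (lt_min hρ' hδ'))),
        (|C| * δ + (innerDist X p p').toReal + |C'| * δ) / δ, ?_⟩
      rintro ⟨x, y⟩ ⟨hx, hy⟩ hxX hyX
      have hx' := lt_min_iff.1 (mem_ball_iff_norm.1 hx)
      have hy' := lt_min_iff.1 (mem_ball_iff_norm.1 hy)
      simp only at hx' hy' hxX hyX ⊢
      have d1 : innerDist X x p ≤ ENNReal.ofReal (|C| * δ) :=
        (h x hxX hx'.1 p (hKX hp) (by simpa)).trans (ENNReal.ofReal_le_ofReal
          (mul_le_mul (le_abs_self _) hx'.2.le (norm_nonneg _) (abs_nonneg _)))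
      have d2 : innerDist X p p' ≤ ENNReal.ofReal (innerDist X p p').toReal :=
        (ENNReal.ofReal_toReal (hfin p (hKX hp) p' (hKX hp')).ne).ge
      have d3 : innerDist X p' y ≤ ENNReal.ofReal (|C'| * δ) :=
        innerDist_comm.trans_le ((h' y hyX hy'.1 p' (hKX hp') (by simpa)).trans
          (ENNReal.ofReal_le_ofReal
            (mul_le_mul (le_abs_self _) hy'.2.le (norm_nonneg _) (abs_nonneg _))))
      refine (innerDist_triangle_ofReal (by positivity) (by positivity)
        (innerDist_triangle_ofReal (by positivity) (by positivity) d1 d2) d3).trans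
        (ENNReal.ofReal_le_ofReal ?_)
      have hle : δ ≤ ‖x - y‖ := by
        have e : p - p' = (x - y) - (x - p) + (y - p') := by abel
        have t1 := norm_add_le ((x - y) - (x - p)) (y - p')
        have t2 := norm_sub_le (x - y) (x - p)
        rw [← e] at t1
        linarith [hx'.2, hy'.2]
      rw [div_mul_eq_mul_div, le_div_iff₀ hδ']
      exact mul_le_mul_of_nonneg_left hle (by positivity))
  obtain ⟨C, hC⟩ := key
  exact ⟨C, fun x hx y hy => hC (x, y) ⟨hx, hy⟩ (hKX hx) (hKX hy)⟩

theorem isLNE_of_local [ProperSpace E] (hcl : IsClosed X) {x₀ : E} (hx₀ : x₀ ∈ X)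
    (hfin : ∀ x ∈ X, ∀ y ∈ X, innerDist X x y < ⊤)
    (hloc : ∀ p ∈ X, ∃ C, ∃ ρ > 0, ∀ x ∈ X, ‖x - p‖ < ρ → ∀ y ∈ X, ‖y - p‖ < ρ →
      innerDist X x y ≤ ENNReal.ofReal (C * ‖x - y‖))
    (hinf : ∃ C, 0 ≤ C ∧ ∃ R, 0 ≤ R ∧
      (∀ x ∈ X, R < ‖x‖ → innerDist X x x₀ ≤ ENNReal.ofReal (C * ‖x‖)) ∧
      ∀ x ∈ X, R < ‖x‖ → ∀ y ∈ X, R < ‖y‖ →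
        innerDist X x y ≤ ENNReal.ofReal (C * ‖x - y‖)) : IsLNE X := by
  obtain ⟨C, hC, R, hR, hbase, hout⟩ := hinf
  set R₀ := max (R + 1) ‖x₀‖ with hR₀
  have hRR₀ : R < R₀ := (lt_add_one R).trans_le (le_max_left _ _)
  have hR₀0 : 0 ≤ R₀ := hR.trans hRR₀.le
  obtain ⟨C', hC'⟩ := exists_innerDist_le_on_isCompact
    ((isCompact_closedBall (0 : E) (2 * R₀)).inter_left hcl) inter_subset_left hfin hloc
  have hnear : ∀ x ∈ X, ‖x‖ ≤ R₀ → innerDist X x x₀ ≤ ENNReal.ofReal (|C'| * (2 * R₀)) :=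
    fun x hx hxR => by
      refine (hC' x ⟨hx, by rw [mem_closedBall_zero_iff]; linarith⟩ x₀
        ⟨hx₀, by rw [mem_closedBall_zero_iff]; linarith [le_max_right (R + 1) ‖x₀‖]⟩).trans
        (ENNReal.ofReal_le_ofReal ?_)
      refine mul_le_mul (le_abs_self _) ?_ (norm_nonneg _) (abs_nonneg _)
      linarith [norm_sub_le x x₀, le_max_right (R + 1) ‖x₀‖]
  have hmixed : ∀ x ∈ X, ‖x‖ ≤ R₀ → ∀ y ∈ X, 2 * R₀ < ‖y‖ →
      innerDist X x y ≤ ENNReal.ofReal ((2 * |C'| + 2 * C) * ‖x - y‖) := fun x hx hxR y hy hyR => by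
    have h2 := hbase y hy (by linarith)
    rw [innerDist_comm] at h2
    refine (innerDist_triangle_ofReal (by positivity) (by positivity) (hnear x hx hxR) h2).trans
      (ENNReal.ofReal_le_ofReal ?_)
    have h3 : ‖y‖ ≤ 2 * ‖x - y‖ := by
      have := norm_sub_norm_le y x
      rw [norm_sub_rev] at this
      linarith
    nlinarith [abs_nonneg C', mul_le_mul_of_nonneg_left h3 hC,
      mul_le_mul_of_nonneg_left (hyR.le.trans h3) (abs_nonneg C')]
  have hM : 0 ≤ 2 * |C'| + 2 * C := by positivity
  refine ⟨max 1 (2 * |C'| + 2 * C), le_max_left _ _, fun x hx y hy => ?_⟩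
  have hmono : ∀ D, D ≤ 2 * |C'| + 2 * C → ENNReal.ofReal (D * ‖x - y‖) ≤
      ENNReal.ofReal (max 1 (2 * |C'| + 2 * C) * ‖x - y‖) := fun D hD =>
    ENNReal.ofReal_le_ofReal (by gcongr; exact hD.trans (le_max_right _ _))
  rcases le_or_gt ‖x‖ R₀ with hxR | hxR
  · rcases le_or_gt ‖y‖ (2 * R₀) with hyR | hyR
    · exact (hC' x ⟨hx, by rw [mem_closedBall_zero_iff]; linarith⟩ y
        ⟨hy, by rwa [mem_closedBall_zero_iff]⟩).trans
        (hmono _ (by linarith [le_abs_self C', abs_nonneg C']))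
    · exact (hmixed x hx hxR y hy hyR).trans (hmono _ le_rfl)
  · rcases le_or_gt ‖y‖ R₀ with hyR | hyR
    · rcases le_or_gt ‖x‖ (2 * R₀) with hxR' | hxR'
      · exact (hC' x ⟨hx, by rwa [mem_closedBall_zero_iff]⟩ y
          ⟨hy, by rw [mem_closedBall_zero_iff]; linarith⟩).trans
          (hmono _ (by linarith [le_abs_self C', abs_nonneg C']))
      · have h := hmixed y hy hyR x hx hxR'
        rw [innerDist_comm, norm_sub_rev] at h
        exact h.trans (hmono _ le_rfl)
    · exact (hout x hx (hRR₀.trans hxR) y hy (hRR₀.trans hyR)).trans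
        (hmono _ (by linarith [abs_nonneg C']))

theorem IsLNE.isPreconnected (hX : IsLNE X) : IsPreconnected X := by
  obtain ⟨c, -, hc⟩ := hX
  refine isPreconnected_of_forall_pair fun x hx y hy => ?_
  obtain ⟨γ, hγ, hm, rfl, rfl, -⟩ := exists_path_of_innerDist_lt
    ((hc x hx y hy).trans_lt ENNReal.ofReal_lt_top)
  exact ⟨γ '' Icc 0 1, hm.image_subset, mem_image_of_mem γ (by simp), mem_image_of_mem γ (by simp),
    isPreconnected_Icc.image γ hγ⟩

theorem isLNE_of_subsingleton (hX : X.Subsingleton) : IsLNE X :=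
  ⟨1, le_rfl, fun x hx y hy => by rw [hX hy hx, innerDist_self hx]; exact zero_le⟩

theorem isHomeoOn_id {α : Type*} [TopologicalSpace α] (S : Set α) : IsHomeoOn id S S :=
  ⟨bijOn_id S, continuousOn_id, id, fun _ _ => rfl, fun _ _ => rfl, continuousOn_id⟩

theorem isBSHomeo_id [NormedSpace ℝ E] : IsBSHomeo id X X :=
  ⟨isHomeoOn_id X, fun p _ => ⟨some p, isHomeoOn_id X, tendsto_id.mono_left nhdsWithin_le_nhds, id,
    isHomeoOn_id _, fun _ _ _ _ => rfl⟩, none, isHomeoOn_id X, tendsto_comap.mono_left inf_le_left,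
    id, isHomeoOn_id _, fun _ _ _ _ => rfl⟩

end GlobalLNE

theorem isLNE_of_isSheeted {n : ℕ} {X : Set (EuclideanSpace ℂ (Fin n))} (hX : IsGraphCurve X)
    (hconn : IsPreconnected X) (hS : ∀ p ∈ X, ∀ j v, v j = 1 → IsSheeted X true p j v)
    (hinf : ∀ j v, v j = 1 → IsSheeted X false 0 j v) : IsLNE X := by
  rcases X.eq_empty_or_nonempty with rfl | ⟨x₀, hx₀⟩
  · exact isLNE_of_subsingleton subsingleton_empty
  have hloc := fun p hp => exists_innerDist_le_nhdsWithin hX hp (hS p hp)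
  have hfin := fun x (hx : x ∈ X) y (hy : y ∈ X) =>
    innerDist_lt_top_of_isPreconnected hconn hloc hx hy
  exact isLNE_of_local hX.isClosed hx₀ hfin hloc
    (exists_innerDist_le_of_lt_norm hX (fun x hx => hfin x hx x₀ hx₀) hinf)

theorem IsBSHomeo.isLNE {n m : ℕ} {X : Set (EuclideanSpace ℂ (Fin n))}
    {Y : Set (EuclideanSpace ℂ (Fin m))} {h : EuclideanSpace ℂ (Fin n) → EuclideanSpace ℂ (Fin m)}
    (hh : IsBSHomeo h X Y) (hX : IsComplexAlgebraicCurve X) (hY : IsComplexAlgebraicCurve Y)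
    (hL : IsLNE Y) : IsLNE X := by
  rcases X.subsingleton_or_nontrivial with hsub | hnt
  · exact isLNE_of_subsingleton hsub
  obtain ⟨hbij, -, g, hgh, -, hgc⟩ := hh.1
  have hYconn := hL.isPreconnected
  have hXconn : IsPreconnected X := by
    have e : g '' Y = X := by
      rw [← hbij.image_eq, image_image]
      exact (image_congr hgh).trans (image_id' X)
    exact e ▸ hYconn.image g hgc
  have hYnt : Y.Nontrivial := hbij.image_eq ▸ hnt.image_of_injOn hbij.injOn
  have hXg := hX.isGraphCurve fun x hx =>
    accPt_iff_frequently_nhdsNE.1 (hXconn.preperfect_of_nontrivial hnt x hx)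
  have hYg := hY.isGraphCurve fun y hy =>
    accPt_iff_frequently_nhdsNE.1 (hYconn.preperfect_of_nontrivial hYnt y hy)
  exact isLNE_of_isSheeted hXg hXconn
    (fun p hp j v hv => hh.isSheeted_finite hXg hYg (fun c v j hv => hL.isSheeted hYg true c hv)
      hp hv)
    (fun j v hv => hh.isSheeted_inf hXg hYg (fun v j hv => hL.isSheeted hYg false 0 hv) hv)

/-- a complex algebraic curve is LNE if and only if it is blow-spherical
homeomorphic to an LNE complex algebraic curve. -/
theorem lne_iff_bs_homeo_to_lne {n : ℕ} (X : Set (EuclideanSpace ℂ (Fin n)))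
    (hX : IsComplexAlgebraicCurve X) :
    IsLNE X ↔ ∃ (m : ℕ) (Y : Set (EuclideanSpace ℂ (Fin m))),
      IsComplexAlgebraicCurve Y ∧ IsLNE Y ∧
      ∃ h : EuclideanSpace ℂ (Fin n) → EuclideanSpace ℂ (Fin m), IsBSHomeo h X Y := by
  exact ⟨fun h => ⟨n, X, hX, h, id, isBSHomeo_id⟩,
    fun ⟨_, _, hY, hL, _, hh⟩ => hh.isLNE hX hY hL⟩

end
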